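/- arXiv:2503.06020 — 2 statements merged into one kernel-verified Lean document; each statement's English description precedes it below -/
import Mathlib

section
/- Theorem 3.1 (elimination of Allee effects in heterogeneous environments). Assume f satisfies condition (f4) with lower bound f̲ of Allee type (f_A), δ ∈ (θ*_{f̲}, 1), and (c̲*, q̲*) is a semi-wave pair for (f̲, δ, d). Let (u,g,h) be a classical solution of the free boundary problem (c) with initial datum u₀ ∈ X(h₀) on [0,∞). Then: (1) g(t) → −∞ and h(t) → +∞ as t → ∞, and u(t,x) → 1 locally uniformly in x ∈ ℝ; (2) there exists a constant M₀ > 0 such that [−c̲*·t + M₀, c̲*·t − M₀] ⊆ [g(t), h(t)] for all t > 0 for which the left interval is nonempty; (3) for every ε ∈ (0, c̲*), sup_{x ∈ [−(c̲*−ε)t, (c̲*−ε)t]} |u(t,x) − 1| → 0 as t → ∞. -/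
open Set Filter

/-- A function `f` is of Allee type `(f_A)` with distinguished zero `θ ∈ [0,1)`. -/
def AlleeType (f : ℝ → ℝ) (θ : ℝ) : Prop :=
  ContDiffOn ℝ 1 f (Ici (0:ℝ)) ∧ θ ∈ Ico (0:ℝ) 1 ∧
    f 0 = 0 ∧ f θ = 0 ∧ f 1 = 0 ∧
    derivWithin f (Ici (0:ℝ)) 0 ≤ 0 ∧ derivWithin f (Ici (0:ℝ)) 1 < 0 ∧
    (∀ u ∈ Icc (0:ℝ) θ, f u ≤ 0) ∧ (∀ u ∈ Ioo θ (1:ℝ), 0 < f u) ∧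
    (∀ u ∈ Ioi (1:ℝ), f u < 0) ∧ 0 < ∫ s in (0:ℝ)..1, f s

/-- `θs` is the number `θ*_f ∈ [θ,1)` attached to an Allee type `f`. -/
def IsThetaStar (f : ℝ → ℝ) (θ θs : ℝ) : Prop :=
  θs ∈ Ico θ (1:ℝ) ∧ (∫ s in (0:ℝ)..θs, f s) = 0 ∧
    ∀ u ∈ Ioc θs (1:ℝ), 0 < ∫ s in (0:ℝ)..u, f s

/-- Membership in the initial class `X(h₀)`. -/
def InX (δ h₀ : ℝ) (φ : ℝ → ℝ) : Prop :=
  ContDiffOn ℝ 2 φ (Icc (-h₀) h₀) ∧ φ (-h₀) = δ ∧ φ h₀ = δ ∧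
    ∀ x ∈ Icc (-h₀) h₀, 0 < φ x

/-- A classical solution `(u,g,h)` of the free boundary problem (with reaction
term `f = f(t,x,u)`) with initial datum `u₀ ∈ X(h₀)` on the time interval `I`. -/
structure ClassicalSolution (d δ h₀ : ℝ) (f : ℝ → ℝ → ℝ → ℝ) (u₀ : ℝ → ℝ)
    (I : Set ℝ) (u : ℝ → ℝ → ℝ) (g h : ℝ → ℝ) : Prop where
  g_reg : ContDiffOn ℝ 1 g I
  h_reg : ContDiffOn ℝ 1 h I
  g_lt_h : ∀ t ∈ I, g t < h t
  u_cont : ContinuousOn (fun p : ℝ × ℝ => u p.1 p.2)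
      {p : ℝ × ℝ | p.1 ∈ I ∧ p.2 ∈ Icc (g p.1) (h p.1)}
  ux_cont : ContinuousOn (fun p : ℝ × ℝ => deriv (u p.1) p.2)
      {p : ℝ × ℝ | p.1 ∈ I ∧ 0 < p.1 ∧ p.2 ∈ Icc (g p.1) (h p.1)}
  ut_diff : ∀ t ∈ I, 0 < t → ∀ x ∈ Ioo (g t) (h t),
      DifferentiableAt ℝ (fun s => u s x) t
  ux_diff : ∀ t ∈ I, 0 < t → ∀ x ∈ Icc (g t) (h t), DifferentiableAt ℝ (u t) x
  uxx_diff : ∀ t ∈ I, 0 < t → ∀ x ∈ Ioo (g t) (h t),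
      DifferentiableAt ℝ (deriv (u t)) x
  ut_cont : ContinuousOn (fun p : ℝ × ℝ => deriv (fun s => u s p.2) p.1)
      {p : ℝ × ℝ | p.1 ∈ I ∧ 0 < p.1 ∧ p.2 ∈ Ioo (g p.1) (h p.1)}
  uxx_cont : ContinuousOn (fun p : ℝ × ℝ => deriv (deriv (u p.1)) p.2)
      {p : ℝ × ℝ | p.1 ∈ I ∧ 0 < p.1 ∧ p.2 ∈ Ioo (g p.1) (h p.1)}
  pde : ∀ t ∈ I, 0 < t → ∀ x ∈ Ioo (g t) (h t),
      deriv (fun s => u s x) t = d * deriv (deriv (u t)) x + f t x (u t x)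
  bc_g : ∀ t ∈ I, 0 < t → u t (g t) = δ
  bc_h : ∀ t ∈ I, 0 < t → u t (h t) = δ
  stefan_g : ∀ t ∈ I, 0 < t → deriv g t = -(d / δ) * deriv (u t) (g t)
  stefan_h : ∀ t ∈ I, 0 < t → deriv h t = -(d / δ) * deriv (u t) (h t)
  g_init : g 0 = -h₀
  h_init : h 0 = h₀
  u_init : ∀ x ∈ Icc (-h₀) h₀, u 0 x = u₀ x

/-- A semi-wave pair `(c,q)` for `(f, δ, d)`. -/
def SemiWavePair (d δ : ℝ) (f : ℝ → ℝ) (c : ℝ) (q : ℝ → ℝ) : Prop :=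
  0 < c ∧ ContDiffOn ℝ 2 q (Ici (0:ℝ)) ∧
    (∀ z ∈ Ici (0:ℝ),
      d * derivWithin (derivWithin q (Ici (0:ℝ))) (Ici (0:ℝ)) z
        - c * derivWithin q (Ici (0:ℝ)) z + f (q z) = 0) ∧
    (∀ z ∈ Ioi (0:ℝ), 0 < q z) ∧ q 0 = δ ∧
    Tendsto q atTop (nhds 1) ∧
    derivWithin q (Ici (0:ℝ)) 0 = c * δ / d ∧
    ∀ z ∈ Ici (0:ℝ), 0 < derivWithin q (Ici (0:ℝ)) z

/-- Condition `(f2)` with Hölder exponent `β`. -/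
def CondF2 (f : ℝ → ℝ → ℝ → ℝ) (β : ℝ) : Prop :=
  β ∈ Ioo (0:ℝ) 1 ∧
    (∀ M > 0, ∃ C > 0, ∀ t₁ ∈ Ici (0:ℝ), ∀ t₂ ∈ Ici (0:ℝ), ∀ x₁ x₂ : ℝ,
        ∀ v ∈ Icc (0:ℝ) M,
        |f t₁ x₁ v - f t₂ x₂ v| ≤ C * (|t₁ - t₂| ^ (β / 2) + |x₁ - x₂| ^ β)) ∧
    (∀ t ∈ Ici (0:ℝ), ∀ x : ℝ, ContDiffOn ℝ 1 (f t x) (Ici (0:ℝ))) ∧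
    (∀ t ∈ Ici (0:ℝ), ∀ x : ℝ, f t x 0 = 0) ∧
    (∀ M > 0, ∃ L > 0, ∀ t ∈ Ici (0:ℝ), ∀ x : ℝ,
        ∀ v₁ ∈ Icc (0:ℝ) M, ∀ v₂ ∈ Icc (0:ℝ) M,
        |f t x v₁ - f t x v₂| ≤ L * |v₁ - v₂|)

/-- Condition `(f3)` with constant `M₀`. -/
def CondF3 (f : ℝ → ℝ → ℝ → ℝ) (M₀ : ℝ) : Prop :=
  0 < M₀ ∧ ∀ t ∈ Ici (0:ℝ), ∀ x : ℝ, ∀ v, M₀ ≤ v → f t x v < 0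

/-- Part (i) of condition `(f4)`, with upper bound function `fbar`. -/
def CondF4i (f : ℝ → ℝ → ℝ → ℝ) (fbar : ℝ → ℝ) (β : ℝ) : Prop :=
  CondF2 f β ∧ (∀ t ∈ Ici (0:ℝ), ∀ x : ℝ, f t x 1 = 0) ∧
    ContinuousOn fbar (Ici (1:ℝ)) ∧
    ∀ t ∈ Ici (0:ℝ), ∀ x : ℝ, ∀ v, 1 < v → f t x v ≤ fbar v ∧ fbar v < 0

/-- Condition `(f4)`, with bounds `fbar` (above, for `u > 1`) and
`funder` (below, of Allee type). -/
def CondF4 (f : ℝ → ℝ → ℝ → ℝ) (fbar funder : ℝ → ℝ) (θ β : ℝ) : Prop :=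
  CondF4i f fbar β ∧ AlleeType funder θ ∧
    ∀ t ∈ Ici (0:ℝ), ∀ x : ℝ, ∀ v, 0 ≤ v → funder v ≤ f t x v

/-- Combustion-type nonlinearity `(f_c)` with ignition value `θ`. -/
def CombustionType (f : ℝ → ℝ) (θ : ℝ) : Prop :=
  ContDiffOn ℝ 1 f (Ici (0:ℝ)) ∧ θ ∈ Ioo (0:ℝ) 1 ∧
    (∀ u ∈ Icc (0:ℝ) θ, f u = 0) ∧ f 1 = 0 ∧ derivWithin f (Ici (0:ℝ)) 1 < 0 ∧
    (∀ u ∈ Ioo θ (1:ℝ), 0 < f u) ∧ (∀ u ∈ Ioi (1:ℝ), f u < 0)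

/-- The (unnormalised) bistable condition `(F_b)` with constants `0 < P < Q`. -/
def CondFb (F : ℝ → ℝ) (P Q : ℝ) : Prop :=
  0 < P ∧ P < Q ∧ ContDiffOn ℝ 1 F (Ici (0:ℝ)) ∧
    F 0 = 0 ∧ F P = 0 ∧ F Q = 0 ∧
    derivWithin F (Ici (0:ℝ)) 0 < 0 ∧ derivWithin F (Ici (0:ℝ)) Q < 0 ∧
    (∀ u ∈ Ioo (0:ℝ) P, F u < 0) ∧ (∀ u ∈ Ioi Q, F u < 0) ∧
    (∀ u ∈ Ioo P Q, 0 < F u) ∧ 0 < ∫ s in (0:ℝ)..Q, F s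

/-- The space-time domain between two curves is compact. -/
theorem hs_dom_compact {T0 T : ℝ} {a b : ℝ → ℝ} (ha : ContinuousOn a (Icc T0 T))
    (hb : ContinuousOn b (Icc T0 T)) :
    IsCompact {p : ℝ × ℝ | p.1 ∈ Icc T0 T ∧ p.2 ∈ Icc (a p.1) (b p.1)} := by
  obtain ⟨A, hA⟩ := (isCompact_Icc.image_of_continuousOn ha).bddBelow
  obtain ⟨B, hB⟩ := (isCompact_Icc.image_of_continuousOn hb).bddAbove
  have hcl : IsClosed {p : ℝ × ℝ | p.1 ∈ Icc T0 T} := isClosed_Icc.preimage continuous_fst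
  have h1 : ContinuousOn (fun p : ℝ × ℝ => p.2 - a p.1) {p : ℝ × ℝ | p.1 ∈ Icc T0 T} :=
    continuousOn_snd.sub (ha.comp continuousOn_fst (fun p hp => hp))
  have h2 : ContinuousOn (fun p : ℝ × ℝ => b p.1 - p.2) {p : ℝ × ℝ | p.1 ∈ Icc T0 T} :=
    (hb.comp continuousOn_fst (fun p hp => hp)).sub continuousOn_snd
  have c1 := h1.preimage_isClosed_of_isClosed hcl (isClosed_Ici (a := (0:ℝ)))
  have c2 := h2.preimage_isClosed_of_isClosed hcl (isClosed_Ici (a := (0:ℝ)))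
  have hc := c1.inter c2
  refine ((isCompact_Icc (a := T0) (b := T)).prod (isCompact_Icc (a := A) (b := B))).of_isClosed_subset
    (?_ : IsClosed _) ?_
  · convert hc using 1
    ext p
    simp only [mem_ofPred_eq, mem_inter_iff, mem_preimage, mem_Ici, sub_nonneg, mem_Icc]
    tauto
  · rintro p ⟨hp1, hp2⟩
    exact ⟨hp1, (hA (mem_image_of_mem a hp1)).trans hp2.1, hp2.2.trans (hB (mem_image_of_mem b hp1))⟩

/-- First touching principle. -/
theorem hs_touch {T0 T : ℝ} {a b : ℝ → ℝ} {v : ℝ → ℝ → ℝ} (ha : ContinuousOn a (Icc T0 T))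
    (hb : ContinuousOn b (Icc T0 T))
    (hv : ContinuousOn (fun p : ℝ × ℝ => v p.1 p.2)
      {p : ℝ × ℝ | p.1 ∈ Icc T0 T ∧ p.2 ∈ Icc (a p.1) (b p.1)})
    (hini : ∀ x ∈ Icc (a T0) (b T0), 0 < v T0 x)
    (hla : ∀ t ∈ Ioc T0 T, a t ≤ b t → 0 < v t (a t))
    (hlb : ∀ t ∈ Ioc T0 T, a t ≤ b t → 0 < v t (b t))
    (hint : ∀ t ∈ Ioc T0 T, ∀ x ∈ Ioo (a t) (b t), v t x = 0 →
      (∀ y ∈ Icc (a t) (b t), 0 ≤ v t y) →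
      (∀ᶠ τ in nhdsWithin t (Iio t), 0 ≤ v τ x) → False) :
    ∀ t ∈ Icc T0 T, ∀ x ∈ Icc (a t) (b t), 0 < v t x := by
  by_contra hcon
  push Not at hcon
  obtain ⟨t₁, ht₁, x₁, hx₁, hv₁⟩ := hcon
  set D := {p : ℝ × ℝ | p.1 ∈ Icc T0 T ∧ p.2 ∈ Icc (a p.1) (b p.1)} with hD
  have hDc : IsCompact D := hs_dom_compact ha hb
  have hScl : IsClosed (D ∩ (fun p : ℝ × ℝ => v p.1 p.2) ⁻¹' Iic 0) :=
    hv.preimage_isClosed_of_isClosed hDc.isClosed isClosed_Iic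
  have hSc := hDc.of_isClosed_subset hScl inter_subset_left
  obtain ⟨⟨t, x⟩, ⟨hpD, hpv⟩, hmin⟩ := hSc.exists_isMinOn ⟨(t₁, x₁), ⟨ht₁, hx₁⟩, hv₁⟩
    (continuous_fst.continuousOn)
  have hpt : t ∈ Icc T0 T := hpD.1
  have hpx : x ∈ Icc (a t) (b t) := hpD.2
  have hpv' : v t x ≤ 0 := hpv
  have hbefore : ∀ τ ∈ Icc T0 T, τ < t → ∀ y ∈ Icc (a τ) (b τ), 0 < v τ y := by
    intro τ hτ hlt y hy
    by_contra hneg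
    have := hmin (a := (τ, y)) ⟨⟨hτ, hy⟩, not_lt.1 hneg⟩
    simp only [mem_ofPred_eq] at this
    linarith
  have hT0 : T0 < t := by
    rcases hpt.1.eq_or_lt with h | h
    · exfalso; subst h; have := hini x hpx; linarith
    · exact h
  have htI : t ∈ Ioc T0 T := ⟨hT0, hpt.2⟩
  have hev : ∀ᶠ τ in nhdsWithin t (Iio t), τ ∈ Icc T0 T ∧ τ < t := by
    filter_upwards [Ioo_mem_nhdsLT hT0] with τ hτ
    exact ⟨⟨hτ.1.le, hτ.2.le.trans hpt.2⟩, hτ.2⟩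
  have hle : nhdsWithin t (Iio t) ≤ nhdsWithin t (Icc T0 T) :=
    tendsto_id'.1 (tendsto_nhdsWithin_iff.2 ⟨tendsto_id.mono_left nhdsWithin_le_nhds, hev.mono fun τ h => h.1⟩)
  have hyD : ∀ y ∈ Ioo (a t) (b t), ∀ᶠ τ in nhdsWithin t (Iio t), (τ, y) ∈ D ∧ τ < t := by
    intro y hy
    have e1 := ((ha t hpt).mono_left hle).eventually_lt_const hy.1
    have e2 := ((hb t hpt).mono_left hle).eventually_const_lt hy.2
    filter_upwards [e1, e2, hev] with τ h1 h2 h3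
    exact ⟨⟨h3.1, h1.le, h2.le⟩, h3.2⟩
  have hnn : ∀ y ∈ Ioo (a t) (b t), 0 ≤ v t y := by
    intro y hy
    have hc : Tendsto (fun τ => v τ y) (nhdsWithin t (Iio t)) (nhds (v t y)) := by
      have h1 : ContinuousWithinAt (fun p : ℝ × ℝ => v p.1 p.2) D (t, y) :=
        hv (t, y) ⟨hpt, Ioo_subset_Icc_self hy⟩
      have h2 : Tendsto (fun τ : ℝ => (τ, y)) (nhdsWithin t (Iio t)) (nhdsWithin (t, y) D) := by
        refine tendsto_nhdsWithin_iff.2 ⟨?_, (hyD y hy).mono fun τ h => h.1⟩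
        exact ((continuous_id.prodMk continuous_const).tendsto t).mono_left nhdsWithin_le_nhds
      exact h1.tendsto.comp h2
    refine ge_of_tendsto hc ?_
    filter_upwards [hyD y hy] with τ hτ
    exact (hbefore τ hτ.1.1 hτ.2 y hτ.1.2).le
  have hab : a t ≤ b t := hpx.1.trans hpx.2
  have hxI : x ∈ Ioo (a t) (b t) := by
    refine ⟨lt_of_le_of_ne hpx.1 ?_, lt_of_le_of_ne hpx.2 ?_⟩
    · intro h; have := hla t htI hab; rw [h] at this; linarith
    · intro h; have := hlb t htI hab; rw [← h] at this; linarith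
  refine hint t htI x hxI (le_antisymm hpv' (hnn x hxI)) ?_ ?_
  · intro y hy
    rcases hy.1.eq_or_lt with h | h
    · rw [← h]; exact (hla t htI hab).le
    · rcases hy.2.eq_or_lt with h' | h'
      · rw [h']; exact (hlb t htI hab).le
      · exact hnn y ⟨h, h'⟩
  · filter_upwards [hyD x hxI] with τ hτ
    exact (hbefore τ hτ.1.1 hτ.2 x hτ.1.2).le

/-- Time derivative at a first touching point. -/
theorem hs_time_deriv {v : ℝ → ℝ} {t v' : ℝ} (hv : HasDerivAt v v' t) (h0 : v t = 0)
    (h : ∀ᶠ τ in nhdsWithin t (Iio t), 0 ≤ v τ) : v' ≤ 0 := by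
  have h1 : Tendsto (slope v t) (nhdsWithin t (Iio t)) (nhds v') :=
    (hasDerivAt_iff_tendsto_slope.1 hv).mono_left (nhdsWithin_mono _ (fun y hy => ne_of_lt hy))
  refine le_of_tendsto h1 ?_
  filter_upwards [h, self_mem_nhdsWithin] with τ h2 h3
  rw [slope_def_field, h0]
  have : τ - t < 0 := sub_neg.2 h3
  exact div_nonpos_of_nonneg_of_nonpos (by linarith) this.le

/-- Second order necessary condition. -/
theorem hs_second {φ φ1 : ℝ → ℝ} {x A : ℝ} (h1 : ∀ᶠ y in nhds x, HasDerivAt φ (φ1 y) y)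
    (h2 : HasDerivAt φ1 A x) (hm : IsLocalMin φ x) : φ1 x = 0 ∧ 0 ≤ A := by
  have hx := h1.self_of_nhds
  have h0 : φ1 x = 0 := hm.hasDerivAt_eq_zero hx
  refine ⟨h0, ?_⟩
  by_contra hneg
  push Not at hneg
  have hd : deriv φ =ᶠ[nhds x] φ1 := h1.mono fun y hy => hy.deriv
  have hdd : deriv (deriv φ) x = A := by rw [hd.deriv_eq]; exact h2.deriv
  have hmax := isLocalMax_of_deriv_deriv_neg (f := φ) (x₀ := x) (by rw [hdd]; exact hneg)
    (by rw [hx.deriv, h0]) hx.continuousAt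
  have hconst : φ =ᶠ[nhds x] fun _ => φ x := by
    filter_upwards [hm, hmax] with y h3 h4
    exact le_antisymm h4 h3
  have : deriv φ =ᶠ[nhds x] fun _ => 0 := by
    have := hconst.deriv
    simpa using this
  have h3 : deriv (deriv φ) x = 0 := by rw [this.deriv_eq]; simp
  linarith

/-- The properties of a classical solution used below. -/
structure HsSol (d δ : ℝ) (f : ℝ → ℝ → ℝ → ℝ) (u : ℝ → ℝ → ℝ) (g h : ℝ → ℝ) : Prop where
  gc : ContinuousOn g (Ici 0)
  hc : ContinuousOn h (Ici 0)
  gd : ∀ t, 0 < t → HasDerivAt g (-(d / δ) * deriv (u t) (g t)) t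
  hd : ∀ t, 0 < t → HasDerivAt h (-(d / δ) * deriv (u t) (h t)) t
  lt : ∀ t, 0 ≤ t → g t < h t
  uc : ContinuousOn (fun p : ℝ × ℝ => u p.1 p.2)
      {p : ℝ × ℝ | 0 ≤ p.1 ∧ p.2 ∈ Icc (g p.1) (h p.1)}
  ut : ∀ t, 0 < t → ∀ x ∈ Ioo (g t) (h t), DifferentiableAt ℝ (fun s => u s x) t
  ux : ∀ t, 0 < t → ∀ x ∈ Icc (g t) (h t), DifferentiableAt ℝ (u t) x
  uxx : ∀ t, 0 < t → ∀ x ∈ Ioo (g t) (h t), DifferentiableAt ℝ (deriv (u t)) x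
  pde : ∀ t, 0 < t → ∀ x ∈ Ioo (g t) (h t),
      deriv (fun s => u s x) t = d * deriv (deriv (u t)) x + f t x (u t x)
  bcg : ∀ t, 0 < t → u t (g t) = δ
  bch : ∀ t, 0 < t → u t (h t) = δ
  ini : ∀ x ∈ Icc (g 0) (h 0), 0 < u 0 x

/-- The properties of the reaction term used below. -/
structure HsF (f : ℝ → ℝ → ℝ → ℝ) (fbar fu : ℝ → ℝ) : Prop where
  low : ∀ t, 0 ≤ t → ∀ x v, 0 ≤ v → fu v ≤ f t x v
  up : ∀ t, 0 ≤ t → ∀ x v, 1 < v → f t x v ≤ fbar v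
  lip : ∀ M > 0, ∃ L > 0, ∀ t, 0 ≤ t → ∀ x, ∀ v ∈ Icc (0:ℝ) M, -(L * v) ≤ f t x v

/-- Reflection of a solution. -/
theorem HsSol.refl {d δ : ℝ} {f : ℝ → ℝ → ℝ → ℝ} {u : ℝ → ℝ → ℝ} {g h : ℝ → ℝ}
    (S : HsSol d δ f u g h) :
    HsSol d δ (fun t x v => f t (-x) v) (fun t x => u t (-x)) (fun t => -h t) (fun t => -g t) := by
  have key : ∀ t x, deriv (fun y => u t (-y)) x = - deriv (u t) (-x) := fun t x => by
    rw [deriv_comp_neg]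
  have key' : ∀ t, deriv (fun y => u t (-y)) = fun x => - deriv (u t) (-x) := fun t =>
    funext (key t)
  have mem : ∀ t x, x ∈ Ioo (-h t) (-g t) → -x ∈ Ioo (g t) (h t) := fun t x hx =>
    ⟨by linarith [hx.2], by linarith [hx.1]⟩
  have mem' : ∀ t x, x ∈ Icc (-h t) (-g t) → -x ∈ Icc (g t) (h t) := fun t x hx =>
    ⟨by linarith [hx.2], by linarith [hx.1]⟩
  refine ⟨S.hc.neg, S.gc.neg, ?_, ?_, ?_, ?_, ?_, ?_, ?_, ?_, ?_, ?_, ?_⟩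
  · intro t ht
    simp only [key, neg_neg]
    exact (S.hd t ht).neg.congr_deriv (by ring)
  · intro t ht
    simp only [key, neg_neg]
    exact (S.gd t ht).neg.congr_deriv (by ring)
  · intro t ht; have := S.lt t ht; linarith
  · exact S.uc.comp (f := fun p : ℝ × ℝ => (p.1, -p.2)) (by fun_prop)
      (fun p hp => ⟨hp.1, mem' _ _ hp.2⟩)
  · intro t ht x hx; exact S.ut t ht _ (mem t x hx)
  · intro t ht x hx
    exact (S.ux t ht _ (mem' t x hx)).comp x (by fun_prop)
  · intro t ht x hx
    rw [key']
    exact ((S.uxx t ht _ (mem t x hx)).comp x (by fun_prop : DifferentiableAt ℝ (fun y : ℝ => -y) x)).neg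
  · intro t ht x hx
    have h1 := S.pde t ht _ (mem t x hx)
    rw [key']
    have h2 : deriv (fun x => -deriv (u t) (-x)) x = deriv (deriv (u t)) (-x) := by
      rw [deriv.fun_neg, deriv_comp_neg (deriv (u t)), neg_neg]
    rw [h2]; exact h1
  · intro t ht; simpa using S.bch t ht
  · intro t ht; simpa using S.bcg t ht
  · intro x hx; exact S.ini _ (mem' 0 x hx)

theorem HsF.refl {f : ℝ → ℝ → ℝ → ℝ} {fbar fu : ℝ → ℝ} (F : HsF f fbar fu) :
    HsF (fun t x v => f t (-x) v) fbar fu := by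
  refine ⟨fun t ht x => F.low t ht _, fun t ht x => F.up t ht _, fun M hM => ?_⟩
  obtain ⟨L, hL, h⟩ := F.lip M hM
  exact ⟨L, hL, fun t ht x => h t ht _⟩

section
variable {d δ : ℝ} {f : ℝ → ℝ → ℝ → ℝ} {u : ℝ → ℝ → ℝ} {g h : ℝ → ℝ}

/-- Lower barrier comparison. -/
theorem HsSol.lower (S : HsSol d δ f u g h) (hd : 0 < d) {T0 T : ℝ} (hT0 : 0 ≤ T0)
    {a b : ℝ → ℝ} {w wt w1 w2 : ℝ → ℝ → ℝ}
    (ha : ContinuousOn a (Icc T0 T)) (hb : ContinuousOn b (Icc T0 T))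
    (hga : ∀ t ∈ Icc T0 T, g t ≤ a t) (hbh : ∀ t ∈ Icc T0 T, b t ≤ h t)
    (hw : ContinuousOn (fun p : ℝ × ℝ => w p.1 p.2)
      {p : ℝ × ℝ | p.1 ∈ Icc T0 T ∧ p.2 ∈ Icc (a p.1) (b p.1)})
    (hini : ∀ x ∈ Icc (a T0) (b T0), w T0 x < u T0 x)
    (hla : ∀ t ∈ Ioc T0 T, a t ≤ b t → w t (a t) < u t (a t))
    (hlb : ∀ t ∈ Ioc T0 T, a t ≤ b t → w t (b t) < u t (b t))
    (hwt : ∀ t ∈ Ioc T0 T, ∀ x ∈ Ioo (a t) (b t), HasDerivAt (fun s => w s x) (wt t x) t)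
    (hw1 : ∀ t ∈ Ioc T0 T, ∀ x ∈ Ioo (a t) (b t), HasDerivAt (w t) (w1 t x) x)
    (hw2 : ∀ t ∈ Ioc T0 T, ∀ x ∈ Ioo (a t) (b t), HasDerivAt (w1 t) (w2 t x) x)
    (hsub : ∀ t ∈ Ioc T0 T, ∀ x ∈ Ioo (a t) (b t), u t x = w t x →
      wt t x < d * w2 t x + f t x (u t x)) :
    ∀ t ∈ Icc T0 T, ∀ x ∈ Icc (a t) (b t), w t x < u t x := by
  have main := hs_touch (v := fun t x => u t x - w t x) ha hb ?_ ?_ ?_ ?_ ?_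
  · intro t ht x hx; have := main t ht x hx; linarith
  · refine (S.uc.mono ?_).sub hw
    rintro p ⟨hp1, hp2⟩
    exact ⟨hT0.trans hp1.1, (hga _ hp1).trans hp2.1, hp2.2.trans (hbh _ hp1)⟩
  · intro x hx; linarith [hini x hx]
  · intro t ht hab; linarith [hla t ht hab]
  · intro t ht hab; linarith [hlb t ht hab]
  · intro t ht x hx h0 hnn hev
    have ht0 : 0 < t := hT0.trans_lt ht.1
    have htI : t ∈ Icc T0 T := Ioc_subset_Icc_self ht
    have hsubset : ∀ y ∈ Ioo (a t) (b t), y ∈ Ioo (g t) (h t) := fun y hy =>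
      ⟨(hga t htI).trans_lt hy.1, hy.2.trans_le (hbh t htI)⟩
    have hxI := hsubset x hx
    have hnb : Ioo (a t) (b t) ∈ nhds x := Ioo_mem_nhds hx.1 hx.2
    have e1 := hs_time_deriv ((S.ut t ht0 x hxI).hasDerivAt.sub (hwt t ht x hx)) h0 hev
    have e2 := hs_second (φ := fun y => u t y - w t y) (φ1 := fun y => deriv (u t) y - w1 t y)
      (x := x) (A := deriv (deriv (u t)) x - w2 t x)
      (by
        filter_upwards [hnb] with y hy
        exact (S.ux t ht0 y (Ioo_subset_Icc_self (hsubset y hy))).hasDerivAt.sub (hw1 t ht y hy))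
      ((S.uxx t ht0 x hxI).hasDerivAt.sub (hw2 t ht x hx))
      (by
        filter_upwards [hnb] with y hy
        have := hnn y (Ioo_subset_Icc_self hy)
        change _ ≤ _
        linarith)
    have e3 := S.pde t ht0 x hxI
    have e4 := hsub t ht x hx (by linarith)
    have e5 := e2.2
    nlinarith

/-- Upper barrier comparison with a space-independent barrier. -/
theorem HsSol.upper (S : HsSol d δ f u g h) (hd : 0 < d) {T : ℝ}
    {w wt : ℝ → ℝ}
    (hini : ∀ x ∈ Icc (g 0) (h 0), u 0 x < w 0)
    (hl : ∀ t ∈ Ioc 0 T, δ < w t)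
    (hwt : ∀ t, HasDerivAt w (wt t) t)
    (hsub : ∀ t ∈ Ioc 0 T, ∀ x ∈ Ioo (g t) (h t), u t x = w t →
      f t x (u t x) < wt t) :
    ∀ t ∈ Icc 0 T, ∀ x ∈ Icc (g t) (h t), u t x < w t := by
  have main := hs_touch (T0 := 0) (T := T) (v := fun t x => w t - u t x)
    (S.gc.mono Icc_subset_Ici_self) (S.hc.mono Icc_subset_Ici_self) ?_ ?_ ?_ ?_ ?_
  · intro t ht x hx; have := main t ht x hx; linarith
  · have hwc : Continuous w := continuous_iff_continuousAt.2 fun t => (hwt t).continuousAt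
    refine ContinuousOn.sub (by fun_prop) (S.uc.mono ?_)
    rintro p ⟨hp1, hp2⟩
    exact ⟨hp1.1, hp2⟩
  · intro x hx; linarith [hini x hx]
  · intro t ht hab; rw [S.bcg t ht.1]; linarith [hl t ht]
  · intro t ht hab; rw [S.bch t ht.1]; linarith [hl t ht]
  · intro t ht x hx h0 hnn hev
    have ht0 : 0 < t := ht.1
    have hnb : Ioo (g t) (h t) ∈ nhds x := Ioo_mem_nhds hx.1 hx.2
    have e1 := hs_time_deriv ((hwt t).sub (S.ut t ht0 x hx).hasDerivAt) h0 hev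
    have e2 := hs_second (φ := fun y => w t - u t y) (φ1 := fun y => - deriv (u t) y)
      (x := x) (A := - deriv (deriv (u t)) x)
      (by
        filter_upwards [hnb] with y hy
        exact (S.ux t ht0 y (Ioo_subset_Icc_self hy)).hasDerivAt.const_sub (w t))
      ((S.uxx t ht0 x hx).hasDerivAt.neg)
      (by
        filter_upwards [hnb] with y hy
        have := hnn y (Ioo_subset_Icc_self hy)
        change _ ≤ _
        linarith)
    have e3 := S.pde t ht0 x hx
    have e4 := hsub t ht x hx (by linarith)
    have e5 := e2.2
    nlinarith

/-- The solution is bounded on bounded time intervals. -/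
theorem HsSol.dom_compact (S : HsSol d δ f u g h) (T : ℝ) :
    IsCompact {p : ℝ × ℝ | p.1 ∈ Icc 0 T ∧ p.2 ∈ Icc (g p.1) (h p.1)} :=
  hs_dom_compact (S.gc.mono Icc_subset_Ici_self) (S.hc.mono Icc_subset_Ici_self)

theorem HsSol.uc' (S : HsSol d δ f u g h) (T : ℝ) :
    ContinuousOn (fun p : ℝ × ℝ => u p.1 p.2)
      {p : ℝ × ℝ | p.1 ∈ Icc 0 T ∧ p.2 ∈ Icc (g p.1) (h p.1)} :=
  S.uc.mono fun _ hp => ⟨hp.1.1, hp.2⟩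

theorem HsSol.uc_slice (S : HsSol d δ f u g h) {t : ℝ} (ht : 0 ≤ t) :
    ContinuousOn (u t) (Icc (g t) (h t)) :=
  S.uc.comp (f := fun y : ℝ => (t, y)) (by fun_prop) (fun y hy => ⟨ht, hy⟩)

/-- Positivity. -/
theorem HsSol.pos (S : HsSol d δ f u g h) (hd : 0 < d) (hδ : 0 < δ) {fbar fu : ℝ → ℝ}
    (F : HsF f fbar fu) : ∀ t, 0 ≤ t → ∀ x ∈ Icc (g t) (h t), 0 < u t x := by
  intro T hT x hx
  obtain ⟨M, hM⟩ := ((S.dom_compact T).image_of_continuousOn (S.uc' T)).bddAbove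
  obtain ⟨x₀, hx₀, hmin⟩ := (isCompact_Icc (a := g 0) (b := h 0)).exists_isMinOn
    ⟨g 0, left_mem_Icc.2 (S.lt 0 le_rfl).le⟩ (S.uc_slice le_rfl)
  set m := min (u 0 x₀) δ / 2 with hm
  have hmin0 : 0 < min (u 0 x₀) δ := lt_min (S.ini x₀ hx₀) hδ
  have hm0 : 0 < m := by positivity
  have hm1 : m < u 0 x₀ := by have := min_le_left (u 0 x₀) δ; linarith
  have hm2 : m < δ := by have := min_le_right (u 0 x₀) δ; linarith
  obtain ⟨L, hL, hLf⟩ := F.lip (max M 1) (by positivity)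
  have hexp : ∀ t, HasDerivAt (fun s => m * Real.exp (-(L + 1) * s))
      (m * (Real.exp (-(L + 1) * t) * (-(L + 1)))) t := fun t => by
    have := (((hasDerivAt_id t).const_mul (-(L+1))).exp).const_mul m
    simpa using this
  have hle : ∀ t, 0 ≤ t → m * Real.exp (-(L + 1) * t) ≤ m := fun t ht => by
    have : Real.exp (-(L + 1) * t) ≤ 1 := Real.exp_le_one_iff.2 (by nlinarith)
    nlinarith
  have main := S.lower hd (T0 := 0) (T := T) le_rfl (a := g) (b := h)
    (w := fun t _ => m * Real.exp (-(L + 1) * t))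
    (wt := fun t _ => m * (Real.exp (-(L + 1) * t) * (-(L + 1)))) (w1 := fun _ _ => 0)
    (w2 := fun _ _ => 0)
    (S.gc.mono Icc_subset_Ici_self) (S.hc.mono Icc_subset_Ici_self)
    (fun _ _ => le_rfl) (fun _ _ => le_rfl) (by fun_prop) ?_ ?_ ?_
    (fun t _ x _ => hexp t) (fun t _ x _ => hasDerivAt_const _ _)
    (fun t _ x _ => hasDerivAt_const _ _) ?_
  · have := main T ⟨hT, le_rfl⟩ x hx
    refine lt_trans ?_ this
    positivity
  · intro y hy
    have := hmin hy
    simp only [mem_ofPred_eq] at this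
    linarith [hle 0 le_rfl]
  · intro t ht _; rw [S.bcg t ht.1]; linarith [hle t ht.1.le]
  · intro t ht _; rw [S.bch t ht.1]; linarith [hle t ht.1.le]
  · intro t ht y hy huw
    have hp : 0 < m * Real.exp (-(L + 1) * t) := by positivity
    have hb : u t y ≤ max M 1 := le_max_of_le_left
      (hM ⟨(t, y), ⟨Ioc_subset_Icc_self ht, Ioo_subset_Icc_self hy⟩, rfl⟩)
    have := hLf t ht.1.le y (u t y) ⟨by rw [huw]; exact hp.le, hb⟩
    rw [huw] at this ⊢
    nlinarith

end

/-- An auxiliary profile: primitive of `min (r / G0) 1`. -/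
theorem hs_H {G0 : ℝ} (hG0 : 0 < G0) : ∃ H : ℝ → ℝ, (∀ y, HasDerivAt H (min (y / G0) 1) y) ∧
    (∀ y, 0 < y → 0 < H y) ∧ ∀ y, 0 ≤ y → 2 * H y ≤ y ^ 2 / G0 := by
  have hc : Continuous fun r : ℝ => min (r / G0) 1 := by fun_prop
  refine ⟨fun y => ∫ r in (0:ℝ)..y, min (r / G0) 1, fun y => ?_, fun y hy => ?_, fun y hy => ?_⟩
  · exact intervalIntegral.integral_hasDerivAt_right (hc.intervalIntegrable _ _)
      hc.stronglyMeasurable.stronglyMeasurableAtFilter hc.continuousAt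
  · refine intervalIntegral.intervalIntegral_pos_of_pos_on (hc.intervalIntegrable _ _) ?_ hy
    intro r hr
    exact lt_min (div_pos hr.1 hG0) one_pos
  · have h1 : (∫ r in (0:ℝ)..y, min (r / G0) 1) ≤ ∫ r in (0:ℝ)..y, r / G0 :=
      intervalIntegral.integral_mono_on hy (hc.intervalIntegrable _ _)
        ((by fun_prop : Continuous fun r : ℝ => r / G0).intervalIntegrable _ _)
        (fun r _ => min_le_left _ _)
    rw [intervalIntegral.integral_div, integral_id] at h1
    simp only
    have : 2 * ((y ^ 2 - 0 ^ 2) / 2 / G0) = y ^ 2 / G0 := by ring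
    linarith

/-- The inverse profile of a slowly moving sub-front. -/
theorem hs_profile {d δ b2 η m : ℝ} {fu : ℝ → ℝ} (hd : 0 < d) (hδ : 0 < δ)
    (hfc : ContinuousOn fu (Ici 0)) (hb2 : b2 ∈ Ioo 0 δ) (hη : 0 < η)
    (hfη : ∀ b ∈ Icc b2 δ, η ≤ fu b) (hm : 0 < m)
    (hFm : ∀ b ∈ Icc 0 b2, m ≤ ∫ r in b..δ, fu r) :
    ∃ (X σ σ' : ℝ → ℝ) (s : ℝ), 0 < s ∧
      (∀ b ∈ Ioo 0 δ, 0 < σ b ∧ HasDerivAt X (-(σ b)⁻¹) b ∧ HasDerivAt σ (σ' b) b ∧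
        s * σ b < d * (σ b * σ' b) + fu b ∧ X b < 0) ∧
      ∀ R, ∃ b1 ∈ Ioo 0 δ, X b1 < -R := by
  set φ : ℝ → ℝ := fun b => fu (max b 0) with hφ
  have hφc : Continuous φ := hfc.comp_continuous (by fun_prop) (fun b => mem_Ici.2 (le_max_right _ _))
  have hφe : ∀ b, 0 ≤ b → φ b = fu b := fun b hb => by simp [hφ, hb]
  set ν := min (η / 2) (m / (2 * δ)) with hν
  have hν0 : 0 < ν := by positivity
  have hνη : ν ≤ η / 2 := min_le_left _ _
  have hνm : ν * δ ≤ m / 2 := by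
    have : ν ≤ m / (2 * δ) := min_le_right _ _
    calc ν * δ ≤ m / (2 * δ) * δ := by gcongr
      _ = m / 2 := by field_simp
  set G0 := m / (2 * d) with hG0
  have hG00 : 0 < G0 := by positivity
  obtain ⟨H, hH1, hH2, hH3⟩ := hs_H hG00
  set G : ℝ → ℝ := fun b => (∫ r in b..δ, (φ r - ν)) / d with hG
  have hψc : Continuous fun r => φ r - ν := by fun_prop
  have hGd : ∀ b, HasDerivAt G (-(φ b - ν) / d) b := fun b =>
    (intervalIntegral.integral_hasDerivAt_left (hψc.intervalIntegrable _ _)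
      hψc.stronglyMeasurable.stronglyMeasurableAtFilter hψc.continuousAt).div_const d
  have hGlow : ∀ b ∈ Icc 0 b2, G0 ≤ G b := by
    intro b hb
    have h1 : (∫ r in b..δ, (φ r - ν)) = (∫ r in b..δ, fu r) - ν * (δ - b) := by
      rw [intervalIntegral.integral_sub (hφc.intervalIntegrable _ _) (by simp)]
      have : (∫ r in b..δ, φ r) = ∫ r in b..δ, fu r := by
        refine intervalIntegral.integral_congr fun r hr => ?_
        rw [uIcc_of_le (hb.2.trans hb2.2.le)] at hr
        exact hφe r (hb.1.trans hr.1)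
      rw [this]; simp; ring
    have h2 := hFm b hb
    have h3 : m / 2 ≤ ∫ r in b..δ, (φ r - ν) := by rw [h1]; nlinarith [hb.1]
    calc G0 = (m / 2) / d := by rw [hG0]; field_simp
      _ ≤ G b := by simp only [hG]; gcongr
  have hGpos : ∀ b ∈ Ico 0 δ, 0 < G b := by
    intro b hb
    by_cases h : b ≤ b2
    · exact hG00.trans_le (hGlow b ⟨hb.1, h⟩)
    · push Not at h
      refine div_pos ?_ hd
      refine intervalIntegral.intervalIntegral_pos_of_pos_on (hψc.intervalIntegrable _ _) ?_ hb.2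
      intro r hr
      rw [hφe r (hb.1.trans hr.1.le)]
      have := hfη r ⟨(h.trans hr.1).le, hr.2.le⟩
      linarith
  -- upper bound of G
  obtain ⟨C1, hC1⟩ := ((isCompact_Icc (a := (0:ℝ)) (b := δ)).image hψc).bddAbove
  set C2 := max C1 1 / d with hC2
  have hC20 : 0 < C2 := by positivity
  have hGup : ∀ b ∈ Ico 0 δ, G b ≤ C2 * (δ - b) := by
    intro b hb
    have h1 : (∫ r in b..δ, (φ r - ν)) ≤ ∫ r in b..δ, max C1 1 := by
      refine intervalIntegral.integral_mono_on hb.2.le (hψc.intervalIntegrable _ _) (by simp) ?_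
      intro r hr
      exact le_max_of_le_left (hC1 ⟨r, ⟨hb.1.trans hr.1, hr.2⟩, rfl⟩)
    simp only [intervalIntegral.integral_const, smul_eq_mul] at h1
    calc G b ≤ ((δ - b) * max C1 1) / d := by simp only [hG]; gcongr
      _ = C2 * (δ - b) := by rw [hC2]; ring
  set p : ℝ → ℝ := fun b => H (G b) with hp
  set p' : ℝ → ℝ := fun b => min (G b / G0) 1 * (-(φ b - ν) / d) with hp'
  have hpd : ∀ b, HasDerivAt p (p' b) b := fun b => (hH1 (G b)).comp b (hGd b)
  have hppos : ∀ b ∈ Ico 0 δ, 0 < p b := fun b hb => hH2 _ (hGpos b hb)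
  have hpf : ∀ b ∈ Ico 0 δ, ν ≤ d * p' b + fu b := by
    intro b hb
    have e : d * p' b = - (min (G b / G0) 1 * (fu b - ν)) := by
      simp only [hp', hφe b hb.1]; field_simp
    rw [e]
    by_cases h : G0 ≤ G b
    · have : min (G b / G0) 1 = 1 := min_eq_right ((one_le_div hG00).2 h)
      rw [this]; linarith
    · have hb2' : b2 ≤ b := by
        by_contra h'
        push Not at h'
        exact h (hGlow b ⟨hb.1, h'.le⟩)
      have h1 := hfη b ⟨hb2', hb.2.le⟩
      have h2 : min (G b / G0) 1 ≤ 1 := min_le_right _ _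
      nlinarith
  set σ : ℝ → ℝ := fun b => Real.sqrt (2 * p b) with hσ
  have hpc : Continuous p := continuous_iff_continuousAt.2 fun b => (hpd b).continuousAt
  have hσc : Continuous σ := by fun_prop
  have hσpos : ∀ b ∈ Ico 0 δ, 0 < σ b := fun b hb =>
    Real.sqrt_pos.2 (by have := hppos b hb; linarith)
  set C := C2 / Real.sqrt G0 with hC
  have hsG : 0 < Real.sqrt G0 := Real.sqrt_pos.2 hG00
  have hC0 : 0 < C := by positivity
  have hσup : ∀ b ∈ Ico 0 δ, σ b ≤ C * (δ - b) := by
    intro b hb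
    have h1 := hH3 (G b) (hGpos b hb).le
    calc σ b ≤ Real.sqrt (G b ^ 2 / G0) := Real.sqrt_le_sqrt h1
      _ = G b / Real.sqrt G0 := by
        rw [Real.sqrt_div (sq_nonneg _), Real.sqrt_sq (hGpos b hb).le]
      _ ≤ (C2 * (δ - b)) / Real.sqrt G0 := by gcongr; exact hGup b hb
      _ = C * (δ - b) := by rw [hC]; ring
  have hσd : ∀ b ∈ Ico 0 δ, HasDerivAt σ (p' b / σ b) b := by
    intro b hb
    have h1 := ((hpd b).const_mul 2).sqrt (by have := hppos b hb; positivity)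
    refine h1.congr_deriv ?_
    rw [mul_div_mul_left _ _ two_ne_zero]
  set X : ℝ → ℝ := fun b => -∫ r in (0:ℝ)..b, (σ r)⁻¹ with hX
  have hτc : ContinuousOn (fun r => (σ r)⁻¹) (Ico 0 δ) :=
    hσc.continuousOn.inv₀ fun r hr => (hσpos r hr).ne'
  have hτi : ∀ b ∈ Ico 0 δ, IntervalIntegrable (fun r => (σ r)⁻¹) MeasureTheory.volume 0 b := by
    intro b hb
    refine ContinuousOn.intervalIntegrable (hτc.mono ?_)
    rw [uIcc_of_le hb.1]
    exact fun r hr => ⟨hr.1, hr.2.trans_lt hb.2⟩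
  have hXd : ∀ b ∈ Ico 0 δ, HasDerivAt X (-(σ b)⁻¹) b := by
    intro b hb
    refine (intervalIntegral.integral_hasDerivAt_right (hτi b hb) ?_ ?_).neg
    · exact hσc.measurable.inv.stronglyMeasurable.stronglyMeasurableAtFilter
    · exact hσc.continuousAt.inv₀ (hσpos b hb).ne'
  refine ⟨X, σ, fun b => p' b / σ b, ν / (C * δ + 1), by positivity, ?_, ?_⟩
  · intro b hb
    have hb' : b ∈ Ico 0 δ := ⟨hb.1.le, hb.2⟩
    refine ⟨hσpos b hb', hXd b hb', hσd b hb', ?_, ?_⟩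
    · have h1 := hpf b hb'
      have h2 : σ b * (p' b / σ b) = p' b := by
        have := (hσpos b hb').ne'; field_simp
      rw [h2]
      refine lt_of_lt_of_le ?_ h1
      have h3 : σ b < C * δ + 1 := by
        have := hσup b hb'
        nlinarith [hb.1]
      have h4 : 0 < C * δ + 1 := by positivity
      calc ν / (C * δ + 1) * σ b < ν / (C * δ + 1) * (C * δ + 1) := by gcongr
        _ = ν := by field_simp
    · have : 0 < ∫ r in (0:ℝ)..b, (σ r)⁻¹ :=
        intervalIntegral.intervalIntegral_pos_of_pos_on (hτi b hb')
          (fun r hr => inv_pos.2 (hσpos r ⟨hr.1.le, hr.2.trans hb.2⟩)) hb.1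
      simp only [hX]; linarith
  · intro R
    -- logarithmic divergence
    have hmono : AntitoneOn (fun b => X b - C⁻¹ * Real.log (δ - b)) (Ico 0 δ) := by
      have hder : ∀ b ∈ Ico 0 δ, HasDerivAt (fun b => X b - C⁻¹ * Real.log (δ - b))
          (-(σ b)⁻¹ - C⁻¹ * (-1 / (δ - b))) b := by
        intro b hb
        have h1 : HasDerivAt (fun b => Real.log (δ - b)) (-1 / (δ - b)) b :=
          ((hasDerivAt_id b).const_sub δ).log (by have := hb.2; simp only [id]; linarith)
        exact (hXd b hb).sub (h1.const_mul C⁻¹)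
      refine antitoneOn_of_deriv_nonpos (convex_Ico _ _)
        (fun b hb => (hder b hb).continuousAt.continuousWithinAt)
        (fun b hb => (hder b (interior_subset hb)).differentiableAt.differentiableWithinAt) ?_
      intro b hb
      have hb' := interior_subset hb
      rw [(hder b hb').deriv]
      have h1 : 0 < δ - b := sub_pos.2 hb'.2
      have h2 := hσup b hb'
      have h3 : (C * (δ - b))⁻¹ ≤ (σ b)⁻¹ := inv_anti₀ (hσpos b hb') h2
      have h4 : C⁻¹ * (-1 / (δ - b)) = - (C * (δ - b))⁻¹ := by field_simp
      rw [h4]; linarith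
    set N := C * (|R| + 1) - Real.log δ with hN
    set y := min (δ / 2) (Real.exp (-N)) with hy
    have hy0 : 0 < y := lt_min (by positivity) (Real.exp_pos _)
    have hyδ : y ≤ δ / 2 := min_le_left _ _
    refine ⟨δ - y, ⟨by linarith, by linarith⟩, ?_⟩
    have h1 := hmono (a := 0) (b := δ - y) ⟨le_rfl, hδ⟩ ⟨by linarith, by linarith⟩ (by linarith)
    have hX0 : X 0 = 0 := by simp [hX]
    simp only [hX0, sub_zero, sub_sub_cancel] at h1
    have h2 : Real.log y ≤ -N := by
      rw [← Real.log_exp (-N)]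
      exact Real.log_le_log hy0 (min_le_right _ _)
    have h3 : C⁻¹ * Real.log y ≤ C⁻¹ * (-N) := by gcongr
    have h4 : C⁻¹ * (-N) = -(|R| + 1) + C⁻¹ * Real.log δ := by rw [hN]; field_simp; ring
    have h5 := le_abs_self R
    linarith

section
variable {d δ : ℝ} {f : ℝ → ℝ → ℝ → ℝ} {u : ℝ → ℝ → ℝ} {g h : ℝ → ℝ}

/-- Asymptotic upper bound. -/
theorem HsSol.upper_lim (S : HsSol d δ f u g h) (hd : 0 < d) (hδ1 : δ < 1) {fbar fu : ℝ → ℝ}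
    (F : HsF f fbar fu) (hfc : ContinuousOn fbar (Ici 1)) (hfn : ∀ v, 1 < v → fbar v < 0)
    {ε : ℝ} (hε : 0 < ε) : ∃ T > 0, ∀ t ≥ T, ∀ x ∈ Icc (g t) (h t), u t x < 1 + ε := by
  obtain ⟨M, hM⟩ := (isCompact_Icc.image_of_continuousOn (S.uc_slice le_rfl)).bddAbove
  set M' := max M 1 with hM'
  have hM'0 : 0 < M' := by positivity
  obtain ⟨v₀, hv₀, hmax⟩ := (isCompact_Icc (a := 1 + ε / 2) (b := 1 + ε / 2 + M')).exists_isMaxOn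
    ⟨1 + ε / 2, left_mem_Icc.2 (by linarith)⟩
    (hfc.mono fun v hv => by simp only [mem_Ici]; linarith [hv.1])
  set k := -(fbar v₀) / (2 * M') with hk
  have hfv₀ : fbar v₀ < 0 := hfn v₀ (by linarith [hv₀.1])
  have hk0 : 0 < k := div_pos (by linarith) (by positivity)
  have hw : ∀ t, HasDerivAt (fun s => 1 + ε / 2 + M' * Real.exp (-k * s))
      (M' * (Real.exp (-k * t) * (-k))) t := fun t => by
    have := ((((hasDerivAt_id t).const_mul (-k)).exp).const_mul M').const_add (1 + ε / 2)
    simpa using this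
  have main : ∀ T, ∀ t ∈ Icc 0 T, ∀ x ∈ Icc (g t) (h t),
      u t x < 1 + ε / 2 + M' * Real.exp (-k * t) := by
    intro T
    refine S.upper hd ?_ ?_ hw ?_
    · intro x hx
      have h1 : u 0 x ≤ M' := le_max_of_le_left (hM ⟨x, hx, rfl⟩)
      simp; linarith
    · intro t ht
      have : 0 < M' * Real.exp (-k * t) := by positivity
      linarith
    · intro t ht x hx huw
      have h1 : 0 < M' * Real.exp (-k * t) := by positivity
      have h2 : Real.exp (-k * t) ≤ 1 := Real.exp_le_one_iff.2 (by nlinarith [ht.1])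
      have h3 : M' * Real.exp (-k * t) ≤ M' := by nlinarith
      have h4 := F.up t ht.1.le x (u t x) (by linarith)
      have h5 : fbar (u t x) ≤ fbar v₀ := hmax ⟨by linarith, by linarith⟩
      have h6 : M' * k = - fbar v₀ / 2 := by rw [hk]; field_simp
      have h7 : M' * (Real.exp (-k * t) * (-k)) = - (M' * k) * Real.exp (-k * t) := by ring
      rw [h7, h6]
      nlinarith [Real.exp_pos (-k * t)]
  have hlim : Tendsto (fun t : ℝ => M' * Real.exp (-k * t)) atTop (nhds (M' * 0)) := by
    refine Tendsto.const_mul _ (Real.tendsto_exp_atBot.comp ?_)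
    exact tendsto_id.const_mul_atTop_of_neg (by linarith)
  rw [mul_zero] at hlim
  obtain ⟨T, hT⟩ := eventually_atTop.1 (hlim.eventually_lt_const (show (0:ℝ) < ε / 2 by linarith))
  refine ⟨max T 1, by positivity, fun t ht x hx => ?_⟩
  have h1 := main t t ⟨by linarith [le_max_right T 1], le_rfl⟩ x hx
  have h2 := hT t (by linarith [le_max_left T 1])
  linarith

end

section
variable {d δ : ℝ} {f : ℝ → ℝ → ℝ → ℝ} {u : ℝ → ℝ → ℝ} {g h : ℝ → ℝ}

/-- Comparison with the slowly moving sub-front entering from the left. -/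
theorem HsSol.front_left (S : HsSol d δ f u g h) (hd : 0 < d) (hδ : 0 < δ) {fbar fu : ℝ → ℝ}
    (F : HsF f fbar fu) {X σ σ' : ℝ → ℝ} {s : ℝ}
    (hP : ∀ b ∈ Ioo 0 δ, 0 < σ b ∧ HasDerivAt X (-(σ b)⁻¹) b ∧ HasDerivAt σ (σ' b) b ∧
        s * σ b < d * (σ b * σ' b) + fu b ∧ X b < 0)
    (hX : ∀ R, ∃ b1 ∈ Ioo 0 δ, X b1 < -R) {b : ℝ} (hb : b ∈ Ioo 0 δ) :
    ∀ t, 0 ≤ t → ∀ x ∈ Icc (g t) (h t), u t x ≤ b → X b < x - g 0 - s * t := by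
  intro T hT x hx hux
  have hanti : AntitoneOn X (Ioo 0 δ) := by
    refine antitoneOn_of_deriv_nonpos (convex_Ioo _ _)
      (fun b hb => (hP b hb).2.1.continuousAt.continuousWithinAt)
      (fun b hb => (hP b (interior_subset hb)).2.1.differentiableAt.differentiableWithinAt) ?_
    intro b hb
    have h1 := hP b (interior_subset hb)
    rw [h1.2.1.deriv]
    have := inv_pos.2 h1.1
    linarith
  have hupos := S.pos hd hδ F
  have hcl : Continuous fun p : ℝ × ℝ => p.2 - g 0 - s * p.1 := by fun_prop
  obtain ⟨R, hR⟩ := ((S.dom_compact T).image hcl).bddBelow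
  obtain ⟨b0, hb0, hXb0⟩ := hX (-R)
  have hRle : ∀ t ∈ Icc 0 T, ∀ y ∈ Icc (g t) (h t), R ≤ y - g 0 - s * t := fun t ht y hy =>
    hR ⟨(t, y), ⟨ht, hy⟩, rfl⟩
  set b1 := max b0 b with hb1d
  have hb1 : b1 ∈ Ioo 0 δ := ⟨lt_max_of_lt_left hb0.1, max_lt hb0.2 hb.2⟩
  have hXb1 : X b1 < R := by
    have := hanti hb0 hb1 (le_max_left _ _)
    linarith
  have hmem : ∀ t, 0 ≤ t → ∀ y ∈ Icc (g t) (h t), min (u t y) b1 ∈ Ioo 0 δ := fun t ht y hy =>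
    ⟨lt_min (hupos t ht y hy) hb1.1, (min_le_right _ _).trans_lt hb1.2⟩
  have hXc : ContinuousOn X (Ioo 0 δ) := fun b hb => (hP b hb).2.1.continuousAt.continuousWithinAt
  have main := hs_touch (T0 := 0) (T := T)
    (v := fun t y => (y - g 0 - s * t) - X (min (u t y) b1))
    (S.gc.mono Icc_subset_Ici_self) (S.hc.mono Icc_subset_Ici_self) ?_ ?_ ?_ ?_ ?_
  · have h1 := main T ⟨hT, le_rfl⟩ x hx
    have hle : u T x ≤ b1 := hux.trans (le_max_right _ _)
    simp only [min_eq_left hle] at h1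
    have h2 := hmem T hT x hx
    rw [min_eq_left hle] at h2
    have := hanti h2 hb hux
    linarith
  · refine hcl.continuousOn.sub (hXc.comp ((continuous_id.min continuous_const).comp_continuousOn (S.uc' T)) ?_)
    intro p hp
    exact hmem p.1 hp.1.1 p.2 hp.2
  · intro y hy
    have := (hP _ (hmem 0 le_rfl y hy)).2.2.2.2
    have := hy.1
    simp only [mul_zero]
    linarith
  · intro t ht hab
    have h1 := hRle t (Ioc_subset_Icc_self ht) (g t) (left_mem_Icc.2 hab)
    rw [S.bcg t ht.1, min_eq_right hb1.2.le]
    linarith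
  · intro t ht hab
    have h1 := hRle t (Ioc_subset_Icc_self ht) (h t) (right_mem_Icc.2 hab)
    rw [S.bch t ht.1, min_eq_right hb1.2.le]
    linarith
  · intro t ht y hy h0 hnn hev
    have ht0 := ht.1
    have hyI := Ioo_subset_Icc_self hy
    have hub : u t y < b1 := by
      by_contra hcon
      push Not at hcon
      rw [min_eq_right hcon] at h0
      have := hRle t (Ioc_subset_Icc_self ht) y hyI
      linarith
    set B := u t y with hB
    have hBI : B ∈ Ioo 0 δ := ⟨hupos t ht0.le y hyI, hub.trans hb1.2⟩
    obtain ⟨hσ0, hXd, hσd, hineq, _⟩ := hP B hBI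
    have hutd := (S.ut t ht0 y hy).hasDerivAt
    have hnb : Ioo (g t) (h t) ∈ nhds y := Ioo_mem_nhds hy.1 hy.2
    rw [min_eq_left hub.le] at h0
    -- time derivative
    have hvt : HasDerivAt (fun τ => (y - g 0 - s * τ) - X (u τ y))
        ((0 - s * 1) - -(σ B)⁻¹ * deriv (fun s => u s y) t) t := by
      have h1 : HasDerivAt (fun τ => X (u τ y)) (-(σ B)⁻¹ * deriv (fun s => u s y) t) t :=
        HasDerivAt.comp t (h₂ := X) (h := fun τ => u τ y) hXd hutd
      have h2 : HasDerivAt (fun τ => y - g 0 - s * τ) (0 - s * 1) t :=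
        (hasDerivAt_const t (y - g 0)).sub ((hasDerivAt_id t).const_mul s)
      exact h2.sub h1
    have hev' : ∀ᶠ τ in nhdsWithin t (Iio t), 0 ≤ (y - g 0 - s * τ) - X (u τ y) := by
      have h1 : ∀ᶠ τ in nhdsWithin t (Iio t), u τ y < b1 :=
        (hutd.continuousAt.eventually_lt_const hub).filter_mono nhdsWithin_le_nhds
      filter_upwards [hev, h1] with τ h2 h3
      rwa [min_eq_left h3.le] at h2
    have e1 := hs_time_deriv hvt h0 hev'
    -- space derivatives
    have hucont : ContinuousAt (u t) y := (S.ux t ht0 y hyI).continuousAt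
    have hnear : ∀ᶠ z in nhds y, z ∈ Ioo (g t) (h t) ∧ u t z < b1 ∧ u t z ∈ Ioo 0 δ := by
      filter_upwards [hnb, hucont.eventually_lt_const hub] with z h1 h2
      exact ⟨h1, h2, hupos t ht0.le z (Ioo_subset_Icc_self h1), h2.trans hb1.2⟩
    have hσ1 : ∀ᶠ z in nhds y, HasDerivAt (fun z => (z - g 0 - s * t) - X (u t z))
        (1 + (σ (u t z))⁻¹ * deriv (u t) z) z := by
      filter_upwards [hnear] with z hz
      have h1 : HasDerivAt (fun z => X (u t z)) (-(σ (u t z))⁻¹ * deriv (u t) z) z :=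
        HasDerivAt.comp z (h₂ := X) (h := u t) (hP _ hz.2.2).2.1
          (S.ux t ht0 z (Ioo_subset_Icc_self hz.1)).hasDerivAt
      have h2 : HasDerivAt (fun z => z - g 0 - s * t) 1 z :=
        ((hasDerivAt_id z).sub_const _).sub_const _
      exact (h2.sub h1).congr_deriv (by ring)
    have hσ2 : HasDerivAt (fun z => 1 + (σ (u t z))⁻¹ * deriv (u t) z)
        (-(σ' B * deriv (u t) y) / σ B ^ 2 * deriv (u t) y + (σ B)⁻¹ * deriv (deriv (u t)) y) y := by
      have h1 : HasDerivAt (fun z => σ (u t z)) (σ' B * deriv (u t) y) y :=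
        HasDerivAt.comp y (h₂ := σ) (h := u t) hσd (S.ux t ht0 y hyI).hasDerivAt
      exact ((h1.fun_inv hσ0.ne').mul (S.uxx t ht0 y hy).hasDerivAt).const_add 1
    have e2 := hs_second hσ1 hσ2 (by
      filter_upwards [hnear] with z hz
      have h1 := hnn z (Ioo_subset_Icc_self hz.1)
      rw [min_eq_left hz.2.1.le] at h1
      rw [h0]; exact h1)
    obtain ⟨e2, e3⟩ := e2
    have e4 : deriv (u t) y = -σ B := by
      have : (σ B)⁻¹ * deriv (u t) y = -1 := by linarith
      field_simp at this
      linarith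
    rw [e4] at e3
    have e5 : σ B * σ' B ≤ deriv (deriv (u t)) y := by
      have h1 : 0 ≤ σ B * (-(σ' B * -σ B) / σ B ^ 2 * -σ B + (σ B)⁻¹ * deriv (deriv (u t)) y) :=
        mul_nonneg hσ0.le e3
      have h2 : σ B * (-(σ' B * -σ B) / σ B ^ 2 * -σ B + (σ B)⁻¹ * deriv (deriv (u t)) y)
          = -(σ B * σ' B) + deriv (deriv (u t)) y := by field_simp
      linarith
    have e6 : deriv (fun s => u s y) t ≤ s * σ B := by
      have h1 : σ B * ((0 - s * 1) - -(σ B)⁻¹ * deriv (fun s => u s y) t) ≤ 0 :=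
        mul_nonpos_of_nonneg_of_nonpos hσ0.le e1
      have h2 : σ B * ((0 - s * 1) - -(σ B)⁻¹ * deriv (fun s => u s y) t)
          = - (s * σ B) + deriv (fun s => u s y) t := by field_simp; ring
      linarith
    have e7 := S.pde t ht0 y hy
    have e8 := F.low t ht0.le y B hBI.1.le
    nlinarith

/-- For every `b < δ`, eventually `u > b`. -/
theorem HsSol.ev_gt (S : HsSol d δ f u g h) (hd : 0 < d) (hδ : 0 < δ) {fbar fu : ℝ → ℝ}
    (F : HsF f fbar fu) {b2 η m : ℝ}
    (hfc : ContinuousOn fu (Ici 0)) (hb2 : b2 ∈ Ioo 0 δ) (hη : 0 < η)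
    (hfη : ∀ b ∈ Icc b2 δ, η ≤ fu b) (hm : 0 < m)
    (hFm : ∀ b ∈ Icc 0 b2, m ≤ ∫ r in b..δ, fu r) {b : ℝ} (hb : b ∈ Ioo 0 δ) :
    ∃ T > 0, ∀ t ≥ T, ∀ x ∈ Icc (g t) (h t), b < u t x := by
  obtain ⟨X, σ, σ', s, hs, hP, hX⟩ := hs_profile hd hδ hfc hb2 hη hfη hm hFm
  refine ⟨max 1 ((h 0 - g 0 - 2 * X b) / (2 * s)), by positivity, fun t ht x hx => ?_⟩
  by_contra hcon
  push Not at hcon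
  have ht0 : 0 ≤ t := by linarith [le_max_left 1 ((h 0 - g 0 - 2 * X b) / (2 * s))]
  have h1 := S.front_left hd hδ F hP hX hb t ht0 x hx hcon
  have h2 := S.refl.front_left hd hδ F.refl hP hX hb t ht0 (-x)
    ⟨by linarith [hx.2], by linarith [hx.1]⟩ (by simpa using hcon)
  have h3 : (h 0 - g 0 - 2 * X b) / (2 * s) ≤ t := (le_max_right _ _).trans ht
  rw [div_le_iff₀ (by positivity)] at h3
  linarith

/-- Eventually `u ≥ δ`. -/
theorem HsSol.ev_ge (S : HsSol d δ f u g h) (hd : 0 < d) (hδ : 0 < δ) {fbar fu : ℝ → ℝ}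
    (F : HsF f fbar fu) {b2 η m : ℝ}
    (hfc : ContinuousOn fu (Ici 0)) (hb2 : b2 ∈ Ioo 0 δ) (hη : 0 < η)
    (hfη : ∀ b ∈ Icc b2 δ, η ≤ fu b) (hm : 0 < m)
    (hFm : ∀ b ∈ Icc 0 b2, m ≤ ∫ r in b..δ, fu r) :
    ∃ T > 0, ∀ t ≥ T, ∀ x ∈ Icc (g t) (h t), δ ≤ u t x := by
  obtain ⟨T, hT, hTu⟩ := S.ev_gt hd hδ F hfc hb2 hη hfη hm hFm hb2
  set ℓ := 2 * (δ - b2) / η with hℓ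
  have hδb : 0 < δ - b2 := sub_pos.2 hb2.2
  have hℓ0 : 0 < ℓ := by positivity
  refine ⟨T + ℓ, by positivity, fun t ht x hx => ?_⟩
  refine le_of_forall_pos_lt_add fun ε hε => ?_
  set ε' := min ε ((δ - b2) / 2) with hε'
  have hε'0 : 0 < ε' := by positivity
  have hε'1 : ε' ≤ ε := min_le_left _ _
  have hε'2 : ε' ≤ (δ - b2) / 2 := min_le_right _ _
  set k := (δ - ε' - b2) / ℓ with hk
  have hk0 : 0 < k := div_pos (by linarith) hℓ0
  have hkℓ : k * ℓ = δ - ε' - b2 := by rw [hk]; field_simp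
  have hkη : k < η := by
    rw [hk, div_lt_iff₀ hℓ0, hℓ]
    have : η * (2 * (δ - b2) / η) = 2 * (δ - b2) := by field_simp
    rw [this]; linarith
  set T0 := t - ℓ with hT0
  have hT0T : T ≤ T0 := by linarith
  have hT00 : 0 ≤ T0 := by linarith
  have hwle : ∀ τ ∈ Ioc T0 t, b2 ≤ b2 + k * (τ - T0) ∧ b2 + k * (τ - T0) < δ := by
    intro τ hτ
    have h1 : 0 ≤ k * (τ - T0) := mul_nonneg hk0.le (by linarith [hτ.1])
    have h2 : k * (τ - T0) ≤ k * ℓ := by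
      apply mul_le_mul_of_nonneg_left _ hk0.le; linarith [hτ.2]
    exact ⟨by linarith, by linarith⟩
  have hsub : Icc T0 t ⊆ Ici 0 := fun τ hτ => hT00.trans hτ.1
  have main := S.lower hd (T0 := T0) (T := t) hT00 (a := g) (b := h)
    (w := fun τ _ => b2 + k * (τ - T0)) (wt := fun _ _ => k) (w1 := fun _ _ => 0)
    (w2 := fun _ _ => 0) (S.gc.mono hsub) (S.hc.mono hsub)
    (fun _ _ => le_rfl) (fun _ _ => le_rfl) (by fun_prop) ?_ ?_ ?_
    (fun τ _ x _ => by
      have := (((hasDerivAt_id τ).sub_const T0).const_mul k).const_add b2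
      simpa using this) (fun t _ x _ => hasDerivAt_const _ _)
    (fun t _ x _ => hasDerivAt_const _ _) ?_
  · have h1 := main t ⟨by linarith, le_rfl⟩ x hx
    have h2 : t - T0 = ℓ := by rw [hT0]; ring
    simp only [h2, hkℓ] at h1
    linarith
  · intro y hy
    have := hTu T0 hT0T y hy
    simpa using this
  · intro τ hτ _; rw [S.bcg τ (hT00.trans_lt hτ.1)]; exact (hwle τ hτ).2
  · intro τ hτ _; rw [S.bch τ (hT00.trans_lt hτ.1)]; exact (hwle τ hτ).2
  · intro τ hτ y hy huw
    obtain ⟨h1, h2⟩ := hwle τ hτ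
    have h3 := F.low τ (hT00.trans hτ.1.le) y (u τ y) (by rw [huw]; linarith [hb2.1])
    have h4 := hfη (u τ y) ⟨by rw [huw]; exact h1, by rw [huw]; exact h2.le⟩
    linarith

end

/-- One-sided derivative at a left minimum. -/
theorem hs_left_deriv {v : ℝ → ℝ} {t v' : ℝ} (hv : HasDerivWithinAt v v' (Iio t) t) (h0 : v t = 0)
    (h : ∀ᶠ τ in nhdsWithin t (Iio t), 0 ≤ v τ) : v' ≤ 0 := by
  have h1 := (hasDerivWithinAt_iff_tendsto_slope' (by simp)).1 hv
  refine le_of_tendsto h1 ?_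
  filter_upwards [h, self_mem_nhdsWithin] with τ h2 h3
  rw [slope_def_field, h0]
  have : τ - t < 0 := sub_neg.2 h3
  exact div_nonpos_of_nonneg_of_nonpos (by linarith) this.le

section
variable {d δ : ℝ} {f : ℝ → ℝ → ℝ → ℝ} {u : ℝ → ℝ → ℝ} {g h : ℝ → ℝ}

theorem HsSol.strict (S : HsSol d δ f u g h) (hd : 0 < d) (hδ : 0 < δ) {fbar fu : ℝ → ℝ}
    (F : HsF f fbar fu) (hfδ : 0 < fu δ) {T2 : ℝ} (hT2 : 0 < T2)
    (hge : ∀ t ≥ T2, ∀ x ∈ Icc (g t) (h t), δ ≤ u t x) :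
    ∀ t, T2 < t → ∀ x ∈ Ioo (g t) (h t), δ < u t x := by
  intro t ht x hx
  refine lt_of_le_of_ne (hge t ht.le x (Ioo_subset_Icc_self hx)) fun heq => ?_
  have ht0 : 0 < t := hT2.trans ht
  have hnb : Ioo (g t) (h t) ∈ nhds x := Ioo_mem_nhds hx.1 hx.2
  have e2 := hs_second (φ := u t) (φ1 := deriv (u t)) (x := x) (A := deriv (deriv (u t)) x)
    (by filter_upwards [hnb] with y hy; exact (S.ux t ht0 y (Ioo_subset_Icc_self hy)).hasDerivAt)
    (S.uxx t ht0 x hx).hasDerivAt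
    (by
      filter_upwards [hnb] with y hy
      rw [← heq]; exact hge t ht.le y (Ioo_subset_Icc_self hy))
  have hev : ∀ᶠ τ in nhdsWithin t (Iio t), 0 ≤ u τ x - δ := by
    have c1 := ((S.gc.continuousAt (Ici_mem_nhds ht0)).eventually_lt_const hx.1).filter_mono
      (nhdsWithin_le_nhds (s := Iio t))
    have c2 := ((S.hc.continuousAt (Ici_mem_nhds ht0)).eventually_const_lt hx.2).filter_mono
      (nhdsWithin_le_nhds (s := Iio t))
    filter_upwards [c1, c2, Ioo_mem_nhdsLT ht] with τ h1 h2 h3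
    linarith [hge τ h3.1.le x ⟨h1.le, h2.le⟩]
  have e1 := hs_time_deriv ((S.ut t ht0 x hx).hasDerivAt.sub_const δ) (by linarith) hev
  have e3 := S.pde t ht0 x hx
  have e4 := F.low t ht0.le x (u t x) (by linarith)
  rw [← heq] at e4 e3
  nlinarith [e2.2]

theorem HsSol.mono_h (S : HsSol d δ f u g h) (hd : 0 < d) (hδ : 0 < δ) {T2 : ℝ} (hT2 : 0 < T2)
    (hge : ∀ t ≥ T2, ∀ x ∈ Icc (g t) (h t), δ ≤ u t x) : MonotoneOn h (Ici T2) := by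
  have hpos : ∀ t ∈ Ici T2, 0 < t := fun t ht => hT2.trans_le ht
  refine monotoneOn_of_deriv_nonneg (convex_Ici _)
    (S.hc.mono fun t ht => (hpos t ht).le)
    (fun t ht => (S.hd t (hpos t (interior_subset ht))).differentiableAt.differentiableWithinAt) ?_
  intro t ht
  have ht' : T2 ≤ t := interior_subset ht
  have ht0 := hpos t ht'
  rw [(S.hd t ht0).deriv]
  have hlt := S.lt t ht0.le
  have h1 := hs_left_deriv (v := fun x => u t x - δ)
    (((S.ux t ht0 (h t) (right_mem_Icc.2 hlt.le)).hasDerivAt.sub_const δ).hasDerivWithinAt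
      (s := Iio (h t))) (by simp [S.bch t ht0]) (by
      filter_upwards [Ioo_mem_nhdsLT hlt] with y hy
      linarith [hge t ht' y ⟨hy.1.le, hy.2.le⟩])
  have : 0 < d / δ := by positivity
  nlinarith

theorem HsSol.ge_refl {T2 : ℝ} (hge : ∀ t ≥ T2, ∀ x ∈ Icc (g t) (h t), δ ≤ u t x) :
    ∀ t ≥ T2, ∀ x ∈ Icc (-h t) (-g t), δ ≤ u t (-x) := fun t ht x hx =>
  hge t ht _ ⟨by linarith [hx.2], by linarith [hx.1]⟩

theorem HsSol.anti_g (S : HsSol d δ f u g h) (hd : 0 < d) (hδ : 0 < δ) {T2 : ℝ} (hT2 : 0 < T2)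
    (hge : ∀ t ≥ T2, ∀ x ∈ Icc (g t) (h t), δ ≤ u t x) : AntitoneOn g (Ici T2) := by
  have := S.refl.mono_h hd hδ hT2 (HsSol.ge_refl hge)
  intro a ha b hb hab
  have := this ha hb hab
  simp only at this
  linarith

/-- One-sided free boundary comparison. -/
theorem HsSol.fb (S : HsSol d δ f u g h) (hd : 0 < d) (hδ : 0 < δ) {fbar fu : ℝ → ℝ}
    (F : HsF f fbar fu) (hfδ : 0 < fu δ) {T2 : ℝ} (hT2 : 0 < T2)
    (hge : ∀ t ≥ T2, ∀ x ∈ Icc (g t) (h t), δ ≤ u t x)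
    {x0 T0 : ℝ} (hT0 : T2 < T0) (hx0 : ∀ t ≥ T0, g t < x0 ∧ x0 < h t)
    {h1 h1' A A' Q Q1 Q2 : ℝ → ℝ}
    (hh1 : ∀ t, HasDerivAt h1 (h1' t) t) (hA1 : ∀ t, HasDerivAt A (A' t) t)
    (hQ0 : Q 0 = δ) (hQd : ∀ z, 0 ≤ z → HasDerivWithinAt Q (Q1 z) (Ici 0) z)
    (hQ2 : ∀ z, 0 < z → HasDerivAt Q1 (Q2 z) z) (hQge : ∀ z, 0 ≤ z → δ ≤ Q z)
    (hA : ∀ t ≥ T0, 0 ≤ A t) (hini : h1 T0 ≤ x0)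
    (hside : ∀ t ≥ T0, x0 ≤ h1 t → δ + A t * (Q (h1 t - x0) - δ) < u t x0)
    (hstef : ∀ t ≥ T0, h1' t < (d / δ) * (A t * Q1 0))
    (hsub : ∀ t ≥ T0, ∀ z, 0 < z →
      A' t * (Q z - δ) + A t * (h1' t * Q1 z) < d * (A t * Q2 z) + fu (δ + A t * (Q z - δ))) :
    ∀ t ≥ T0, h1 t < h t ∧ ∀ x ∈ Icc x0 (h1 t), δ + A t * (Q (h1 t - x) - δ) < u t x := by
  have hT00 : 0 < T0 := hT2.trans hT0
  have hstrict := S.strict hd hδ F hfδ hT2 hge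
  have hh1c : Continuous h1 := continuous_iff_continuousAt.2 fun t => (hh1 t).continuousAt
  have hAc : Continuous A := continuous_iff_continuousAt.2 fun t => (hA1 t).continuousAt
  have hQc : ContinuousOn Q (Ici 0) := fun z hz => (hQd z hz).continuousWithinAt
  have hQd' : ∀ z, 0 < z → HasDerivAt Q (Q1 z) z := fun z hz =>
    (hQd z hz.le).hasDerivAt (Ici_mem_nhds hz)
  have hwt : ∀ t x, x < h1 t → HasDerivAt (fun s => δ + A s * (Q (h1 s - x) - δ))
      (A' t * (Q (h1 t - x) - δ) + A t * (h1' t * Q1 (h1 t - x))) t := by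
    intro t x hx
    have e1 : HasDerivAt (fun s => h1 s - x) (h1' t) t := (hh1 t).sub_const x
    have e2 : HasDerivAt (fun s => Q (h1 s - x)) (Q1 (h1 t - x) * h1' t) t :=
      HasDerivAt.comp t (h₂ := Q) (h := fun s => h1 s - x) (hQd' _ (sub_pos.2 hx)) e1
    exact (((hA1 t).mul (e2.sub_const δ)).const_add δ).congr_deriv (by ring)
  -- comparison as long as `h1 < h`
  have claim1 : ∀ T, (∀ t ∈ Icc T0 T, h1 t < h t) → ∀ t ∈ Icc T0 T, ∀ x ∈ Icc x0 (h1 t),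
      δ + A t * (Q (h1 t - x) - δ) < u t x := by
    intro T hlt
    refine S.lower hd hT00.le (a := fun _ => x0) (b := h1)
      (w := fun t x => δ + A t * (Q (h1 t - x) - δ))
      (wt := fun t x => A' t * (Q (h1 t - x) - δ) + A t * (h1' t * Q1 (h1 t - x)))
      (w1 := fun t x => -(A t * Q1 (h1 t - x))) (w2 := fun t x => A t * Q2 (h1 t - x))
      continuousOn_const hh1c.continuousOn (fun t ht => (hx0 t ht.1).1.le)
      (fun t ht => (hlt t ht).le) ?_ ?_ ?_ ?_ ?_ ?_ ?_ ?_
    · refine continuousOn_const.add (ContinuousOn.mul (by fun_prop) (ContinuousOn.sub ?_ continuousOn_const))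
      refine hQc.comp (f := fun p : ℝ × ℝ => h1 p.1 - p.2) (by fun_prop) ?_
      intro p hp
      exact sub_nonneg.2 hp.2.2
    · intro x hx
      have hxe : x = x0 := le_antisymm (hx.2.trans hini) hx.1
      rw [hxe]; exact hside T0 le_rfl (hx.1.trans hx.2)
    · intro t ht hab; exact hside t ht.1.le hab
    · intro t ht hab
      have := hstrict t (hT0.trans ht.1) (h1 t)
        ⟨(hx0 t ht.1.le).1.trans_le hab, hlt t (Ioc_subset_Icc_self ht)⟩
      simpa [hQ0] using this
    · intro t ht x hx; exact hwt t x hx.2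
    · intro t ht x hx
      have e1 : HasDerivAt (fun y => h1 t - y) (-1) x := (hasDerivAt_id x).const_sub (h1 t)
      have e2 : HasDerivAt (fun y => Q (h1 t - y)) (Q1 (h1 t - x) * (-1)) x :=
        HasDerivAt.comp x (h₂ := Q) (h := fun y => h1 t - y) (hQd' _ (sub_pos.2 hx.2)) e1
      exact (((e2.sub_const δ).const_mul (A t)).const_add δ).congr_deriv (by ring)
    · intro t ht x hx
      have e1 : HasDerivAt (fun y => h1 t - y) (-1) x := (hasDerivAt_id x).const_sub (h1 t)
      have e2 : HasDerivAt (fun y => Q1 (h1 t - y)) (Q2 (h1 t - x) * (-1)) x :=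
        HasDerivAt.comp x (h₂ := Q1) (h := fun y => h1 t - y) (hQ2 _ (sub_pos.2 hx.2)) e1
      exact ((e2.const_mul (A t)).neg).congr_deriv (by ring)
    · intro t ht x hx huw
      have e1 := hsub t ht.1.le (h1 t - x) (sub_pos.2 hx.2)
      have e2 : 0 ≤ A t * (Q (h1 t - x) - δ) :=
        mul_nonneg (hA t ht.1.le) (sub_nonneg.2 (hQge _ (sub_nonneg.2 hx.2.le)))
      have e3 := F.low t (hT00.trans ht.1).le x (u t x) (by rw [huw]; linarith)
      rw [huw] at e3 ⊢
      linarith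
  have claim2 : ∀ t ≥ T0, h1 t < h t := by
    by_contra hcon
    push Not at hcon
    obtain ⟨t₁, ht₁, hht₁⟩ := hcon
    set E := {t | t ∈ Ici T0 ∧ h t - h1 t ∈ Iic (0:ℝ)} with hE
    have hcont : ContinuousOn (fun t => h t - h1 t) (Ici T0) :=
      (S.hc.mono fun t ht => hT00.le.trans ht).sub hh1c.continuousOn
    have hEc : IsClosed E := hcont.preimage_isClosed_of_isClosed isClosed_Ici isClosed_Iic
    have hEb : BddBelow E := ⟨T0, fun t ht => ht.1⟩
    have hEn : E.Nonempty := ⟨t₁, ht₁, by simp only [mem_Iic]; linarith⟩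
    set t := sInf E with ht
    have htE : t ∈ E := hEc.csInf_mem hEn hEb
    have htT0 : T0 ≤ t := htE.1
    have hth : h t - h1 t ≤ 0 := htE.2
    have hbef : ∀ τ, T0 ≤ τ → τ < t → h1 τ < h τ := by
      intro τ h2 h3
      by_contra h4
      have : τ ∈ E := ⟨h2, by simp only [mem_Iic]; linarith⟩
      exact absurd (csInf_le hEb this) (not_le.2 h3)
    have hlt : T0 < t := by
      rcases htT0.eq_or_lt with h2 | h2
      · exfalso
        rw [← h2] at hth
        linarith [(hx0 T0 le_rfl).2]
      · exact h2
    have ht0 : 0 < t := hT00.trans hlt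
    have hevI : ∀ᶠ τ in nhdsWithin t (Iio t), T0 ≤ τ ∧ τ < t := by
      filter_upwards [Ioo_mem_nhdsLT hlt] with τ hτ using ⟨hτ.1.le, hτ.2⟩
    have hev : ∀ᶠ τ in nhdsWithin t (Iio t), 0 ≤ h τ - h1 τ := by
      filter_upwards [hevI] with τ hτ
      linarith [hbef τ hτ.1 hτ.2]
    have hder := (S.hd t ht0).sub (hh1 t)
    have hge0 : 0 ≤ h t - h1 t :=
      ge_of_tendsto (hder.continuousAt.tendsto.mono_left nhdsWithin_le_nhds) hev
    have heq : h t = h1 t := by linarith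
    have d1 := hs_time_deriv hder (by simp [heq]) hev
    have hx0t := hx0 t htT0
    -- `u ≥ w` at time `t`
    have huw : ∀ x ∈ Ioo x0 (h t), 0 ≤ u t x - (δ + A t * (Q (h1 t - x) - δ)) := by
      intro x hx
      have c1 : ContinuousAt (fun s => u s x) t :=
        (S.ut t ht0 x ⟨hx0t.1.trans hx.1, hx.2⟩).continuousAt
      have c2 := (hwt t x (by rw [← heq]; exact hx.2)).continuousAt
      refine ge_of_tendsto ((c1.sub c2).tendsto.mono_left (nhdsWithin_le_nhds (s := Iio t))) ?_
      have c3 : ∀ᶠ τ in nhdsWithin t (Iio t), x < h1 τ :=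
        (hh1c.continuousAt.eventually_const_lt (by rw [← heq]; exact hx.2)).filter_mono
          nhdsWithin_le_nhds
      filter_upwards [hevI, c3] with τ hτ h3
      have := claim1 τ (fun s hs => hbef s hs.1 (hs.2.trans_lt hτ.2)) τ ⟨hτ.1, le_rfl⟩ x
        ⟨hx.1.le, h3.le⟩
      exact (sub_pos.2 this).le
    have d2 := hs_left_deriv (v := fun x => u t x - (δ + A t * (Q (h1 t - x) - δ))) (t := h t)
      (v' := deriv (u t) (h t) - A t * (Q1 0 * (-1))) (by
        have e1 : HasDerivWithinAt (fun y => h1 t - y) (-1) (Iio (h t)) (h t) :=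
          ((hasDerivAt_id (h t)).const_sub (h1 t)).hasDerivWithinAt
        have e0 : h1 t - h t = 0 := by linarith
        have e2 : HasDerivWithinAt (fun y => Q (h1 t - y)) (Q1 0 * (-1)) (Iio (h t)) (h t) := by
          refine HasDerivWithinAt.comp (h₂ := Q) (h := fun y => h1 t - y) (h t) (s' := Ici 0) ?_ e1 ?_
          · rw [e0]; exact hQd 0 le_rfl
          · intro y hy
            simp only [mem_Iio] at hy
            simp only [mem_Ici]; linarith
        have e3 := (S.ux t ht0 (h t) (right_mem_Icc.2 (S.lt t ht0.le).le)).hasDerivAt.hasDerivWithinAt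
          (s := Iio (h t))
        exact e3.sub (((e2.sub_const δ).const_mul (A t)).const_add δ))
      (by simp [heq ▸ S.bch t ht0, heq, hQ0])
      (by
        filter_upwards [Ioo_mem_nhdsLT hx0t.2] with x hx
        exact huw x hx)
    have d3 := hstef t htT0
    have hdδ : 0 < d / δ := by positivity
    have d4 : (d / δ) * (deriv (u t) (h t) + A t * Q1 0) ≤ 0 :=
      mul_nonpos_of_nonneg_of_nonpos hdδ.le (by linarith)
    linarith
  intro t ht
  exact ⟨claim2 t ht, claim1 t (fun s hs => claim2 s hs.1) t ⟨ht, le_rfl⟩⟩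

end

section
variable {d δ : ℝ} {f : ℝ → ℝ → ℝ → ℝ} {u : ℝ → ℝ → ℝ} {g h : ℝ → ℝ}

/-- A point where the solution stays above a level larger than `δ`. -/
theorem HsSol.plateau (S : HsSol d δ f u g h) (hd : 0 < d) (hδ : 0 < δ) {fbar fu : ℝ → ℝ}
    (F : HsF f fbar fu) {η δ1 : ℝ} (hη : 0 < η) (hδ1 : δ < δ1) (hfη : ∀ v ∈ Icc δ δ1, η ≤ fu v)
    {T2 : ℝ} (hT2 : 0 < T2)
    (hge : ∀ t ≥ T2, ∀ x ∈ Icc (g t) (h t), δ ≤ u t x) :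
    ∃ T3 > T2, ∃ x0 P : ℝ, δ < P ∧ ∀ t ≥ T3, g t < x0 ∧ x0 < h t ∧ P < u t x0 := by
  have hfδ : 0 < fu δ := hη.trans_le (hfη δ ⟨le_rfl, hδ1.le⟩)
  have hstrict := S.strict hd hδ F hfδ hT2 hge
  have hmono := S.mono_h hd hδ hT2 hge
  have hanti := S.anti_g hd hδ hT2 hge
  set T3 := T2 + 1 with hT3
  have hlt := S.lt T3 (by linarith)
  obtain ⟨a, ha1, ha2⟩ := exists_between hlt
  obtain ⟨b, hb1, hb2⟩ := exists_between ha2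
  have hgt : ∀ t ≥ T3, g t < a := fun t ht =>
    (hanti (by simp only [mem_Ici]; linarith) (by simp only [mem_Ici]; linarith) ht).trans_lt ha1
  have hht : ∀ t ≥ T3, b < h t := fun t ht =>
    hb2.trans_le (hmono (by simp only [mem_Ici]; linarith) (by simp only [mem_Ici]; linarith) ht)
  obtain ⟨xm, hxm, hmin⟩ := (isCompact_Icc (a := a) (b := b)).exists_isMinOn
    ⟨a, left_mem_Icc.2 hb1.le⟩
    ((S.uc_slice (t := T3) (by linarith)).mono (Icc_subset_Icc ha1.le hb2.le))
  have hmu : δ < u T3 xm := hstrict T3 (by linarith) xm ⟨ha1.trans_le hxm.1, hxm.2.trans_lt hb2⟩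
  set B := (b - a) ^ 2 with hB
  have hB0 : 0 < B := by have := sub_pos.2 hb1; positivity
  obtain ⟨ε, hε0, hε⟩ : ∃ ε > 0, ε * B < u T3 xm - δ ∧ ε * B < δ1 - δ ∧ 2 * d * ε < η := by
    have h1 := sub_pos.2 hmu
    have h2 := sub_pos.2 hδ1
    have e1 : ∀ k m : ℝ, 0 < k → 0 < m → ∀ᶠ ε in nhdsWithin (0:ℝ) (Ioi 0), k * ε < m := by
      intro k m hk hm
      have : Tendsto (fun ε : ℝ => k * ε) (nhds 0) (nhds (k * 0)) :=
        (continuous_const.mul continuous_id).tendsto 0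
      rw [mul_zero] at this
      exact (this.eventually_lt_const hm).filter_mono nhdsWithin_le_nhds
    obtain ⟨ε, h5, h6, h7, h8⟩ := ((e1 B _ hB0 h1).and ((e1 B _ hB0 h2).and
      ((e1 (2 * d) _ (by positivity) hη).and self_mem_nhdsWithin))).exists
    exact ⟨ε, h8, by linarith, by linarith, h7⟩
  have hq : ∀ x ∈ Icc a b, 0 ≤ (x - a) * (b - x) ∧ (x - a) * (b - x) ≤ B := by
    intro x hx
    constructor
    · exact mul_nonneg (sub_nonneg.2 hx.1) (sub_nonneg.2 hx.2)
    · rw [hB]; nlinarith [sq_nonneg (x - a), sq_nonneg (b - x), hx.1, hx.2,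
        mul_nonneg (sub_nonneg.2 hx.1) (sub_nonneg.2 hx.2)]
  refine ⟨T3, by linarith, (a + b) / 2, δ + ε * (((a + b) / 2 - a) * (b - (a + b) / 2)), ?_, ?_⟩
  · have : 0 < ((a + b) / 2 - a) * (b - (a + b) / 2) := mul_pos (by linarith) (by linarith)
    have := mul_pos hε0 this
    linarith
  · intro t ht
    refine ⟨(hgt t ht).trans (by linarith), lt_trans (by linarith) (hht t ht), ?_⟩
    refine S.lower hd (T0 := T3) (T := t) (by linarith) (a := fun _ => a) (b := fun _ => b)
      (w := fun _ x => δ + ε * ((x - a) * (b - x))) (wt := fun _ _ => 0)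
      (w1 := fun _ x => ε * ((b - x) - (x - a))) (w2 := fun _ _ => ε * (-2))
      continuousOn_const continuousOn_const (fun t ht => (hgt t ht.1).le)
      (fun t ht => (hht t ht.1).le) (by fun_prop) ?_ ?_ ?_ ?_ ?_ ?_ ?_ t ⟨ht, le_rfl⟩ _
      ⟨by linarith, by linarith⟩
    · intro x hx
      have h1 : u T3 xm ≤ u T3 x := hmin hx
      have h2 := mul_le_mul_of_nonneg_left (hq x hx).2 hε0.le
      linarith
    · intro s hs _
      have := hstrict s (by linarith [hs.1]) a ⟨hgt s hs.1.le, hb1.trans (hht s hs.1.le)⟩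
      simpa using this
    · intro s hs _
      have := hstrict s (by linarith [hs.1]) b ⟨(hgt s hs.1.le).trans hb1, hht s hs.1.le⟩
      simpa using this
    · intro s hs x hx; exact hasDerivAt_const _ _
    · intro s hs x hx
      exact (((((hasDerivAt_id x).sub_const a).mul ((hasDerivAt_id x).const_sub b)).const_mul
        ε).const_add δ).congr_deriv (by simp only [id, Pi.neg_apply]; ring)
    · intro s hs x hx
      exact ((((hasDerivAt_id x).const_sub b).sub ((hasDerivAt_id x).sub_const a)).const_mul
        ε).congr_deriv (by ring)
    · intro s hs x hx huw
      have h2 := mul_le_mul_of_nonneg_left (hq x (Ioo_subset_Icc_self hx)).2 hε0.le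
      have h3 := mul_nonneg hε0.le (hq x (Ioo_subset_Icc_self hx)).1
      have h4 := F.low s (by linarith [hs.1]) x (u s x) (by linarith)
      have h5 := hfη (u s x) ⟨by linarith, by linarith⟩
      linarith [hε.2.2]

/-- Linear spreading to the right with some positive speed. -/
theorem HsSol.slow_right (S : HsSol d δ f u g h) (hd : 0 < d) (hδ : 0 < δ) {fbar fu : ℝ → ℝ}
    (F : HsF f fbar fu) {η δ1 : ℝ} (hη : 0 < η) (hδ1 : δ < δ1) (hfη : ∀ v ∈ Icc δ δ1, η ≤ fu v)
    {T2 : ℝ} (hT2 : 0 < T2)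
    (hge : ∀ t ≥ T2, ∀ x ∈ Icc (g t) (h t), δ ≤ u t x) :
    ∃ s > 0, ∃ T > T2, ∀ t ≥ T, s * t < h t := by
  obtain ⟨T3, hT3, x0, P, hP, hx0⟩ := S.plateau hd hδ F hη hδ1 hfη hT2 hge
  have hfδ : 0 < fu δ := hη.trans_le (hfη δ ⟨le_rfl, hδ1.le⟩)
  obtain ⟨A0, hA0, hA1, hA2, hA3⟩ : ∃ A0 > 0, A0 < P - δ ∧ A0 < δ1 - δ ∧
      A0 * (d * A0 / (2 * δ) + d) < η := by
    have h1 := sub_pos.2 hP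
    have h2 := sub_pos.2 hδ1
    have e : Tendsto (fun A : ℝ => A * (d * A / (2 * δ) + d)) (nhds 0) (nhds 0) := by
      have : Continuous (fun A : ℝ => A * (d * A / (2 * δ) + d)) := by fun_prop
      simpa using this.tendsto 0
    obtain ⟨A, h5, h6, h7, h8⟩ := (((eventually_lt_nhds h1).filter_mono
      (nhdsWithin_le_nhds (s := Ioi 0))).and (((eventually_lt_nhds h2).filter_mono
      (nhdsWithin_le_nhds (s := Ioi 0))).and (((e.eventually_lt_const hη).filter_mono
      (nhdsWithin_le_nhds (s := Ioi 0))).and self_mem_nhdsWithin))).exists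
    exact ⟨A, h8, h5, h6, h7⟩
  set s := d * A0 / (2 * δ) with hs
  have hs0 : 0 < s := by positivity
  have hexp : ∀ z : ℝ, HasDerivAt (fun z => Real.exp (-z)) (-Real.exp (-z)) z := fun z =>
    ((hasDerivAt_neg z).exp).congr_deriv (by ring)
  have hz1 : ∀ z : ℝ, 0 ≤ z → Real.exp (-z) ≤ 1 := fun z hz => by
    rw [Real.exp_le_one_iff]; linarith
  have key := S.fb hd hδ F hfδ hT2 hge (x0 := x0) (T0 := T3) hT3
    (fun t ht => ⟨(hx0 t ht).1, (hx0 t ht).2.1⟩)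
    (h1 := fun t => x0 + s * (t - T3)) (h1' := fun _ => s) (A := fun _ => 1) (A' := fun _ => 0)
    (Q := fun z => δ + A0 * (1 - Real.exp (-z))) (Q1 := fun z => A0 * Real.exp (-z))
    (Q2 := fun z => A0 * (-Real.exp (-z)))
    (fun t => ((((hasDerivAt_id t).sub_const T3).const_mul s).const_add x0).congr_deriv (by ring))
    (fun t => hasDerivAt_const _ _) (by simp)
    (fun z _ => (((((hexp z).const_sub 1).const_mul A0).const_add δ).congr_deriv
      (by ring)).hasDerivWithinAt)
    (fun z _ => (hexp z).const_mul A0)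
    (fun z hz => by
      have := mul_nonneg hA0.le (sub_nonneg.2 (hz1 z hz))
      linarith)
    (fun _ _ => zero_le_one) (by simp)
    (fun t ht _ => by
      have h1 := mul_pos hA0 (Real.exp_pos (-(x0 + s * (t - T3) - x0)))
      have h2 := (hx0 t ht).2.2
      linarith)
    (fun t ht => by
      simp only [neg_zero, Real.exp_zero]
      have : d / δ * (1 * (A0 * 1)) = 2 * s := by rw [hs]; field_simp
      rw [this]; linarith)
    (fun t ht z hz => by
      have e1 := hz1 z hz.le
      have e0 := Real.exp_pos (-z)
      have h1 := mul_nonneg hA0.le (sub_nonneg.2 e1)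
      have h2 := hfη (δ + 1 * (δ + A0 * (1 - Real.exp (-z)) - δ)) ⟨by linarith, by nlinarith⟩
      have h3 : A0 * (s + d) * Real.exp (-z) ≤ A0 * (s + d) * 1 :=
        mul_le_mul_of_nonneg_left e1 (by positivity)
      nlinarith)
  refine ⟨s / 2, by positivity, max (T3 + 1) (2 * (s * T3 - x0) / s), lt_max_of_lt_left (by linarith), ?_⟩
  intro t ht
  have h1 := (key t (by linarith [le_max_left (T3 + 1) (2 * (s * T3 - x0) / s)])).1
  have h2 := (le_max_right (T3 + 1) (2 * (s * T3 - x0) / s)).trans ht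
  rw [div_le_iff₀ hs0] at h2
  linarith

/-- Linear spreading in both directions. -/
theorem HsSol.slow (S : HsSol d δ f u g h) (hd : 0 < d) (hδ : 0 < δ) {fbar fu : ℝ → ℝ}
    (F : HsF f fbar fu) {η δ1 : ℝ} (hη : 0 < η) (hδ1 : δ < δ1) (hfη : ∀ v ∈ Icc δ δ1, η ≤ fu v)
    {T2 : ℝ} (hT2 : 0 < T2)
    (hge : ∀ t ≥ T2, ∀ x ∈ Icc (g t) (h t), δ ≤ u t x) :
    ∃ s > 0, ∃ T > T2, ∀ t ≥ T, s * t < h t ∧ g t < -(s * t) := by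
  obtain ⟨s1, hs1, T1, hT1, h1⟩ := S.slow_right hd hδ F hη hδ1 hfη hT2 hge
  obtain ⟨s3, hs3, T3, hT3, h3⟩ := S.refl.slow_right hd hδ F.refl hη hδ1 hfη hT2
    (HsSol.ge_refl hge)
  refine ⟨min s1 s3, lt_min hs1 hs3, max T1 T3, lt_max_of_lt_left hT1, fun t ht => ?_⟩
  have e1 := h1 t ((le_max_left _ _).trans ht)
  have e3 := h3 t ((le_max_right _ _).trans ht)
  have ht0 : 0 ≤ t := by linarith [(le_max_left T1 T3).trans ht]
  have i1 := mul_le_mul_of_nonneg_right (min_le_left s1 s3) ht0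
  have i3 := mul_le_mul_of_nonneg_right (min_le_right s1 s3) ht0
  constructor <;> linarith

/-- Exponential convergence from below at the origin. -/
theorem HsSol.center (S : HsSol d δ f u g h) (hd : 0 < d) (hδ : 0 < δ) (hδ1 : δ < 1)
    {fbar fu : ℝ → ℝ} (F : HsF f fbar fu) {κ s T2 : ℝ} (hκ : 0 < κ)
    (hfκ : ∀ v ∈ Icc δ 1, κ * (1 - v) ≤ fu v) (hT2 : 0 < T2) (hs : 0 < s)
    (hge : ∀ t ≥ T2, ∀ x ∈ Icc (g t) (h t), δ ≤ u t x)
    (hsp : ∀ t ≥ T2, s * t < h t ∧ g t < -(s * t)) :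
    ∃ C > 0, ∃ κ' > 0, ∀ t ≥ T2, 1 - C * Real.exp (-(κ' * t)) < u t 0 := by
  obtain ⟨k, hk, hk1⟩ : ∃ k > 0, k * s + d * k ^ 2 < κ := by
    have e : Tendsto (fun k : ℝ => k * s + d * k ^ 2) (nhds 0) (nhds 0) := by
      have : Continuous (fun k : ℝ => k * s + d * k ^ 2) := by fun_prop
      simpa using this.tendsto 0
    obtain ⟨k, h7, h8⟩ := (((e.eventually_lt_const hκ).filter_mono
      (nhdsWithin_le_nhds (s := Ioi 0))).and self_mem_nhdsWithin).exists
    exact ⟨k, h8, h7⟩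
  set D := 1 - δ with hD
  have hD0 : 0 < D := sub_pos.2 hδ1
  have hE1 : ∀ t x : ℝ, HasDerivAt (fun t => Real.exp (-(k * (s * t - x))))
      (Real.exp (-(k * (s * t - x))) * (-(k * s))) t := fun t x =>
    ((((((hasDerivAt_id t).const_mul s).sub_const x).const_mul k).neg).exp).congr_deriv
      (by simp only [id, Pi.neg_apply]; ring)
  have hE2 : ∀ t x : ℝ, HasDerivAt (fun t => Real.exp (-(k * (s * t + x))))
      (Real.exp (-(k * (s * t + x))) * (-(k * s))) t := fun t x =>
    ((((((hasDerivAt_id t).const_mul s).add_const x).const_mul k).neg).exp).congr_deriv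
      (by simp only [id, Pi.neg_apply]; ring)
  have hE3 : ∀ t : ℝ, HasDerivAt (fun t => Real.exp (-(κ / 2 * (t - T2))))
      (Real.exp (-(κ / 2 * (t - T2))) * (-(κ / 2))) t := fun t =>
    (((((hasDerivAt_id t).sub_const T2).const_mul (κ / 2)).neg).exp).congr_deriv
      (by simp only [id, Pi.neg_apply]; ring)
  have hX1 : ∀ t x : ℝ, HasDerivAt (fun x => Real.exp (-(k * (s * t - x))))
      (k * Real.exp (-(k * (s * t - x)))) x := fun t x =>
    (((((hasDerivAt_id x).const_sub (s * t)).const_mul k).neg).exp).congr_deriv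
      (by simp only [id, Pi.neg_apply]; ring)
  have hX2 : ∀ t x : ℝ, HasDerivAt (fun x => Real.exp (-(k * (s * t + x))))
      (-k * Real.exp (-(k * (s * t + x)))) x := fun t x =>
    (((((hasDerivAt_id x).const_add (s * t)).const_mul k).neg).exp).congr_deriv
      (by simp only [id, Pi.neg_apply]; ring)
  have hpos : ∀ t ≥ T2, 0 < s * t := fun t ht => mul_pos hs (by linarith)
  have main : ∀ t ≥ T2, ∀ x ∈ Icc (-(s * t)) (s * t),
      1 - D * (Real.exp (-(k * (s * t - x))) + Real.exp (-(k * (s * t + x)))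
        + Real.exp (-(κ / 2 * (t - T2)))) < u t x := by
    intro t ht
    refine S.lower hd (T0 := T2) (T := t) hT2.le (a := fun t => -(s * t)) (b := fun t => s * t)
      (w := fun t x => 1 - D * (Real.exp (-(k * (s * t - x))) + Real.exp (-(k * (s * t + x)))
        + Real.exp (-(κ / 2 * (t - T2)))))
      (wt := fun t x => -(D * (Real.exp (-(k * (s * t - x))) * (-(k * s)) +
        Real.exp (-(k * (s * t + x))) * (-(k * s))
        + Real.exp (-(κ / 2 * (t - T2))) * (-(κ / 2)))))
      (w1 := fun t x => -(D * (k * Real.exp (-(k * (s * t - x))) +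
        -k * Real.exp (-(k * (s * t + x))))))
      (w2 := fun t x => -(D * (k * (k * Real.exp (-(k * (s * t - x)))) +
        -k * (-k * Real.exp (-(k * (s * t + x)))))))
      (by fun_prop) (by fun_prop) (fun t ht => (hsp t ht.1).2.le)
      (fun t ht => (hsp t ht.1).1.le) (by fun_prop) ?_ ?_ ?_ ?_ ?_ ?_ ?_ t ⟨ht, le_rfl⟩
    · intro x hx
      have h1 := hge T2 le_rfl x ⟨(hsp T2 le_rfl).2.le.trans hx.1, hx.2.trans (hsp T2 le_rfl).1.le⟩
      have h2 := mul_pos hD0 (Real.exp_pos (-(k * (s * T2 - x))))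
      have h3 := mul_pos hD0 (Real.exp_pos (-(k * (s * T2 + x))))
      simp only [sub_self, mul_zero, neg_zero, Real.exp_zero]
      linarith
    · intro τ hτ _
      have h1 := hge τ hτ.1.le (-(s * τ)) ⟨(hsp τ hτ.1.le).2.le,
        by linarith [hpos τ hτ.1.le, (hsp τ hτ.1.le).1]⟩
      have h2 := mul_pos hD0 (Real.exp_pos (-(k * (s * τ - -(s * τ)))))
      have h3 := mul_pos hD0 (Real.exp_pos (-(κ / 2 * (τ - T2))))
      simp only [add_neg_cancel, mul_zero, neg_zero, Real.exp_zero]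
      linarith
    · intro τ hτ _
      have h1 := hge τ hτ.1.le (s * τ) ⟨by linarith [hpos τ hτ.1.le, (hsp τ hτ.1.le).2],
        (hsp τ hτ.1.le).1.le⟩
      have h2 := mul_pos hD0 (Real.exp_pos (-(k * (s * τ + (s * τ)))))
      have h3 := mul_pos hD0 (Real.exp_pos (-(κ / 2 * (τ - T2))))
      simp only [sub_self, mul_zero, neg_zero, Real.exp_zero]
      linarith
    · intro τ hτ x hx
      exact ((((hE1 τ x).add (hE2 τ x)).add (hE3 τ)).const_mul D).const_sub 1
    · intro τ hτ x hx
      exact ((((hX1 τ x).add (hX2 τ x)).add_const _).const_mul D).const_sub 1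
    · intro τ hτ x hx
      exact ((((hX1 τ x).const_mul k).add ((hX2 τ x).const_mul (-k))).const_mul D).neg
    · intro τ hτ x hx huw
      have h1 := hge τ hτ.1.le x ⟨(hsp τ hτ.1.le).2.le.trans hx.1.le,
        hx.2.le.trans (hsp τ hτ.1.le).1.le⟩
      have p1 := mul_pos hD0 (Real.exp_pos (-(k * (s * τ - x))))
      have p2 := mul_pos hD0 (Real.exp_pos (-(k * (s * τ + x))))
      have p3 := mul_pos hD0 (Real.exp_pos (-(κ / 2 * (τ - T2))))
      have h2 := F.low τ (by linarith [hτ.1]) x (u τ x) (by linarith)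
      have h3 := hfκ (u τ x) ⟨h1, by linarith⟩
      rw [huw] at h2 h3 ⊢
      have q1 := mul_lt_mul_of_pos_right hk1 p1
      have q2 := mul_lt_mul_of_pos_right hk1 p2
      have q3 := mul_pos hκ p3
      nlinarith
  refine ⟨D * (2 + Real.exp (κ / 2 * T2)), by positivity, min (k * s) (κ / 2),
    lt_min (by positivity) (by positivity), fun t ht => ?_⟩
  have ht0 : 0 < t := by linarith
  have h1 := main t ht 0 ⟨by linarith [hpos t ht], (hpos t ht).le⟩
  have e1 : Real.exp (-(k * (s * t - 0))) ≤ Real.exp (-(min (k * s) (κ / 2) * t)) := by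
    apply Real.exp_le_exp.2
    nlinarith [min_le_left (k * s) (κ / 2)]
  have e2 : Real.exp (-(k * (s * t + 0))) ≤ Real.exp (-(min (k * s) (κ / 2) * t)) := by
    apply Real.exp_le_exp.2
    nlinarith [min_le_left (k * s) (κ / 2)]
  have e3 : Real.exp (-(κ / 2 * (t - T2))) ≤
      Real.exp (κ / 2 * T2) * Real.exp (-(min (k * s) (κ / 2) * t)) := by
    rw [← Real.exp_add]
    apply Real.exp_le_exp.2
    nlinarith [min_le_right (k * s) (κ / 2)]
  have := mul_le_mul_of_nonneg_left (add_le_add (add_le_add e1 e2) e3) hD0.le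
  linarith

end

/-- The lower bound decreases near `1`. -/
theorem hs_near_one {fu : ℝ → ℝ} {δ : ℝ} (hδ1 : δ < 1) (hδ : 0 < δ)
    (hC : ContDiffOn ℝ 1 fu (Ici 0)) (h1 : derivWithin fu (Ici 0) 1 < 0) :
    ∃ κ > 0, ∃ ρ > 0, δ ≤ 1 - 2 * ρ ∧ AntitoneOn (fun v => fu v + κ * v) (Icc (1 - 2 * ρ) 1) := by
  have hc : ContinuousOn (derivWithin fu (Ici 0)) (Ici 0) :=
    hC.continuousOn_derivWithin (uniqueDiffOn_Ici 0) le_rfl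
  have hca : ContinuousAt (derivWithin fu (Ici 0)) 1 := hc.continuousAt (Ici_mem_nhds one_pos)
  set κ := -(derivWithin fu (Ici 0) 1) / 2 with hκ
  have hκ0 : 0 < κ := by rw [hκ]; linarith
  have hev := hca.eventually_lt_const (show derivWithin fu (Ici 0) 1 < -κ by rw [hκ]; linarith)
  obtain ⟨r, hr, hr1⟩ := Metric.eventually_nhds_iff.1 hev
  set ρ := min (r / 4) ((1 - δ) / 2) with hρ
  have hρ0 : 0 < ρ := lt_min (by positivity) (by linarith)
  have hρ1 : ρ ≤ r / 4 := min_le_left _ _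
  have hρ2 : ρ ≤ (1 - δ) / 2 := min_le_right _ _
  refine ⟨κ, hκ0, ρ, hρ0, by linarith, ?_⟩
  have hdiff : ∀ v, 0 < v → HasDerivAt fu (derivWithin fu (Ici 0) v) v := fun v hv =>
    ((hC.differentiableOn (by norm_num) v hv.le).hasDerivWithinAt).hasDerivAt (Ici_mem_nhds hv)
  have hd2 : ∀ v, 0 < v → HasDerivAt (fun v => fu v + κ * v) (derivWithin fu (Ici 0) v + κ) v :=
    fun v hv => ((hdiff v hv).add ((hasDerivAt_id v).const_mul κ)).congr_deriv (by ring)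
  refine antitoneOn_of_deriv_nonpos (convex_Icc _ _) ?_ ?_ ?_
  · intro v hv
    exact (hd2 v (by linarith [hv.1])).continuousAt.continuousWithinAt
  · intro v hv
    have := interior_subset hv
    exact (hd2 v (by linarith [this.1])).differentiableAt.differentiableWithinAt
  · intro v hv
    have hv' := interior_subset hv
    rw [(hd2 v (by linarith [hv'.1])).deriv]
    have := hr1 (y := v) (by rw [Real.dist_eq, abs_lt]; constructor <;> linarith [hv'.1, hv'.2])
    linarith

theorem hs_kappa {fu : ℝ → ℝ} {δ : ℝ} (hδ1 : δ < 1) (hδ : 0 < δ)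
    (hC : ContDiffOn ℝ 1 fu (Ici 0)) (h1 : derivWithin fu (Ici 0) 1 < 0) (hf1 : fu 1 = 0)
    (hpos : ∀ v ∈ Ico δ 1, 0 < fu v) :
    ∃ κ > 0, ∀ v ∈ Icc δ 1, κ * (1 - v) ≤ fu v := by
  obtain ⟨κ, hκ, ρ, hρ, hρδ, hA⟩ := hs_near_one hδ1 hδ hC h1
  obtain ⟨v0, hv0, hmin⟩ := (isCompact_Icc (a := δ) (b := 1 - 2 * ρ)).exists_isMinOn
    ⟨δ, left_mem_Icc.2 hρδ⟩ (hC.continuousOn.mono fun v hv => hδ.le.trans hv.1)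
  have hμ : 0 < fu v0 := hpos v0 ⟨hv0.1, by linarith [hv0.2]⟩
  refine ⟨min κ (fu v0), lt_min hκ hμ, fun v hv => ?_⟩
  have h1v : 0 ≤ 1 - v := sub_nonneg.2 hv.2
  rcases le_total v (1 - 2 * ρ) with h | h
  · have e1 : fu v0 ≤ fu v := hmin ⟨hv.1, h⟩
    have e2 := mul_le_mul_of_nonneg_right (min_le_right κ (fu v0)) h1v
    nlinarith [hv.1]
  · have e1 := hA (a := v) (b := 1) ⟨h, hv.2⟩ ⟨by linarith, le_rfl⟩ hv.2
    simp only [hf1] at e1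
    have e2 := mul_le_mul_of_nonneg_right (min_le_left κ (fu v0)) h1v
    linarith

theorem hs_lip {fu : ℝ → ℝ} {δ : ℝ} (hδ : 0 < δ) (hC : ContDiffOn ℝ 1 fu (Ici 0)) :
    ∃ L > 0, ∀ v ∈ Icc δ 1, ∀ w ∈ Icc δ 1, v ≤ w → fu w - fu v ≤ L * (w - v) := by
  have hc : ContinuousOn (derivWithin fu (Ici 0)) (Icc δ 1) :=
    (hC.continuousOn_derivWithin (uniqueDiffOn_Ici 0) le_rfl).mono fun v hv => hδ.le.trans hv.1
  obtain ⟨L, hL⟩ := isCompact_Icc.exists_bound_of_continuousOn hc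
  have hdiff : ∀ v, 0 < v → HasDerivAt fu (derivWithin fu (Ici 0) v) v := fun v hv =>
    ((hC.differentiableOn (by norm_num) v hv.le).hasDerivWithinAt).hasDerivAt (Ici_mem_nhds hv)
  refine ⟨max L 1, by positivity, fun v hv w hw hvw => ?_⟩
  have := (convex_Icc δ (1:ℝ)).norm_image_sub_le_of_norm_hasDerivWithin_le (C := L) (f := fu)
    (f' := derivWithin fu (Ici 0)) (fun x hx => (hdiff x (by linarith [hx.1])).hasDerivWithinAt) hL
    hv hw
  rw [Real.norm_eq_abs, Real.norm_eq_abs, abs_of_nonneg (sub_nonneg.2 hvw)] at this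
  have h2 := mul_le_mul_of_nonneg_right (le_max_left L 1) (sub_nonneg.2 hvw)
  linarith [le_abs_self (fu w - fu v)]

/-- Properties of the semi-wave profile used below. -/
structure HsWave (d δ c : ℝ) (fu q Q1 Q2 : ℝ → ℝ) : Prop where
  q0 : q 0 = δ
  qd : ∀ z, 0 ≤ z → HasDerivWithinAt q (Q1 z) (Ici 0) z
  q2 : ∀ z, 0 < z → HasDerivAt Q1 (Q2 z) z
  q1c : ContinuousOn Q1 (Ici 0)
  pos : ∀ z, 0 ≤ z → 0 < Q1 z
  ode : ∀ z, 0 ≤ z → d * Q2 z - c * Q1 z + fu (q z) = 0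
  lim : Tendsto q atTop (nhds 1)
  st : Q1 0 = c * δ / d

section
variable {d δ c : ℝ} {fu q Q1 Q2 : ℝ → ℝ}

theorem HsWave.mono (W : HsWave d δ c fu q Q1 Q2) : StrictMonoOn q (Ici 0) := by
  refine strictMonoOn_of_deriv_pos (convex_Ici 0)
    (fun z hz => (W.qd z hz).continuousWithinAt) ?_
  intro z hz
  rw [interior_Ici] at hz
  rw [((W.qd z hz.le).hasDerivAt (Ici_mem_nhds hz)).deriv]
  exact W.pos z hz.le

theorem HsWave.ge (W : HsWave d δ c fu q Q1 Q2) {z : ℝ} (hz : 0 ≤ z) : δ ≤ q z := by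
  rw [← W.q0]; exact W.mono.monotoneOn self_mem_Ici hz hz

theorem HsWave.lt_one (W : HsWave d δ c fu q Q1 Q2) {z : ℝ} (hz : 0 ≤ z) : q z < 1 := by
  have h1 : q z < q (z + 1) := W.mono hz (by simp only [mem_Ici]; linarith) (by linarith)
  refine h1.trans_le (ge_of_tendsto W.lim ?_)
  filter_upwards [eventually_ge_atTop (z + 1)] with y hy
  exact W.mono.monotoneOn (by simp only [mem_Ici]; linarith) (by simp only [mem_Ici]; linarith) hy

theorem HsWave.sub (W : HsWave d δ c fu q Q1 Q2) (hδ : 0 < δ) (hδ1 : δ < 1)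
    (hC : ContDiffOn ℝ 1 fu (Ici 0)) (h1 : derivWithin fu (Ici 0) 1 < 0)
    (hpos : ∀ v ∈ Ico δ 1, 0 < fu v) :
    ∃ κ > 0, ∃ K > c, 0 < K ∧ ∃ ε > 0, ε < 1 ∧ ∀ κ2 ≤ κ, ∀ e, 0 < e → e ≤ ε → ∀ z, 0 < z →
      κ2 * e * (q z - δ) + (1 - e) * ((c - K * e) * Q1 z)
        < d * ((1 - e) * Q2 z) + fu (δ + (1 - e) * (q z - δ)) := by
  obtain ⟨κ, hκ, ρ, hρ, hρδ, hA⟩ := hs_near_one hδ1 hδ hC h1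
  obtain ⟨L, hL, hLip⟩ := hs_lip hδ hC
  obtain ⟨Z, hZ⟩ := eventually_atTop.1 (W.lim.eventually_const_lt (show 1 - ρ < 1 by linarith))
  set Z' := max Z 0
  obtain ⟨zm, hzm, hmin⟩ := (isCompact_Icc (a := 0) (b := Z')).exists_isMinOn
    ⟨0, left_mem_Icc.2 (le_max_right _ _)⟩ (W.q1c.mono fun z hz => hz.1)
  set m := Q1 zm with hm
  have hm0 : 0 < m := W.pos zm hzm.1
  set K := max (max c 0 + 1) (2 * (κ + L) / m + 1) with hK
  have hK1 : max c 0 + 1 ≤ K := le_max_left _ _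
  have hK2 : 2 * (κ + L) / m + 1 ≤ K := le_max_right _ _
  have hK0 : 0 < K := by linarith [le_max_right c 0]
  refine ⟨κ, hκ, K, by linarith [le_max_left c 0], hK0, min ρ (1 / 2),
    lt_min hρ (by norm_num), by linarith [min_le_right ρ (1 / 2 : ℝ)], ?_⟩
  intro κ2 hκ2 e he heε z hz
  have he1 : e ≤ ρ := heε.trans (min_le_left _ _)
  have he2 : e ≤ 1 / 2 := heε.trans (min_le_right _ _)
  have hode := W.ode z hz.le
  have hq0 := W.ge hz.le
  have hq1 := W.lt_one hz.le
  have hQ1 := W.pos z hz.le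
  have hfq := hpos (q z) ⟨hq0, hq1⟩
  have hdQ : d * ((1 - e) * Q2 z) = (1 - e) * (c * Q1 z - fu (q z)) := by
    have : d * Q2 z = c * Q1 z - fu (q z) := by linarith
    rw [← this]; ring
  rw [hdQ]
  have hv : δ + (1 - e) * (q z - δ) = q z - e * (q z - δ) := by ring
  rw [hv]
  have ep : 0 ≤ e * (q z - δ) := mul_nonneg he.le (by linarith)
  have ep1 : e * (q z - δ) ≤ e := by nlinarith
  have ep2 : e * (q z - δ) ≤ q z - δ := by nlinarith
  have hk2 : κ2 * (e * (q z - δ)) ≤ κ * (e * (q z - δ)) := mul_le_mul_of_nonneg_right hκ2 ep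
  have hefq : 0 < e * fu (q z) := mul_pos he hfq
  have hQe : 0 < e * Q1 z := mul_pos he hQ1
  have hKQ : K * (e * Q1 z) * (1 / 2) ≤ K * (e * Q1 z) * (1 - e) :=
    mul_le_mul_of_nonneg_left (by linarith) (by positivity)
  rcases le_total (1 - ρ) (q z) with hc | hc
  · have a1 := hA (a := q z - e * (q z - δ)) (b := q z) ⟨by linarith, by linarith⟩
      ⟨by linarith, hq1.le⟩ (by linarith)
    simp only at a1
    have : 0 < K * (e * Q1 z) := by positivity
    nlinarith
  · have hzZ : z < Z := by
      by_contra hcon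
      linarith [hZ z (not_lt.1 hcon)]
    have hQm : m ≤ Q1 z := hmin ⟨hz.le, hzZ.le.trans (le_max_left _ _)⟩
    have a1 := hLip (q z - e * (q z - δ)) ⟨by linarith, by linarith⟩ (q z) ⟨hq0, hq1.le⟩ (by linarith)
    have a2 : L * (q z - (q z - e * (q z - δ))) ≤ L * e :=
      mul_le_mul_of_nonneg_left (by linarith) hL.le
    have a3 : κ * (e * (q z - δ)) ≤ κ * e := mul_le_mul_of_nonneg_left ep1 hκ.le
    have a4 : 2 * (κ + L) < K * m := by
      have : 2 * (κ + L) / m < K := by linarith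
      rwa [div_lt_iff₀ hm0] at this
    have a5 : K * m * e ≤ K * (e * Q1 z) := by
      have := mul_le_mul_of_nonneg_left hQm (mul_pos hK0 he).le
      linarith
    have a6 := mul_lt_mul_of_pos_right a4 he
    nlinarith
end

section
variable {d δ : ℝ} {f : ℝ → ℝ → ℝ → ℝ} {u : ℝ → ℝ → ℝ} {g h : ℝ → ℝ}

/-- Sharp lower bound for the right front. -/
theorem HsSol.fast_right (S : HsSol d δ f u g h) (hd : 0 < d) (hδ : 0 < δ) (hδ1 : δ < 1)
    {fbar fu : ℝ → ℝ} (F : HsF f fbar fu) {c : ℝ} {q Q1 Q2 : ℝ → ℝ}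
    (W : HsWave d δ c fu q Q1 Q2)
    (hC : ContDiffOn ℝ 1 fu (Ici 0)) (h1 : derivWithin fu (Ici 0) 1 < 0)
    (hpos : ∀ v ∈ Ico δ 1, 0 < fu v) {T2 C κ' : ℝ} (hT2 : 0 < T2)
    (hge : ∀ t ≥ T2, ∀ x ∈ Icc (g t) (h t), δ ≤ u t x)
    (hin : ∀ t ≥ T2, g t < 0 ∧ 0 < h t) (hκ' : 0 < κ')
    (hcen : ∀ t ≥ T2, 1 - C * Real.exp (-(κ' * t)) < u t 0) :
    ∃ T0 > 0, ∃ M > 0, ∃ E : ℝ → ℝ, Tendsto E atTop (nhds 0) ∧ ∀ t ≥ T0, E t ≤ 1 ∧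
      c * t - M < h t ∧
      ∀ x ∈ Icc 0 (c * t - M), δ + (1 - E t) * (q (c * t - M - x) - δ) < u t x := by
  obtain ⟨κ, hκ, K, hKc, hK0, ε, hε, hε1, hsub⟩ := W.sub hδ hδ1 hC h1 hpos
  set κ2 := min κ κ' with hκ2
  have hκ20 : 0 < κ2 := lt_min hκ hκ'
  have hlim : Tendsto (fun t : ℝ => C * Real.exp (-(κ' * t))) atTop (nhds 0) := by
    have : Tendsto (fun t : ℝ => Real.exp (-(κ' * t))) atTop (nhds 0) :=
      Real.tendsto_exp_neg_atTop_nhds_zero.comp (tendsto_id.const_mul_atTop hκ')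
    simpa using this.const_mul C
  obtain ⟨T0, hT01, hT02⟩ := ((hlim.eventually_le_const
    (show 0 < ε * (1 - δ) from mul_pos hε (by linarith))).and (eventually_gt_atTop T2)).exists
  set e : ℝ → ℝ := fun t => ε * Real.exp (-(κ2 * (t - T0))) with he
  have hexp : ∀ t, HasDerivAt (fun t => Real.exp (-(κ2 * (t - T0))))
      (Real.exp (-(κ2 * (t - T0))) * (-κ2)) t := fun t =>
    (((((hasDerivAt_id t).sub_const T0).const_mul κ2).neg).exp).congr_deriv
      (by simp only [id, Pi.neg_apply]; ring)
  have he0 : ∀ t, 0 < e t := fun t => by positivity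
  have heε : ∀ t ≥ T0, e t ≤ ε := fun t ht => by
    have : Real.exp (-(κ2 * (t - T0))) ≤ 1 := by
      rw [Real.exp_le_one_iff]
      have := mul_nonneg hκ20.le (sub_nonneg.2 ht)
      linarith
    have := mul_le_mul_of_nonneg_left this hε.le
    simp only [he]; linarith
  have key := S.fb hd hδ F (hpos δ ⟨le_rfl, hδ1⟩) hT2 hge (x0 := 0) (T0 := T0) hT02
    (fun t ht => hin t (by linarith))
    (h1 := fun t => c * (t - T0) - K * ε / κ2 * (1 - Real.exp (-(κ2 * (t - T0)))))
    (h1' := fun t => c - K * e t) (A := fun t => 1 - e t) (A' := fun t => κ2 * e t)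
    (Q := q) (Q1 := Q1) (Q2 := Q2)
    (fun t => ((((hasDerivAt_id t).sub_const T0).const_mul c).sub
      (((hexp t).const_sub 1).const_mul (K * ε / κ2))).congr_deriv
        (by simp only [he]; field_simp))
    (fun t => (((hexp t).const_mul ε).const_sub 1).congr_deriv (by simp only [he]; ring))
    W.q0 W.qd W.q2 (fun z hz => W.ge hz) (fun t ht => by linarith [heε t ht]) (by simp)
    (fun t ht h0 => by
      have a1 := hcen t (by linarith)
      rw [sub_zero]
      have a2 := W.lt_one h0
      have a3 : 0 < 1 - e t := by linarith [heε t ht]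
      have a4 := mul_lt_mul_of_pos_left a2 a3
      have a5 : C * Real.exp (-(κ' * t)) ≤ e t * (1 - δ) := by
        have b1 : Real.exp (-(κ' * t)) = Real.exp (-(κ' * T0)) * Real.exp (-(κ' * (t - T0))) := by
          rw [← Real.exp_add]; congr 1; ring
        have b2 : Real.exp (-(κ' * (t - T0))) ≤ Real.exp (-(κ2 * (t - T0))) := by
          apply Real.exp_le_exp.2
          have := mul_le_mul_of_nonneg_right (min_le_right κ κ') (sub_nonneg.2 ht)
          linarith
        have b3 := mul_le_mul_of_nonneg_right hT01 (Real.exp_pos (-(κ' * (t - T0)))).le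
        have b4 := mul_le_mul_of_nonneg_left b2 (mul_pos hε (sub_pos.2 hδ1)).le
        rw [b1]; simp only [he]; nlinarith
      nlinarith)
    (fun t ht => by
      rw [W.st]
      have : d / δ * ((1 - e t) * (c * δ / d)) = (1 - e t) * c := by field_simp
      rw [this]
      have := mul_lt_mul_of_pos_right hKc (he0 t)
      linarith)
    (fun t ht z hz => hsub κ2 (min_le_left _ _) (e t) (he0 t) (heε t ht) z hz)
  have hc0 : 0 < c := by
    have := W.pos 0 le_rfl
    rw [W.st, div_pos_iff_of_pos_right hd, mul_pos_iff_of_pos_right hδ] at this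
    exact this
  have hT00 : 0 < T0 := hT2.trans hT02
  refine ⟨T0, hT00, c * T0 + K * ε / κ2, by positivity, e, ?_, ?_⟩
  · have : Tendsto (fun t : ℝ => Real.exp (-(κ2 * (t - T0)))) atTop (nhds 0) :=
      Real.tendsto_exp_neg_atTop_nhds_zero.comp
        ((tendsto_atTop_add_const_right _ (-T0) tendsto_id).const_mul_atTop hκ20)
    simpa using this.const_mul ε
  · intro t ht
    have hle : c * t - (c * T0 + K * ε / κ2) ≤
        c * (t - T0) - K * ε / κ2 * (1 - Real.exp (-(κ2 * (t - T0)))) := by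
      have : 0 < K * ε / κ2 * Real.exp (-(κ2 * (t - T0))) := by positivity
      linarith
    refine ⟨by linarith [heε t ht], hle.trans_lt (key t ht).1, fun x hx => ?_⟩
    refine lt_of_le_of_lt ?_ ((key t ht).2 x ⟨hx.1, hx.2.trans hle⟩)
    have a3 : 0 ≤ 1 - e t := by linarith [heε t ht]
    have := W.mono.monotoneOn (a := c * t - (c * T0 + K * ε / κ2) - x)
      (b := c * (t - T0) - K * ε / κ2 * (1 - Real.exp (-(κ2 * (t - T0)))) - x)
      (by simp only [mem_Ici]; linarith [hx.2]) (by simp only [mem_Ici]; linarith [hx.2])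
      (by linarith)
    have := mul_le_mul_of_nonneg_left (sub_le_sub_right this δ) a3
    linarith
end

section
variable {d δ : ℝ} {f : ℝ → ℝ → ℝ → ℝ} {u : ℝ → ℝ → ℝ} {g h : ℝ → ℝ}

/-- From the front estimate to convergence behind the front. -/
theorem hs_right_lim {δ c M T0 : ℝ} {fu q Q1 Q2 E : ℝ → ℝ} {d : ℝ}
    (W : HsWave d δ c fu q Q1 Q2) (hE : Tendsto E atTop (nhds 0)) {u : ℝ → ℝ → ℝ} {h : ℝ → ℝ}
    (hk : ∀ t ≥ T0, E t ≤ 1 ∧ c * t - M < h t ∧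
      ∀ x ∈ Icc 0 (c * t - M), δ + (1 - E t) * (q (c * t - M - x) - δ) < u t x)
    {ε ε' : ℝ} (hε : 0 < ε) (hε' : 0 < ε') :
    ∀ᶠ t in atTop, ∀ x ∈ Icc 0 ((c - ε) * t), x < h t ∧ 1 - ε' < u t x := by
  have hz : Tendsto (fun t : ℝ => ε * t - M) atTop atTop :=
    tendsto_atTop_add_const_right _ (-M) (tendsto_id.const_mul_atTop hε)
  have hl : Tendsto (fun t => δ + (1 - E t) * (q (ε * t - M) - δ)) atTop
      (nhds (δ + (1 - 0) * (1 - δ))) :=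
    ((hE.const_sub 1).mul ((W.lim.comp hz).sub_const δ)).const_add δ
  filter_upwards [hl.eventually_const_lt (show 1 - ε' < δ + (1 - 0) * (1 - δ) by linarith),
    eventually_ge_atTop T0, hz.eventually_ge_atTop 0] with t h1 h2 h3 x hx
  obtain ⟨k1, k2, k3⟩ := hk t h2
  have hx2 := hx.2
  refine ⟨by linarith, h1.trans (lt_of_le_of_lt ?_ (k3 x ⟨hx.1, by linarith⟩))⟩
  have := W.mono.monotoneOn (a := ε * t - M) (b := c * t - M - x) h3
    (by simp only [mem_Ici]; linarith) (by linarith)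
  have := mul_le_mul_of_nonneg_left (sub_le_sub_right this δ) (sub_nonneg.2 k1)
  linarith

/-- All conclusions for the abstract formulation. -/
theorem HsSol.main (S : HsSol d δ f u g h) (hd : 0 < d) (hδ : 0 < δ) (hδ1 : δ < 1)
    {fbar fu : ℝ → ℝ} (F : HsF f fbar fu) {c : ℝ} {q Q1 Q2 : ℝ → ℝ}
    (W : HsWave d δ c fu q Q1 Q2) (hc : 0 < c)
    (hbc : ContinuousOn fbar (Ici 1)) (hbn : ∀ v, 1 < v → fbar v < 0)
    (hC : ContDiffOn ℝ 1 fu (Ici 0)) (h1 : derivWithin fu (Ici 0) 1 < 0) (hf1 : fu 1 = 0)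
    (hpos : ∀ v ∈ Ico δ 1, 0 < fu v) {b2 η m : ℝ} (hb2 : b2 ∈ Ioo 0 δ) (hη : 0 < η)
    (hfη : ∀ b ∈ Icc b2 δ, η ≤ fu b) (hm : 0 < m)
    (hFm : ∀ b ∈ Icc 0 b2, m ≤ ∫ r in b..δ, fu r) :
    (∃ M₀ > 0, ∀ t > 0, Icc (-(c * t) + M₀) (c * t - M₀) ⊆ Icc (g t) (h t)) ∧
    ∀ ε ∈ Ioo (0:ℝ) c, ∀ ε' > 0, ∀ᶠ t in atTop,
      ∀ x ∈ Icc (-((c - ε) * t)) ((c - ε) * t), g t < x ∧ x < h t ∧ |u t x - 1| < ε' := by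
  obtain ⟨T2, hT2, hge⟩ := S.ev_ge hd hδ F hC.continuousOn hb2 hη hfη hm hFm
  obtain ⟨κ, hκ, hfκ⟩ := hs_kappa hδ1 hδ hC h1 hf1 hpos
  obtain ⟨s, hs, T, hT, hsp⟩ := S.slow hd hδ F (η := κ * (1 - (δ + 1) / 2)) (δ1 := (δ + 1) / 2)
    (mul_pos hκ (by linarith)) (by linarith)
    (fun v hv => (mul_le_mul_of_nonneg_left (by linarith [hv.2]) hκ.le).trans
      (hfκ v ⟨hv.1, by linarith [hv.2]⟩)) hT2 hge
  have hT0 : 0 < T := hT2.trans hT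
  have hge' : ∀ t ≥ T, ∀ x ∈ Icc (g t) (h t), δ ≤ u t x := fun t ht => hge t (by linarith)
  obtain ⟨C, hC0, κ', hκ', hcen⟩ := S.center hd hδ hδ1 F hκ hfκ hT0 hs hge' hsp
  have hin : ∀ t ≥ T, g t < 0 ∧ 0 < h t := fun t ht => by
    have : 0 < s * t := mul_pos hs (by linarith)
    constructor <;> linarith [hsp t ht]
  obtain ⟨T3, hT3, M3, hM3, E3, hE3, hR⟩ :=
    S.fast_right hd hδ hδ1 F W hC h1 hpos hT0 hge' hin hκ' hcen
  obtain ⟨T4, hT4, M4, hM4, E4, hE4, hL⟩ :=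
    S.refl.fast_right hd hδ hδ1 F.refl W hC h1 hpos hT0 (HsSol.ge_refl hge')
      (fun t ht => ⟨by linarith [(hin t ht).2], by linarith [(hin t ht).1]⟩) hκ'
      (by simpa using hcen)
  constructor
  · refine ⟨M3 + M4 + c * (T3 + T4), by positivity, fun t ht x hx => ?_⟩
    have hx1 := hx.1
    have hx2 := hx.2
    have ht' : T3 + T4 ≤ t := by
      have : c * (T3 + T4) ≤ c * t := by linarith
      exact le_of_mul_le_mul_left this hc
    have p3 := (hR t (by linarith)).2.1
    have p4 := (hL t (by linarith)).2.1
    have : 0 < c * (T3 + T4) := by positivity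
    exact ⟨by linarith, by linarith⟩
  · intro ε hε ε' hε'
    obtain ⟨T5, hT5, hup⟩ := S.upper_lim hd hδ1 F hbc hbn hε'
    filter_upwards [hs_right_lim W hE3 hR hε.1 hε', hs_right_lim W hE4 hL hε.1 hε',
      eventually_ge_atTop T5, eventually_ge_atTop T] with t e1 e2 e3 e4 x hx
    have key : g t < x ∧ x < h t ∧ 1 - ε' < u t x := by
      rcases le_total 0 x with h0 | h0
      · have := e1 x ⟨h0, hx.2⟩
        exact ⟨by linarith [(hin t e4).1], this.1, this.2⟩
      · have := e2 (-x) ⟨by linarith, by linarith [hx.1]⟩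
        rw [neg_neg] at this
        exact ⟨by linarith [this.1], by linarith [(hin t e4).2], this.2⟩
    refine ⟨key.1, key.2.1, ?_⟩
    have := hup t e3 x ⟨key.1.le, key.2.1.le⟩
    rw [abs_lt]
    constructor <;> linarith [key.2.2]

end

/-- Theorem 3.1, elimination of Allee effects in heterogeneous
environments. -/
theorem hetero_spreading (d δ h₀ θ θs β c : ℝ) (f : ℝ → ℝ → ℝ → ℝ)
    (fbar funder u₀ q : ℝ → ℝ) (u : ℝ → ℝ → ℝ) (g h : ℝ → ℝ)
    (hd : 0 < d) (hh₀ : 0 < h₀)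
    (hf4 : CondF4 f fbar funder θ β)
    (hθs : IsThetaStar funder θ θs) (hδ : δ ∈ Ioo θs 1)
    (hsw : SemiWavePair d δ funder c q)
    (hu₀ : InX δ h₀ u₀)
    (hsol : ClassicalSolution d δ h₀ f u₀ (Ici (0:ℝ)) u g h) :
    (Tendsto g atTop atBot ∧ Tendsto h atTop atTop ∧
      ∀ a b : ℝ, a ≤ b →
        (∃ T > 0, ∀ t ≥ T, g t < a ∧ b < h t) ∧
        (∀ ε > 0, ∃ T > 0, ∀ t ≥ T, ∀ x ∈ Icc a b, |u t x - 1| < ε)) ∧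
    (∃ M₀ > 0, ∀ t > 0,
      Icc (-(c * t) + M₀) (c * t - M₀) ⊆ Icc (g t) (h t)) ∧
    ∀ ε ∈ Ioo (0:ℝ) c, ∀ ε' > 0, ∃ T > 0, ∀ t ≥ T,
      ∀ x ∈ Icc (-((c - ε) * t)) ((c - ε) * t), |u t x - 1| < ε' := by
  obtain ⟨⟨⟨hβ, hhol, hC1, hf0, hlip⟩, hft1, hbc, hbar⟩, ⟨hC, hθ, hfu0, hfuθ, hfu1, hfd0, hfd1,
    hneg, hposθ, hneg1, hint⟩, hlow⟩ := hf4
  obtain ⟨hθs1, hθs2, hθs3⟩ := hθs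
  obtain ⟨hc, hqC, hode, hqpos, hq0, hqlim, hqst, hqmono⟩ := hsw
  have hδ0 : 0 < δ := by linarith [hδ.1, hθs1.1, hθ.1]
  have hθδ : θ < δ := by linarith [hδ.1, hθs1.1]
  -- the reaction term
  have F : HsF f fbar funder := by
    refine ⟨fun t ht x v hv => hlow t ht x v hv, fun t ht x v hv => (hbar t ht x v hv).1, ?_⟩
    intro M hM
    obtain ⟨L, hL, h1⟩ := hlip M hM
    refine ⟨L, hL, fun t ht x v hv => ?_⟩
    have := h1 t ht x v hv 0 ⟨le_rfl, hM.le⟩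
    rw [hf0 t ht x, sub_zero, sub_zero, abs_of_nonneg hv.1] at this
    linarith [neg_abs_le (f t x v)]
  -- the solution
  have S : HsSol d δ f u g h := by
    have hgd : ∀ t, 0 < t → HasDerivAt g (-(d / δ) * deriv (u t) (g t)) t := fun t ht => by
      rw [← hsol.stefan_g t ht.le ht]
      exact ((hsol.g_reg.differentiableOn (by norm_num) t ht.le).differentiableAt
        (Ici_mem_nhds ht)).hasDerivAt
    have hhd : ∀ t, 0 < t → HasDerivAt h (-(d / δ) * deriv (u t) (h t)) t := fun t ht => by
      rw [← hsol.stefan_h t ht.le ht]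
      exact ((hsol.h_reg.differentiableOn (by norm_num) t ht.le).differentiableAt
        (Ici_mem_nhds ht)).hasDerivAt
    refine ⟨hsol.g_reg.continuousOn, hsol.h_reg.continuousOn, hgd, hhd,
      fun t ht => hsol.g_lt_h t ht, hsol.u_cont, fun t ht => hsol.ut_diff t ht.le ht,
      fun t ht => hsol.ux_diff t ht.le ht, fun t ht => hsol.uxx_diff t ht.le ht,
      fun t ht => hsol.pde t ht.le ht, fun t ht => hsol.bc_g t ht.le ht,
      fun t ht => hsol.bc_h t ht.le ht, ?_⟩
    intro x hx
    rw [hsol.g_init, hsol.h_init] at hx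
    rw [hsol.u_init x hx]
    exact hu₀.2.2.2 x hx
  -- the semi-wave
  have hQC : ContDiffOn ℝ 1 (derivWithin q (Ici 0)) (Ici 0) :=
    hqC.derivWithin (uniqueDiffOn_Ici 0) (by norm_num)
  have W : HsWave d δ c funder q (derivWithin q (Ici 0))
      (derivWithin (derivWithin q (Ici 0)) (Ici 0)) := by
    refine ⟨hq0, fun z hz => (hqC.differentiableOn (by norm_num) z hz).hasDerivWithinAt,
      fun z hz => ((hQC.differentiableOn (by norm_num) z hz.le).hasDerivWithinAt).hasDerivAt
        (Ici_mem_nhds hz), hQC.continuousOn, hqmono, hode, hqlim, hqst⟩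
  -- integral data
  obtain ⟨b2, hb2θ, hb2δ⟩ := exists_between hθδ
  have hb20 : 0 < b2 := hθ.1.trans_lt hb2θ
  obtain ⟨v0, hv0, hv0m⟩ := (isCompact_Icc (a := b2) (b := δ)).exists_isMinOn
    ⟨b2, left_mem_Icc.2 hb2δ.le⟩ (hC.continuousOn.mono fun v hv => hb20.le.trans hv.1)
  have hη : 0 < funder v0 := hposθ v0 ⟨hb2θ.trans_le hv0.1, hv0.2.trans_lt hδ.2⟩
  have hii : ∀ a b : ℝ, 0 ≤ a → 0 ≤ b → IntervalIntegrable funder MeasureTheory.volume a b :=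
    fun a b ha hb => (hC.continuousOn.mono fun v hv => (le_min ha hb).trans hv.1).intervalIntegrable
  obtain ⟨m, hm, hFm⟩ : ∃ m > 0, ∀ b ∈ Icc 0 b2, m ≤ ∫ r in b..δ, funder r := by
    have hI : 0 < ∫ r in b2..δ, funder r :=
      intervalIntegral.intervalIntegral_pos_of_pos_on (hii _ _ hb20.le hδ0.le)
        (fun x hx => hposθ x ⟨hb2θ.trans hx.1, hx.2.trans hδ.2⟩) hb2δ
    have hJ : 0 < ∫ r in (0:ℝ)..δ, funder r := hθs3 δ ⟨hδ.1, hδ.2.le⟩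
    refine ⟨min (∫ r in b2..δ, funder r) (∫ r in (0:ℝ)..δ, funder r), lt_min hI hJ, fun b hb => ?_⟩
    rcases le_total b θ with hbθ | hbθ
    · have e1 := intervalIntegral.integral_add_adjacent_intervals (hii 0 b le_rfl hb.1)
        (hii b δ hb.1 hδ0.le)
      have e2 : ∫ r in (0:ℝ)..b, funder r ≤ 0 :=
        by
          have e3 : 0 ≤ ∫ r in (0:ℝ)..b, -funder r :=
            intervalIntegral.integral_nonneg hb.1 fun x hx => by
              linarith [hneg x ⟨hx.1, hx.2.trans hbθ⟩]
          rw [intervalIntegral.integral_neg] at e3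
          linarith
      exact (min_le_right _ _).trans (by linarith)
    · have e1 := intervalIntegral.integral_add_adjacent_intervals (hii b b2 hb.1 hb20.le)
        (hii b2 δ hb20.le hδ0.le)
      have e2 : 0 ≤ ∫ r in b..b2, funder r :=
        intervalIntegral.integral_nonneg hb.2 fun x hx => by
          rcases (hbθ.trans hx.1).eq_or_lt with h0 | h0
          · rw [← h0, hfuθ]
          · exact (hposθ x ⟨h0, by linarith [hx.2, hδ.2]⟩).le
      exact (min_le_left _ _).trans (by linarith)
  obtain ⟨P2, P3⟩ := S.main hd hδ0 hδ.2 F W hc hbc (fun v hv => (hbar 0 self_mem_Ici 0 v hv).2)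
    hC hfd1 hfu1 (fun v hv => hposθ v ⟨hθδ.trans_le hv.1, hv.2⟩) ⟨hb20, hb2δ⟩ hη
    (fun b hb => hv0m hb) hm hFm
  -- local statements
  have hloc : ∀ a b : ℝ, ∀ ε > 0, ∀ᶠ t in atTop, ∀ x ∈ Icc a b,
      g t < x ∧ x < h t ∧ |u t x - 1| < ε := by
    intro a b ε hε
    have hc2 : 0 < c - c / 2 := by linarith
    have hl : Tendsto (fun t : ℝ => (c - c / 2) * t) atTop atTop :=
      tendsto_id.const_mul_atTop hc2
    filter_upwards [P3 (c / 2) ⟨by linarith, by linarith⟩ ε hε, hl.eventually_ge_atTop (-a),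
      hl.eventually_ge_atTop b] with t h1 h2 h3 x hx
    exact h1 x ⟨by linarith [hx.1], by linarith [hx.2]⟩
  have hexT : ∀ p : ℝ → Prop, (∀ᶠ t in atTop, p t) → ∃ T > 0, ∀ t ≥ T, p t := by
    intro p hp
    obtain ⟨T, hT⟩ := eventually_atTop.1 hp
    exact ⟨max T 1, by positivity, fun t ht => hT t ((le_max_left _ _).trans ht)⟩
  refine ⟨⟨?_, ?_, ?_⟩, P2, ?_⟩
  · refine tendsto_atBot.2 fun a => ?_
    filter_upwards [hloc a a 1 one_pos] with t ht
    exact (ht a ⟨le_rfl, le_rfl⟩).1.le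
  · refine tendsto_atTop.2 fun a => ?_
    filter_upwards [hloc a a 1 one_pos] with t ht
    exact (ht a ⟨le_rfl, le_rfl⟩).2.1.le
  · intro a b hab
    refine ⟨hexT _ ?_, fun ε hε => hexT _ ?_⟩
    · filter_upwards [hloc a b 1 one_pos] with t ht
      exact ⟨(ht a ⟨le_rfl, hab⟩).1, (ht b ⟨hab, le_rfl⟩).2.1⟩
    · filter_upwards [hloc a b ε hε] with t ht x hx
      exact (ht x hx).2.2
  · intro ε hε ε' hε'
    refine hexT _ ?_
    filter_upwards [P3 ε hε ε' hε'] with t ht x hx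
    exact (ht x hx).2.2
end

section
/- Theorem 3.2 (vanishing when δ > 1). Assume δ ∈ (1,∞), part (i) of condition (f4) holds, and additionally f(t,x,u) is uniformly Hölder continuous of exponent β/2 in t for t ≥ 0, x ∈ ℝ, u ∈ [0,δ]. Let (u,g,h) be a classical solution of the free boundary problem (c) with initial datum u₀ ∈ X(h₀) on [0,∞). Then there exists ξ* ∈ ℝ, depending on f and u₀, such that lim_{t→∞} g(t) = lim_{t→∞} h(t) = ξ*, and sup_{x ∈ [g(t),h(t)]} |u(t,x) − δ| → 0 as t → ∞. -/
open Set Filter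

theorem second_deriv_nonneg_aux (F zx : ℝ → ℝ) (x zxx : ℝ)
    (hmin : IsLocalMin F x) (h1 : ∀ᶠ y in nhds x, HasDerivAt F (zx y) y)
    (h2 : HasDerivAt zx zxx x) : 0 ≤ zxx := by
  by_contra hneg
  push Not at hneg
  have e1 : deriv F =ᶠ[nhds x] zx := by
    filter_upwards [h1] with y hy using hy.deriv
  have e2 : deriv (deriv F) x = zxx := by
    rw [e1.deriv_eq]; exact h2.deriv
  have hmax : IsLocalMax F x :=
    isLocalMax_of_deriv_deriv_neg (by rw [e2]; exact hneg) hmin.deriv_eq_zero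
      h1.self_of_nhds.continuousAt
  have hc : F =ᶠ[nhds x] fun _ => F x := by
    filter_upwards [hmin, hmax] with y a b using le_antisymm b a
  have e3 : deriv F =ᶠ[nhds x] fun _ => (0:ℝ) := by
    have := hc.deriv
    filter_upwards [this] with y hy
    rw [hy]; simp
  have : deriv (deriv F) x = 0 := by rw [e3.deriv_eq]; simp
  linarith

/-- Strict parabolic comparison principle on a moving domain. -/
theorem parabolic_pos (d t0 t1 : ℝ) (hd : 0 < d) (g h : ℝ → ℝ)
    (hg : ContinuousOn g (Icc t0 t1)) (hh : ContinuousOn h (Icc t0 t1)) (z : ℝ → ℝ → ℝ)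
    (hz : ContinuousOn (fun p : ℝ × ℝ => z p.1 p.2)
      {p : ℝ × ℝ | p.1 ∈ Icc t0 t1 ∧ p.2 ∈ Icc (g p.1) (h p.1)})
    (init : ∀ x ∈ Icc (g t0) (h t0), 0 < z t0 x)
    (lat : ∀ t ∈ Ioc t0 t1, 0 < z t (g t) ∧ 0 < z t (h t))
    (hint : ∀ t ∈ Ioc t0 t1, ∀ x ∈ Ioo (g t) (h t), z t x = 0 →
      ∃ (zt zxx : ℝ) (zx : ℝ → ℝ), HasDerivAt (fun s => z s x) zt t ∧
        (∀ y ∈ Ioo (g t) (h t), HasDerivAt (z t) (zx y) y) ∧ HasDerivAt zx zxx x ∧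
        0 < zt - d * zxx) :
    ∀ t ∈ Icc t0 t1, ∀ x ∈ Icc (g t) (h t), 0 < z t x := by
  set D : Set (ℝ × ℝ) := {p : ℝ × ℝ | p.1 ∈ Icc t0 t1 ∧ p.2 ∈ Icc (g p.1) (h p.1)} with hD
  have hgc : ContinuousOn (fun p : ℝ × ℝ => g p.1) (Icc t0 t1 ×ˢ (univ : Set ℝ)) :=
    hg.comp continuousOn_fst (fun p hp => hp.1)
  have hhc : ContinuousOn (fun p : ℝ × ℝ => h p.1) (Icc t0 t1 ×ˢ (univ : Set ℝ)) :=
    hh.comp continuousOn_fst (fun p hp => hp.1)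
  have hcl : IsClosed (Icc t0 t1 ×ˢ (univ : Set ℝ)) := isClosed_Icc.prod isClosed_univ
  have hDcl : IsClosed D := by
    have c1 := hcl.isClosed_le hgc continuousOn_snd
    have c2 := hcl.isClosed_le continuousOn_snd hhc
    convert c1.inter c2 using 1
    ext p
    simp only [hD, mem_ofPred_eq, mem_inter_iff, mem_prod, mem_univ, and_true, mem_Icc]
    tauto
  obtain ⟨a, ha⟩ := (isCompact_Icc.image_of_continuousOn hg).bddBelow
  obtain ⟨b, hb⟩ := (isCompact_Icc.image_of_continuousOn hh).bddAbove
  have hDc : IsCompact D := by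
    refine ((isCompact_Icc (a := t0) (b := t1)).prod (isCompact_Icc (a := a) (b := b))).of_isClosed_subset hDcl ?_
    rintro ⟨s, y⟩ ⟨hs, hy⟩
    exact ⟨hs, (ha (mem_image_of_mem g hs)).trans hy.1, hy.2.trans (hb (mem_image_of_mem h hs))⟩
  by_contra hcon
  push Not at hcon
  obtain ⟨t', ht', x', hx', hz'⟩ := hcon
  set S : Set (ℝ × ℝ) := {p ∈ D | z p.1 p.2 ≤ 0} with hS
  have hScl : IsClosed S := hDcl.isClosed_le hz continuousOn_const
  have hSc : IsCompact S := hDc.of_isClosed_subset hScl (fun p hp => hp.1)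
  obtain ⟨⟨t, x⟩, ⟨⟨ht, hx⟩, hzle⟩, hmin⟩ := hSc.exists_isMinOn ⟨(t', x'), ⟨ht', hx'⟩, hz'⟩
    (continuousOn_fst (s := S))
  simp only at ht hx hzle
  have hprev : ∀ s ∈ Ico t0 t, ∀ y ∈ Icc (g s) (h s), 0 < z s y := by
    intro s hs y hy
    by_contra hcon
    push Not at hcon
    have hmem : (s, y) ∈ S := ⟨⟨⟨hs.1, hs.2.le.trans ht.2⟩, hy⟩, hcon⟩
    have := hmin hmem
    simp only [mem_ofPred_eq] at this
    linarith [hs.2]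
  have ht0 : t0 < t := by
    rcases eq_or_lt_of_le ht.1 with e | e
    · subst e; linarith [init x hx]
    · exact e
  have htI : t ∈ Ioc t0 t1 := ⟨ht0, ht.2⟩
  have hxI : x ∈ Ioo (g t) (h t) := by
    refine ⟨lt_of_le_of_ne hx.1 ?_, lt_of_le_of_ne hx.2 ?_⟩
    · rintro e; rw [← e] at hzle; linarith [(lat t htI).1]
    · rintro e; rw [e] at hzle; linarith [(lat t htI).2]
  -- nearby earlier times are inside the domain
  have hsub : nhdsWithin t (Iio t) ≤ nhdsWithin t (Icc t0 t1) := by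
    rw [← nhdsWithin_Ioo_eq_nhdsLT ht0]
    exact nhdsWithin_mono _ (fun s hs => ⟨hs.1.le, hs.2.le.trans ht.2⟩)
  have hnear : ∀ y ∈ Ioo (g t) (h t), ∀ᶠ s in nhdsWithin t (Iio t),
      s ∈ Ico t0 t ∧ y ∈ Icc (g s) (h s) := by
    intro y hy
    have A := ((hg t ht).mono_left hsub).eventually (eventually_lt_nhds hy.1)
    have B := ((hh t ht).mono_left hsub).eventually (eventually_gt_nhds hy.2)
    have C : ∀ᶠ s in nhdsWithin t (Iio t), s ∈ Ico t0 t := by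
      rw [← nhdsWithin_Ioo_eq_nhdsLT ht0]
      filter_upwards [self_mem_nhdsWithin] with s hs using ⟨hs.1.le, hs.2⟩
    filter_upwards [A, B, C] with s a b c using ⟨c, a.le, b.le⟩
  have hnn : ∀ y ∈ Ioo (g t) (h t), 0 ≤ z t y := by
    intro y hy
    have hyI : y ∈ Icc (g t) (h t) := ⟨hy.1.le, hy.2.le⟩
    have hcw := hz (t, y) ⟨ht, hyI⟩
    have hlim : Tendsto (fun s : ℝ => (s, y)) (nhdsWithin t (Iio t)) (nhdsWithin (t, y) D) := by
      refine tendsto_nhdsWithin_iff.2 ⟨?_, ?_⟩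
      · exact ((continuous_id.prodMk continuous_const).tendsto t).mono_left nhdsWithin_le_nhds
      · filter_upwards [hnear y hy] with s hs
        exact ⟨⟨hs.1.1, hs.1.2.le.trans ht.2⟩, hs.2⟩
    have hl := hcw.tendsto.comp hlim
    refine ge_of_tendsto hl ?_
    filter_upwards [hnear y hy] with s hs
    exact (hprev s hs.1 y hs.2).le
  have hz0 : z t x = 0 := le_antisymm hzle (hnn x hxI)
  obtain ⟨zt, zxx, zx, d1, d2, d3, hpos⟩ := hint t htI x hxI hz0
  have hIoo : Ioo (g t) (h t) ∈ nhds x := Ioo_mem_nhds hxI.1 hxI.2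
  have hxx : 0 ≤ zxx := by
    refine second_deriv_nonneg_aux (z t) zx x zxx ?_ ?_ d3
    · filter_upwards [hIoo] with y hy
      rw [hz0]; exact hnn y hy
    · filter_upwards [hIoo] with y hy using d2 y hy
  have htt : zt ≤ 0 := by
    have hs := (hasDerivAt_iff_tendsto_slope.1 d1).mono_left
      (nhdsWithin_mono t (s := Iio t) (fun s (hs : s < t) => ne_of_lt hs))
    refine le_of_tendsto hs ?_
    filter_upwards [hnear x hxI] with s hs
    rw [slope_def_field, hz0]
    have := hprev s hs.1 x hs.2
    apply div_nonpos_of_nonneg_of_nonpos <;> linarith [hs.1.2]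
  nlinarith

/-- One-sided derivative sign at a right end point. -/
theorem deriv_right_end (F : ℝ → ℝ) (a b F' : ℝ) (hab : a < b) (hF : HasDerivAt F F' b)
    (hle : ∀ x ∈ Icc a b, F x ≤ F b) : 0 ≤ F' := by
  have hs := (hasDerivAt_iff_tendsto_slope.1 hF).mono_left
    (nhdsWithin_mono b (s := Iio b) (fun s (hs : s < b) => ne_of_lt hs))
  refine ge_of_tendsto hs ?_
  rw [← nhdsWithin_Ioo_eq_nhdsLT hab]
  filter_upwards [self_mem_nhdsWithin] with s hs
  rw [slope_def_field]
  have := hle s ⟨hs.1.le, hs.2.le⟩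
  apply div_nonneg_of_nonpos <;> linarith [hs.2]

/-- One-sided derivative sign at a left end point. -/
theorem deriv_left_end (F : ℝ → ℝ) (a b F' : ℝ) (hab : a < b) (hF : HasDerivAt F F' a)
    (hle : ∀ x ∈ Icc a b, F x ≤ F a) : F' ≤ 0 := by
  have hs := (hasDerivAt_iff_tendsto_slope.1 hF).mono_left
    (nhdsWithin_mono a (s := Ioi a) (fun s (hs : a < s) => ne_of_gt hs))
  refine le_of_tendsto hs ?_
  rw [← nhdsWithin_Ioo_eq_nhdsGT hab]
  filter_upwards [self_mem_nhdsWithin] with s hs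
  rw [slope_def_field]
  have := hle s ⟨hs.1.le, hs.2.le⟩
  apply div_nonpos_of_nonpos_of_nonneg <;> linarith [hs.1]

/-- Comparison principle specialised to `z = σ u + q` for a classical solution. -/
theorem sol_compare {d δ h₀ : ℝ} {f : ℝ → ℝ → ℝ → ℝ} {u₀ : ℝ → ℝ} {u : ℝ → ℝ → ℝ} {g h : ℝ → ℝ}
    (hd : 0 < d) (hsol : ClassicalSolution d δ h₀ f u₀ (Ici (0:ℝ)) u g h)
    (σ t0 t1 : ℝ) (ht0 : 0 ≤ t0) (q qt qx : ℝ → ℝ → ℝ) (qxx : ℝ → ℝ → ℝ)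
    (hq : ContinuousOn (fun p : ℝ × ℝ => q p.1 p.2) {p : ℝ × ℝ | p.1 ∈ Icc t0 t1})
    (hqt : ∀ t ∈ Ioc t0 t1, ∀ x, HasDerivAt (fun s => q s x) (qt t x) t)
    (hqx : ∀ t ∈ Ioc t0 t1, ∀ x, HasDerivAt (q t) (qx t x) x)
    (hqxx : ∀ t ∈ Ioc t0 t1, ∀ x, HasDerivAt (qx t) (qxx t x) x)
    (init : ∀ x ∈ Icc (g t0) (h t0), 0 < σ * u t0 x + q t0 x)
    (lat : ∀ t ∈ Ioc t0 t1, 0 < σ * δ + q t (g t) ∧ 0 < σ * δ + q t (h t))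
    (hint : ∀ t ∈ Ioc t0 t1, ∀ x ∈ Ioo (g t) (h t), σ * u t x + q t x = 0 →
        0 < σ * f t x (u t x) + qt t x - d * qxx t x) :
    ∀ t ∈ Icc t0 t1, ∀ x ∈ Icc (g t) (h t), 0 < σ * u t x + q t x := by
  have hsub : Icc t0 t1 ⊆ Ici (0:ℝ) := fun s hs => ht0.trans hs.1
  refine parabolic_pos d t0 t1 hd g h (hsol.g_reg.continuousOn.mono hsub)
    (hsol.h_reg.continuousOn.mono hsub) (fun t x => σ * u t x + q t x) ?_ init ?_ ?_
  · refine ContinuousOn.add (continuousOn_const.mul (hsol.u_cont.mono ?_)) (hq.mono ?_)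
    · intro p hp; exact ⟨hsub hp.1, hp.2⟩
    · intro p hp; exact hp.1
  · intro t ht
    have h0 : 0 < t := ht0.trans_lt ht.1
    have := lat t ht
    simp only [hsol.bc_g t h0.le h0, hsol.bc_h t h0.le h0]
    exact this
  · intro t ht x hx hzero
    have h0 : 0 < t := ht0.trans_lt ht.1
    have hu1 := (hsol.ut_diff t h0.le h0 x hx).hasDerivAt
    have hu3 := (hsol.uxx_diff t h0.le h0 x hx).hasDerivAt
    refine ⟨_, _, fun y => σ * deriv (u t) y + qx t y, (hu1.const_mul σ).add (hqt t ht x), ?_,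
      (hu3.const_mul σ).add (hqxx t ht x), ?_⟩
    · intro y hy
      exact ((hsol.ux_diff t h0.le h0 y ⟨hy.1.le, hy.2.le⟩).hasDerivAt.const_mul σ).add (hqx t ht y)
    · rw [hsol.pde t h0.le h0 x hx]
      have := hint t ht x hx hzero
      linarith

theorem fbar_bound {f : ℝ → ℝ → ℝ → ℝ} {fbar : ℝ → ℝ} {β : ℝ} (hf : CondF4i f fbar β)
    (a b : ℝ) (ha : 1 < a) (hab : a ≤ b) :
    ∃ c > 0, ∀ v ∈ Icc a b, ∀ t ∈ Ici (0:ℝ), ∀ x : ℝ, f t x v < -c := by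
  obtain ⟨-, -, hc, hb⟩ := hf
  have hsub : Icc a b ⊆ Ici (1:ℝ) := fun v hv => ha.le.trans hv.1
  obtain ⟨v₀, hv₀, hmax⟩ := isCompact_Icc.exists_isMaxOn (nonempty_Icc.2 hab) (hc.mono hsub)
  have hneg : fbar v₀ < 0 := (hb 0 (mem_Ici.2 le_rfl) 0 v₀ (ha.trans_le hv₀.1)).2
  refine ⟨-fbar v₀ / 2, by linarith, ?_⟩
  intro v hv t ht x
  have h1 := (hb t ht x v (ha.trans_le hv.1)).1
  have h2 : fbar v ≤ fbar v₀ := hmax hv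
  linarith

/-- Positivity. -/
theorem sol_pos {d δ h₀ β : ℝ} {f : ℝ → ℝ → ℝ → ℝ} {fbar u₀ : ℝ → ℝ} {u : ℝ → ℝ → ℝ}
    {g h : ℝ → ℝ} (hd : 0 < d) (hh₀ : 0 < h₀) (hδ : 1 < δ) (hf4i : CondF4i f fbar β)
    (hu₀ : InX δ h₀ u₀) (hsol : ClassicalSolution d δ h₀ f u₀ (Ici (0:ℝ)) u g h) :
    ∀ t, 0 ≤ t → ∀ x ∈ Icc (g t) (h t), 0 < u t x := by
  obtain ⟨hreg, -, -, hpos⟩ := hu₀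
  obtain ⟨x₀, hx₀, hmin⟩ := isCompact_Icc.exists_isMinOn
    (nonempty_Icc.2 (by linarith : -h₀ ≤ h₀)) hreg.continuousOn
  have hp0 := hpos x₀ hx₀
  set m := min (u₀ x₀) δ / 2 with hm
  have hmpos : 0 < m := by
    have : 0 < min (u₀ x₀) δ := lt_min hp0 (by linarith)
    linarith
  have hm1 : m < u₀ x₀ := by linarith [min_le_left (u₀ x₀) δ]
  have hm2 : m < δ := by linarith [min_le_right (u₀ x₀) δ]
  obtain ⟨⟨-, -, -, hf0, hLip⟩, -, -, -⟩ := hf4i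
  obtain ⟨L, hL, hLip⟩ := hLip δ (by linarith)
  have hexp : ∀ t, 0 ≤ t → m * Real.exp (-(L + 1) * t) ≤ m := by
    intro t ht
    have : Real.exp (-(L + 1) * t) ≤ 1 := Real.exp_le_one_iff.2 (by nlinarith)
    nlinarith
  intro t ht x hx
  have key := sol_compare hd hsol 1 0 t le_rfl
    (fun s _ => -(m * Real.exp (-(L + 1) * s)))
    (fun s _ => (L + 1) * (m * Real.exp (-(L + 1) * s))) (fun _ _ => 0) (fun _ _ => 0)
    (by fun_prop)
    (by
      intro s _ y
      have h1 : HasDerivAt (fun s : ℝ => -(L + 1) * s) (-(L + 1)) s := by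
        simpa using (hasDerivAt_id s).const_mul (-(L + 1))
      refine HasDerivAt.congr_deriv ((h1.exp.const_mul m).neg) ?_
      ring)
    (by intro s _ y; exact hasDerivAt_const _ _)
    (by intro s _ y; exact hasDerivAt_const _ _)
    (by
      intro y hy
      rw [hsol.g_init, hsol.h_init] at hy
      rw [hsol.u_init y hy]
      have : u₀ x₀ ≤ u₀ y := hmin hy
      simp
      linarith)
    (by
      intro s hs
      have := hexp s hs.1.le
      constructor <;> linarith)
    (by
      intro s hs y hy hz
      have he := Real.exp_pos (-(L + 1) * s)
      have hme : 0 < m * Real.exp (-(L + 1) * s) := mul_pos hmpos he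
      have hu : u s y = m * Real.exp (-(L + 1) * s) := by linarith
      have hle := hexp s hs.1.le
      have hF := hLip s hs.1.le y (u s y) ⟨by linarith, by linarith⟩ 0 ⟨le_rfl, by linarith⟩
      have hup : 0 < u s y := by rw [hu]; exact hme
      rw [hf0 s hs.1.le y, sub_zero, sub_zero, abs_of_pos hup] at hF
      have := (abs_le.1 hF).1
      rw [← hu]
      rw [← hu] at hme
      linarith)
    t ⟨ht, le_rfl⟩ x hx
  have := mul_pos hmpos (Real.exp_pos (-(L + 1) * t))
  linarith

/-- After a finite time `u ≤ δ`. -/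
theorem sol_le {d δ h₀ β : ℝ} {f : ℝ → ℝ → ℝ → ℝ} {fbar u₀ : ℝ → ℝ} {u : ℝ → ℝ → ℝ}
    {g h : ℝ → ℝ} (hd : 0 < d) (hh₀ : 0 < h₀) (hδ : 1 < δ) (hf4i : CondF4i f fbar β)
    (hu₀ : InX δ h₀ u₀) (hsol : ClassicalSolution d δ h₀ f u₀ (Ici (0:ℝ)) u g h) :
    ∃ T > 0, ∀ t, T ≤ t → ∀ x ∈ Icc (g t) (h t), u t x ≤ δ := by
  obtain ⟨hreg, -, -, hpos⟩ := hu₀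
  obtain ⟨x₀, hx₀, hmax⟩ := isCompact_Icc.exists_isMaxOn
    (nonempty_Icc.2 (by linarith : -h₀ ≤ h₀)) hreg.continuousOn
  set M := max (u₀ x₀) δ + 1 with hM
  have hM1 : u₀ x₀ < M := by linarith [le_max_left (u₀ x₀) δ]
  have hM2 : δ + 1 ≤ M := by linarith [le_max_right (u₀ x₀) δ]
  obtain ⟨c, hc, hfc⟩ := fbar_bound hf4i δ M hδ (by linarith)
  refine ⟨(M - δ) / c, div_pos (by linarith) hc, ?_⟩
  intro t ht x hx
  refine le_of_forall_pos_lt_add ?_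
  intro ε' hε'
  set ε := min ε' 1 with hε
  have hεp : 0 < ε := lt_min hε' one_pos
  have hε1 : ε ≤ 1 := min_le_right _ _
  have hε2 : ε ≤ ε' := min_le_left _ _
  set T := (M - δ - ε) / c with hT
  have hT0 : 0 ≤ T := div_nonneg (by linarith) hc.le
  have hcT : c * T = M - δ - ε := by rw [hT]; field_simp
  have hTt : T ≤ t := by
    refine le_trans ?_ ht
    rw [hT]; exact div_le_div_of_nonneg_right (by linarith) hc.le
  have key1 := sol_compare hd hsol (-1) 0 T le_rfl
    (fun s _ => M - c * s) (fun s _ => -c) (fun _ _ => 0) (fun _ _ => 0)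
    (by fun_prop)
    (by
      intro s _ y
      simpa using ((hasDerivAt_id s).const_mul c).const_sub M)
    (by intro s _ y; exact hasDerivAt_const _ _)
    (by intro s _ y; exact hasDerivAt_const _ _)
    (by
      intro y hy
      rw [hsol.g_init, hsol.h_init] at hy
      rw [hsol.u_init y hy]
      have : u₀ y ≤ u₀ x₀ := hmax hy
      linarith)
    (by
      intro s hs
      have : c * s ≤ c * T := by gcongr; exact hs.2
      constructor <;> linarith)
    (by
      intro s hs y hy hz
      have h1 : c * s ≤ c * T := by gcongr; exact hs.2
      have h2 : 0 ≤ c * s := mul_nonneg hc.le hs.1.le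
      have := hfc (u s y) ⟨by linarith, by linarith⟩ s hs.1.le y
      linarith)
  have key2 := sol_compare hd hsol (-1) T t hT0
    (fun s _ => δ + ε) (fun s _ => 0) (fun _ _ => 0) (fun _ _ => 0)
    (by fun_prop)
    (by intro s _ y; exact hasDerivAt_const _ _)
    (by intro s _ y; exact hasDerivAt_const _ _)
    (by intro s _ y; exact hasDerivAt_const _ _)
    (by
      intro y hy
      have := key1 T ⟨hT0, le_rfl⟩ y hy
      linarith)
    (by intro s hs; constructor <;> linarith)
    (by
      intro s hs y hy hz
      have := hfc (u s y) ⟨by linarith, by linarith⟩ s (hT0.trans hs.1.le) y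
      linarith)
    t ⟨hTt, le_rfl⟩ x hx
  linarith

/-- Differentiability of the free boundaries. -/
theorem sol_bdry {d δ h₀ : ℝ} {f : ℝ → ℝ → ℝ → ℝ} {u₀ : ℝ → ℝ} {u : ℝ → ℝ → ℝ}
    {g h : ℝ → ℝ} (hsol : ClassicalSolution d δ h₀ f u₀ (Ici (0:ℝ)) u g h) (t : ℝ) (ht : 0 < t) :
    HasDerivAt g (deriv g t) t ∧ HasDerivAt h (deriv h t) t :=
  ⟨(((hsol.g_reg t ht.le).differentiableWithinAt one_ne_zero).differentiableAt
      (Ici_mem_nhds ht)).hasDerivAt,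
   (((hsol.h_reg t ht.le).differentiableWithinAt one_ne_zero).differentiableAt
      (Ici_mem_nhds ht)).hasDerivAt⟩

/-- Quantitative Hopf step. -/
theorem sol_hopf {d δ h₀ β : ℝ} {f : ℝ → ℝ → ℝ → ℝ} {fbar u₀ : ℝ → ℝ} {u : ℝ → ℝ → ℝ}
    {g h : ℝ → ℝ} (hd : 0 < d) (hδ : 1 < δ) (hf4i : CondF4i f fbar β)
    (hsol : ClassicalSolution d δ h₀ f u₀ (Ici (0:ℝ)) u g h)
    (T : ℝ) (hT : 0 < T) (hle : ∀ t, T ≤ t → ∀ x ∈ Icc (g t) (h t), u t x ≤ δ)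
    (hg' : ∀ t, T ≤ t → 0 ≤ deriv g t) (hh' : ∀ t, T ≤ t → deriv h t ≤ 0)
    (hgm : MonotoneOn g (Ici T)) (hhm : AntitoneOn h (Ici T)) :
    ∃ e > 0, ∀ t, T + 1 ≤ t → ∀ x ∈ Icc (g t) (h t), u t x ≤ δ - e * ((x - g t) * (h t - x)) := by
  set η := (δ - 1) / 2 with hη
  have hηp : 0 < η := by linarith
  obtain ⟨c, hc, hfc⟩ := fbar_bound hf4i (δ - η) (δ + 1) (by linarith) (by linarith)
  set l := h T - g T with hl
  have hlp : 0 < l := by linarith [hsol.g_lt_h T hT.le]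
  set k := l ^ 2 + 2 * d with hk
  have hkp : 0 < k := by positivity
  set ε := min (c / k) (η / k) with hε
  have hεp : 0 < ε := lt_min (by positivity) (by positivity)
  have hε1 : ε * k ≤ c := by
    have : ε ≤ c / k := min_le_left _ _
    rwa [le_div_iff₀ hkp] at this
  have hε2 : ε * k ≤ η := by
    have : ε ≤ η / k := min_le_right _ _
    rwa [le_div_iff₀ hkp] at this
  have hε3 : ε * l ^ 2 ≤ ε * k := by gcongr; linarith
  -- the product is between `0` and `l ^ 2`
  have hprod : ∀ t, T ≤ t → ∀ x ∈ Icc (g t) (h t),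
      0 ≤ (x - g t) * (h t - x) ∧ (x - g t) * (h t - x) ≤ l ^ 2 := by
    intro t ht x hx
    have h1 : g T ≤ g t := hgm (mem_Ici.2 le_rfl) ht ht
    have h2 : h t ≤ h T := hhm (mem_Ici.2 le_rfl) ht ht
    have a1 : 0 ≤ x - g t := by linarith [hx.1]
    have a2 : 0 ≤ h t - x := by linarith [hx.2]
    refine ⟨mul_nonneg a1 a2, ?_⟩
    have a3 : x - g t ≤ l := by linarith [hx.2]
    have a4 : h t - x ≤ l := by linarith [hx.1]
    rw [sq]; exact mul_le_mul a3 a4 a2 hlp.le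
  set S : ℝ → ℝ := fun t => 1 - Real.exp (-(t - T)) with hSdef
  have hS0 : ∀ t, T ≤ t → 0 ≤ S t := by
    intro t ht
    have : Real.exp (-(t - T)) ≤ 1 := Real.exp_le_one_iff.2 (by linarith)
    simp only [hSdef]; linarith
  have hS1 : ∀ t, S t ≤ 1 := by
    intro t
    have := Real.exp_pos (-(t - T))
    simp only [hSdef]; linarith
  have hSd : ∀ t, HasDerivAt S (Real.exp (-(t - T))) t := by
    intro t
    have h1 : HasDerivAt (fun t : ℝ => -(t - T)) (-1) t := by
      exact ((hasDerivAt_id t).sub_const T).neg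
    exact HasDerivAt.congr_deriv (h1.exp.const_sub 1) (by ring)
  have hSc : Continuous S := by simp only [hSdef]; fun_prop
  have main : ∀ ρ, 0 < ρ → ρ ≤ 1 → ∀ t, T ≤ t → ∀ x ∈ Icc (g t) (h t),
      u t x < δ + ρ - S t * (ε * ((x - g t) * (h t - x))) := by
    intro ρ hρ hρ1 t ht x hx
    have hsub : Icc T t ⊆ Ici (0:ℝ) := fun s hs => hT.le.trans hs.1
    have hgc : ContinuousOn (fun p : ℝ × ℝ => g p.1) {p : ℝ × ℝ | p.1 ∈ Icc T t} :=
      (hsol.g_reg.continuousOn.mono hsub).comp continuousOn_fst (fun p hp => hp)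
    have hhc : ContinuousOn (fun p : ℝ × ℝ => h p.1) {p : ℝ × ℝ | p.1 ∈ Icc T t} :=
      (hsol.h_reg.continuousOn.mono hsub).comp continuousOn_fst (fun p hp => hp)
    have hScc : ContinuousOn (fun p : ℝ × ℝ => S p.1) {p : ℝ × ℝ | p.1 ∈ Icc T t} :=
      hSc.comp_continuousOn continuousOn_fst
    have key := sol_compare hd hsol (-1) T t hT.le
      (fun s y => δ + ρ - S s * (ε * ((y - g s) * (h s - y))))
      (fun s y => -(Real.exp (-(s - T)) * (ε * ((y - g s) * (h s - y))) +
        S s * (ε * (-deriv g s * (h s - y) + (y - g s) * deriv h s))))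
      (fun s y => -(S s * (ε * ((h s - y) - (y - g s)))))
      (fun s _ => 2 * (S s * ε))
      (by
        refine continuousOn_const.sub (hScc.mul (continuousOn_const.mul ?_))
        exact (continuousOn_snd.sub hgc).mul (hhc.sub continuousOn_snd))
      (by
        intro s hs y
        obtain ⟨b1, b2⟩ := sol_bdry hsol s (hT.trans hs.1)
        exact ((hSd s).mul (((b1.const_sub y).mul (b2.sub_const y)).const_mul ε)).const_sub (δ + ρ))
      (by
        intro s hs y
        have h1 := (((hasDerivAt_id y).sub_const (g s)).mul
          ((hasDerivAt_id y).const_sub (h s))).const_mul ε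
        have h2 := (h1.const_mul (S s)).const_sub (δ + ρ)
        refine HasDerivAt.congr_deriv (h2) ?_
        simp only [id]
        ring)
      (by
        intro s hs y
        have h1 := ((hasDerivAt_id y).const_sub (h s)).sub ((hasDerivAt_id y).sub_const (g s))
        have h2 := ((h1.const_mul ε).const_mul (S s)).neg
        refine HasDerivAt.congr_deriv (h2) ?_
        ring)
      (by
        intro y hy
        have := hle T le_rfl y hy
        simp [hSdef]
        linarith)
      (by intro s hs; constructor <;> simp <;> linarith)
      (by
        intro s hs y hy hz
        have hyI : y ∈ Icc (g s) (h s) := ⟨hy.1.le, hy.2.le⟩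
        obtain ⟨p1, p2⟩ := hprod s hs.1.le y hyI
        have s0 := hS0 s hs.1.le
        have s1 := hS1 s
        have q1 : 0 ≤ ε * ((y - g s) * (h s - y)) := mul_nonneg hεp.le p1
        have q2 : ε * ((y - g s) * (h s - y)) ≤ ε * l ^ 2 := by gcongr
        have r1 : 0 ≤ S s * (ε * ((y - g s) * (h s - y))) := mul_nonneg s0 q1
        have r2 : S s * (ε * ((y - g s) * (h s - y))) ≤ ε * l ^ 2 := by nlinarith
        have hF := hfc (u s y) ⟨by linarith, by linarith⟩ s (hT.le.trans hs.1.le) y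
        have e1 : Real.exp (-(s - T)) ≤ 1 := Real.exp_le_one_iff.2 (by linarith [hs.1])
        have e0 := Real.exp_pos (-(s - T))
        have r3 : Real.exp (-(s - T)) * (ε * ((y - g s) * (h s - y))) ≤ ε * l ^ 2 := by nlinarith
        have m1 : 0 ≤ deriv g s * (h s - y) :=
          mul_nonneg (hg' s hs.1.le) (by linarith [hy.2])
        have m2 : (y - g s) * deriv h s ≤ 0 :=
          mul_nonpos_of_nonneg_of_nonpos (by linarith [hy.1]) (hh' s hs.1.le)
        have r4 : S s * (ε * (-deriv g s * (h s - y) + (y - g s) * deriv h s)) ≤ 0 :=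
          mul_nonpos_of_nonneg_of_nonpos s0
            (mul_nonpos_of_nonneg_of_nonpos hεp.le (by linarith))
        have r5 : d * (2 * (S s * ε)) ≤ ε * (2 * d) := by
          have : S s * (ε * (2 * d)) ≤ 1 * (ε * (2 * d)) := by gcongr
          linarith
        have : ε * k = ε * l ^ 2 + ε * (2 * d) := by rw [hk]; ring
        linarith)
      t ⟨ht, le_rfl⟩ x hx
    linarith
  refine ⟨ε / 2, by linarith, ?_⟩
  intro t ht x hx
  have htT : T ≤ t := by linarith
  have hhalf : 1 / 2 ≤ S t := by
    have h1 : Real.exp (-(t - T)) ≤ Real.exp (-1) := Real.exp_le_exp.2 (by linarith)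
    have h2 := Real.exp_neg_one_lt_d9
    simp only [hSdef]
    have h3 : Real.exp (-1) ≤ 1 / 2 := by linarith
    linarith
  have p1 := (hprod t htT x hx).1
  have h1 : u t x ≤ δ - S t * (ε * ((x - g t) * (h t - x))) := by
    refine le_of_forall_pos_lt_add ?_
    intro ρ hρ
    have := main (min ρ 1) (lt_min hρ one_pos) (min_le_right _ _) t htT x hx
    linarith [min_le_left ρ 1]
  have : 1 / 2 * (ε * ((x - g t) * (h t - x))) ≤ S t * (ε * ((x - g t) * (h t - x))) := by
    gcongr
  linarith

/-- Smallness of `δ - u` on short intervals. -/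
theorem sol_lower {d δ h₀ β : ℝ} {f : ℝ → ℝ → ℝ → ℝ} {fbar u₀ : ℝ → ℝ} {u : ℝ → ℝ → ℝ}
    {g h : ℝ → ℝ} (hd : 0 < d) (hδ : 1 < δ) (hf4i : CondF4i f fbar β)
    (hsol : ClassicalSolution d δ h₀ f u₀ (Ici (0:ℝ)) u g h)
    (hpos : ∀ t, 0 ≤ t → ∀ x ∈ Icc (g t) (h t), 0 < u t x)
    (T : ℝ) (hT : 0 < T) (hle : ∀ t, T ≤ t → ∀ x ∈ Icc (g t) (h t), u t x ≤ δ)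
    (hgm : MonotoneOn g (Ici T)) (hhm : AntitoneOn h (Ici T)) :
    ∃ K > 0, ∀ t1, T ≤ t1 → ∃ μ > 0, ∀ t, t1 ≤ t → ∀ x ∈ Icc (g t) (h t),
      δ - u t x ≤ K * (h t1 - g t1) ^ 2 + 2 * δ * Real.exp (-μ * (t - t1)) := by
  obtain ⟨⟨-, -, -, hf0, hLip⟩, -, -, -⟩ := hf4i
  obtain ⟨L, hL, hLip⟩ := hLip δ (by linarith)
  set K := L * δ + 1 with hK
  have hKp : 0 < K := by positivity
  refine ⟨K / d, by positivity, ?_⟩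
  intro t1 ht1
  set l := h t1 - g t1 with hl
  have ht10 : 0 < t1 := hT.trans_le ht1
  have hlp : 0 < l := by linarith [hsol.g_lt_h t1 ht10.le]
  set μ := d / l ^ 2 with hμ
  have hμp : 0 < μ := by positivity
  have hμl : μ * l ^ 2 = d := by rw [hμ]; field_simp
  refine ⟨μ, hμp, ?_⟩
  set A : ℝ → ℝ := fun s => K / (2 * d) + δ / l ^ 2 * Real.exp (-μ * (s - t1)) with hA
  have hAd : ∀ s, HasDerivAt A (-μ * (δ / l ^ 2 * Real.exp (-μ * (s - t1)))) s := by
    intro s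
    have h1 : HasDerivAt (fun s : ℝ => -μ * (s - t1)) (-μ) s := by
      simpa using ((hasDerivAt_id s).sub_const t1).const_mul (-μ)
    refine HasDerivAt.congr_deriv ((h1.exp.const_mul (δ / l ^ 2)).const_add (K / (2 * d))) ?_
    ring
  have hAc : Continuous A := by simp only [hA]; fun_prop
  have hAp : ∀ s, 0 < A s := by
    intro s
    have := Real.exp_pos (-μ * (s - t1))
    simp only [hA]; positivity
  have hp : ∀ s, t1 ≤ s → ∀ y ∈ Icc (g s) (h s),
      l ^ 2 ≤ 2 * l ^ 2 - (y - g t1) ^ 2 ∧ 2 * l ^ 2 - (y - g t1) ^ 2 ≤ 2 * l ^ 2 := by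
    intro s hs y hy
    have h1 : g t1 ≤ g s := hgm ht1 (ht1.trans hs) hs
    have h2 : h s ≤ h t1 := hhm ht1 (ht1.trans hs) hs
    have a1 : 0 ≤ y - g t1 := by linarith [hy.1]
    have a2 : y - g t1 ≤ l := by linarith [hy.2]
    constructor <;> nlinarith
  intro t ht x hx
  have key := sol_compare hd hsol 1 t1 t ht10.le
    (fun s y => -δ + A s * (2 * l ^ 2 - (y - g t1) ^ 2))
    (fun s y => -μ * (δ / l ^ 2 * Real.exp (-μ * (s - t1))) * (2 * l ^ 2 - (y - g t1) ^ 2))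
    (fun s y => -(A s * (2 * (y - g t1))))
    (fun s _ => -(A s * 2))
    (by fun_prop)
    (by
      intro s hs y
      exact ((hAd s).mul_const _).const_add (-δ))
    (by
      intro s hs y
      have h1 := (((((hasDerivAt_id y).sub_const (g t1)).pow 2).const_sub
        (2 * l ^ 2)).const_mul (A s)).const_add (-δ)
      refine HasDerivAt.congr_deriv (h1) ?_
      simp)
    (by
      intro s hs y
      have h1 := ((((hasDerivAt_id y).sub_const (g t1)).const_mul 2).const_mul (A s)).neg
      refine HasDerivAt.congr_deriv (h1) ?_
      simp)
    (by
      intro y hy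
      have h1 := hpos t1 ht10.le y hy
      have h2 := (hp t1 le_rfl y hy).1
      have h3 : δ ≤ A t1 * (2 * l ^ 2 - (y - g t1) ^ 2) := by
        have h4 : δ / l ^ 2 ≤ A t1 := by
          simp only [hA, sub_self, mul_zero, Real.exp_zero, mul_one]
          linarith [show 0 < K / (2 * d) by positivity]
        calc δ = δ / l ^ 2 * l ^ 2 := by field_simp
          _ ≤ _ := mul_le_mul h4 h2 (by positivity) (hAp t1).le
      linarith)
    (by
      intro s hs
      have hgh := (hsol.g_lt_h s (ht10.le.trans hs.1.le)).le
      have h1 := (hp s hs.1.le (g s) ⟨le_rfl, hgh⟩).1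
      have h2 := (hp s hs.1.le (h s) ⟨hgh, le_rfl⟩).1
      have hl2 : 0 < l ^ 2 := by positivity
      have h3 := mul_pos (hAp s) (hl2.trans_le h1)
      have h4 := mul_pos (hAp s) (hl2.trans_le h2)
      constructor <;> linarith)
    (by
      intro s hs y hy hz
      have hyI : y ∈ Icc (g s) (h s) := ⟨hy.1.le, hy.2.le⟩
      have hs0 : 0 ≤ s := ht10.le.trans hs.1.le
      have hu0 := hpos s hs0 y hyI
      have hu1 := hle s (ht1.trans hs.1.le) y hyI
      have hF := hLip s hs0 y (u s y) ⟨hu0.le, hu1⟩ 0 ⟨le_rfl, by linarith⟩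
      rw [hf0 s hs0 y, sub_zero, sub_zero, abs_of_pos hu0] at hF
      have hF1 := (abs_le.1 hF).1
      have hF2 : L * u s y ≤ L * δ := by gcongr
      have hE : 0 < δ / l ^ 2 * Real.exp (-μ * (s - t1)) := by
        have := Real.exp_pos (-μ * (s - t1))
        positivity
      have h2 := (hp s hs.1.le y hyI).2
      have h5 : μ * (2 * l ^ 2 - (y - g t1) ^ 2) ≤ 2 * d := by
        have := mul_le_mul_of_nonneg_left h2 hμp.le
        linarith
      have h6 := mul_le_mul_of_nonneg_left h5 hE.le
      have h7 : d * (A s * 2) = K + 2 * d * (δ / l ^ 2 * Real.exp (-μ * (s - t1))) := by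
        simp only [hA]; field_simp
      linarith)
    t ⟨ht, le_rfl⟩ x hx
  have h2 := (hp t ht x hx).2
  have h3 := mul_le_mul_of_nonneg_left h2 (hAp t).le
  have h4 : A t * (2 * l ^ 2) = K / d * l ^ 2 + 2 * δ * Real.exp (-μ * (t - t1)) := by
    simp only [hA]; field_simp
  linarith

/-- Theorem 3.2, vanishing when `δ > 1`. -/
theorem vanishing_delta_gt_one (d δ h₀ β : ℝ) (f : ℝ → ℝ → ℝ → ℝ)
    (fbar u₀ : ℝ → ℝ) (u : ℝ → ℝ → ℝ) (g h : ℝ → ℝ)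
    (hd : 0 < d) (hh₀ : 0 < h₀) (hδ : 1 < δ)
    (hf4i : CondF4i f fbar β)
    (hHolder : ∃ C > 0, ∀ t₁ ∈ Ici (0:ℝ), ∀ t₂ ∈ Ici (0:ℝ), ∀ x : ℝ,
      ∀ v ∈ Icc (0:ℝ) δ, |f t₁ x v - f t₂ x v| ≤ C * |t₁ - t₂| ^ (β / 2))
    (hu₀ : InX δ h₀ u₀)
    (hsol : ClassicalSolution d δ h₀ f u₀ (Ici (0:ℝ)) u g h) :
    ∃ ξ : ℝ, Tendsto g atTop (nhds ξ) ∧ Tendsto h atTop (nhds ξ) ∧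
      ∀ ε > 0, ∃ T > 0, ∀ t ≥ T, ∀ x ∈ Icc (g t) (h t), |u t x - δ| < ε := by
  have hpos := sol_pos hd hh₀ hδ hf4i hu₀ hsol
  obtain ⟨T, hT, hle⟩ := sol_le hd hh₀ hδ hf4i hu₀ hsol
  have hdδ : 0 < d / δ := div_pos hd (by linarith)
  have hux : ∀ t, T ≤ t → ∀ x ∈ Icc (g t) (h t), HasDerivAt (u t) (deriv (u t) x) x :=
    fun t ht x hx => (hsol.ux_diff t (hT.le.trans ht) (hT.trans_le ht) x hx).hasDerivAt
  have hgh : ∀ t, T ≤ t → g t < h t := fun t ht => hsol.g_lt_h t (hT.le.trans ht)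
  have hbg : ∀ t, T ≤ t → u t (g t) = δ :=
    fun t ht => hsol.bc_g t (hT.le.trans ht) (hT.trans_le ht)
  have hbh : ∀ t, T ≤ t → u t (h t) = δ :=
    fun t ht => hsol.bc_h t (hT.le.trans ht) (hT.trans_le ht)
  have hg' : ∀ t, T ≤ t → 0 ≤ deriv g t := by
    intro t ht
    rw [hsol.stefan_g t (hT.le.trans ht) (hT.trans_le ht)]
    have := deriv_left_end (u t) (g t) (h t) _ (hgh t ht)
      (hux t ht (g t) ⟨le_rfl, (hgh t ht).le⟩)
      (fun x hx => by rw [hbg t ht]; exact hle t ht x hx)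
    nlinarith
  have hh' : ∀ t, T ≤ t → deriv h t ≤ 0 := by
    intro t ht
    rw [hsol.stefan_h t (hT.le.trans ht) (hT.trans_le ht)]
    have := deriv_right_end (u t) (g t) (h t) _ (hgh t ht)
      (hux t ht (h t) ⟨(hgh t ht).le, le_rfl⟩)
      (fun x hx => by rw [hbh t ht]; exact hle t ht x hx)
    nlinarith
  have hdg : ∀ t, T ≤ t → HasDerivAt g (deriv g t) t :=
    fun t ht => (sol_bdry hsol t (hT.trans_le ht)).1
  have hdh : ∀ t, T ≤ t → HasDerivAt h (deriv h t) t :=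
    fun t ht => (sol_bdry hsol t (hT.trans_le ht)).2
  have hgm : MonotoneOn g (Ici T) := by
    refine monotoneOn_of_deriv_nonneg (convex_Ici T)
      (fun t ht => (hdg t ht).continuousAt.continuousWithinAt)
      (fun t ht => ?_) (fun t ht => ?_)
    · exact (hdg t (interior_subset ht)).differentiableAt.differentiableWithinAt
    · exact hg' t (interior_subset ht)
  have hhm : AntitoneOn h (Ici T) := by
    refine antitoneOn_of_deriv_nonpos (convex_Ici T)
      (fun t ht => (hdh t ht).continuousAt.continuousWithinAt)
      (fun t ht => ?_) (fun t ht => ?_)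
    · exact (hdh t (interior_subset ht)).differentiableAt.differentiableWithinAt
    · exact hh' t (interior_subset ht)
  obtain ⟨e, he, hopf⟩ := sol_hopf hd hδ hf4i hsol T hT hle hg' hh' hgm hhm
  set k := 2 * (d / δ) * e with hk
  have hkp : 0 < k := by positivity
  have hlen : ∀ t, T + 1 ≤ t → deriv h t - deriv g t ≤ -k * (h t - g t) := by
    intro t ht
    have htT : T ≤ t := by linarith
    have hgI : g t ∈ Icc (g t) (h t) := ⟨le_rfl, (hgh t htT).le⟩
    have hhI : h t ∈ Icc (g t) (h t) := ⟨(hgh t htT).le, le_rfl⟩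
    have hD : ∀ x ∈ Icc (g t) (h t), HasDerivAt
        (fun y => u t y + e * ((y - g t) * (h t - y)))
        (deriv (u t) x + e * ((h t - x) - (x - g t))) x := by
      intro x hx
      have h1 := (((hasDerivAt_id x).sub_const (g t)).mul
          ((hasDerivAt_id x).const_sub (h t))).const_mul e
      refine HasDerivAt.congr_deriv ((hux t htT x hx).add h1) ?_
      simp only [id]
      ring
    have a1 := deriv_left_end _ (g t) (h t) _ (hgh t htT) (hD _ hgI) (by
      intro x hx
      have := hopf t ht x hx
      simp only [hbg t htT, sub_self, zero_mul, mul_zero, add_zero]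
      linarith)
    have a2 := deriv_right_end _ (g t) (h t) _ (hgh t htT) (hD _ hhI) (by
      intro x hx
      have := hopf t ht x hx
      simp only [hbh t htT, sub_self, mul_zero, add_zero]
      linarith)
    rw [hsol.stefan_g t (hT.le.trans htT) (hT.trans_le htT),
      hsol.stefan_h t (hT.le.trans htT) (hT.trans_le htT)]
    have b1 : deriv (u t) (g t) ≤ -(e * (h t - g t)) := by linarith
    have b2 : e * (h t - g t) ≤ deriv (u t) (h t) := by linarith
    have c1 := mul_le_mul_of_nonneg_left b1 hdδ.le
    have c2 := mul_le_mul_of_nonneg_left b2 hdδ.le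
    rw [hk]
    linarith
  -- exponential decay of the length
  have hdec : AntitoneOn (fun t => (h t - g t) * Real.exp (k * t)) (Ici (T + 1)) := by
    have hder : ∀ t ∈ Ici (T + 1), HasDerivAt (fun t => (h t - g t) * Real.exp (k * t))
        ((deriv h t - deriv g t) * Real.exp (k * t) + (h t - g t) * (Real.exp (k * t) * k)) t := by
      intro t ht
      have htT : T ≤ t := by linarith [mem_Ici.1 ht]
      have h1 : HasDerivAt (fun t : ℝ => k * t) k t := by
        simpa using (hasDerivAt_id t).const_mul k
      exact ((hdh t htT).sub (hdg t htT)).mul h1.exp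
    refine antitoneOn_of_deriv_nonpos (convex_Ici _)
      (fun t ht => (hder t ht).continuousAt.continuousWithinAt)
      (fun t ht => (hder t (interior_subset ht)).differentiableAt.differentiableWithinAt)
      (fun t ht => ?_)
    rw [(hder t (interior_subset ht)).deriv]
    have h1 := hlen t (interior_subset ht)
    have h2 := mul_le_mul_of_nonneg_right h1 (Real.exp_pos (k * t)).le
    linarith
  have hl0 : Tendsto (fun t => h t - g t) atTop (nhds 0) := by
    set C := (h (T + 1) - g (T + 1)) * Real.exp (k * (T + 1)) with hC
    have hlim : Tendsto (fun t => C * Real.exp (-(k * t))) atTop (nhds 0) := by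
      have : Tendsto (fun t => Real.exp (-(k * t))) atTop (nhds 0) :=
        Real.tendsto_exp_neg_atTop_nhds_zero.comp (tendsto_id.const_mul_atTop hkp)
      simpa using this.const_mul C
    refine squeeze_zero' ?_ ?_ hlim
    · filter_upwards [eventually_ge_atTop T] with t ht
      linarith [hgh t ht]
    · filter_upwards [eventually_ge_atTop (T + 1)] with t ht
      have := hdec (mem_Ici.2 le_rfl) ht ht
      simp only at this
      rw [Real.exp_neg, ← div_eq_mul_inv, le_div_iff₀ (Real.exp_pos _)]
      exact this
  -- convergence of `g`
  obtain ⟨ξ, hξ⟩ : ∃ ξ, Tendsto g atTop (nhds ξ) := by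
    have hmono : Monotone (fun t => g (max T t)) := fun a b hab =>
      hgm (mem_Ici.2 (le_max_left _ _)) (mem_Ici.2 (le_max_left _ _)) (max_le_max le_rfl hab)
    have hbdd : BddAbove (range (fun t => g (max T t))) := by
      refine ⟨h T, ?_⟩
      rintro _ ⟨t, rfl⟩
      have h1 := hgh (max T t) (le_max_left _ _)
      have h2 : h (max T t) ≤ h T := hhm (mem_Ici.2 le_rfl) (mem_Ici.2 (le_max_left _ _)) (le_max_left _ _)
      simp only
      linarith
    refine ⟨_, (tendsto_atTop_ciSup hmono hbdd).congr' ?_⟩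
    filter_upwards [eventually_ge_atTop T] with t ht
    rw [max_eq_right ht]
  refine ⟨ξ, hξ, ?_, ?_⟩
  · have := hl0.add hξ
    simpa using this
  intro ε hε
  obtain ⟨K, hK, hlow⟩ := sol_lower hd hδ hf4i hsol hpos T hT hle hgm hhm
  have hsq : Tendsto (fun t => K * (h t - g t) ^ 2) atTop (nhds 0) := by
    simpa using (hl0.pow 2).const_mul K
  obtain ⟨t1, ht1, ht1T⟩ := ((hsq.eventually (gt_mem_nhds (half_pos hε))).and
    (eventually_ge_atTop T)).exists
  obtain ⟨μ, hμ, hlow⟩ := hlow t1 ht1T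
  have hexp : Tendsto (fun t => 2 * δ * Real.exp (-μ * (t - t1))) atTop (nhds 0) := by
    have h1 : Tendsto (fun t : ℝ => μ * (t - t1)) atTop atTop :=
      (tendsto_atTop_add_const_right atTop (-t1) tendsto_id).const_mul_atTop hμ
    have h2 := (Real.tendsto_exp_neg_atTop_nhds_zero.comp h1).const_mul (2 * δ)
    simpa [Function.comp_def] using h2
  obtain ⟨T2, hT2⟩ := eventually_atTop.1 (hexp.eventually (gt_mem_nhds (half_pos hε)))
  refine ⟨max T2 t1, lt_of_lt_of_le (hT.trans_le ht1T) (le_max_right _ _), ?_⟩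
  intro t ht x hx
  have a1 : t1 ≤ t := (le_max_right _ _).trans ht
  have a2 := hT2 t ((le_max_left _ _).trans ht)
  have a3 := hlow t a1 x hx
  have a4 := hle t (ht1T.trans a1) x hx
  rw [abs_lt]
  constructor <;> linarith
end
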